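/- arXiv:1105.3643 — 2 statements merged into one kernel-verified Lean document; each statement's English description precedes it below -/
import Mathlib

section
/- Let m > 5 and k ≥ 1 be integers with (k+1)·m ≤ 2^{m-1} (i.e. k+1 ≤ 2^{m-1}/m). Then the Segre product of m copies of ℙ¹ is k-identifiable; concretely: there exists a nonzero polynomial P on the parameter space ((ℂ²)^m)^{k+1} such that for every parameter v = (v_{i,j}) with P(v) ≠ 0, every decomposition of length k+1 of the tensor T(v) = Σ_{i=0}^{k} v_{i,0} ⊗ ⋯ ⊗ v_{i,m-1} (i.e. every multiset of k+1 nonzero decomposable tensors in ⨂^m ℂ² summing to T(v)) equals the multiset { v_{i,0} ⊗ ⋯ ⊗ v_{i,m-1} : i = 0,…,k }. -/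
open scoped TensorProduct

/-- The `m`-fold tensor product of `ℂ²`, the affine cone over the Segre embedding
of `(ℙ¹)^m`. -/
abbrev BinTensor (m : ℕ) := ⨂[ℂ] _ : Fin m, (Fin 2 → ℂ)

/-- A tensor is decomposable if it is a pure tensor `w 0 ⊗ ⋯ ⊗ w (m-1)`. -/
def Decomposable {m : ℕ} (t : BinTensor m) : Prop :=
  ∃ w : Fin m → Fin 2 → ℂ, t = ⨂ₜ[ℂ] j, w j

/-- A decomposition of length `n` of a tensor `T` is a multiset of `n` nonzero
decomposable tensors whose sum is `T`. -/
def IsDecomposition {m : ℕ} (n : ℕ) (T : BinTensor m) (D : Multiset (BinTensor m)) : Prop :=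
  Multiset.card D = n ∧ (∀ t ∈ D, t ≠ 0 ∧ Decomposable t) ∧ D.sum = T

section GenericLinearAlgebra

open MvPolynomial

/-- A property holds generically if it holds off the zero locus of a nonzero polynomial. -/
def Generically {σ : Type*} (Q : (σ → ℂ) → Prop) : Prop :=
  ∃ P : MvPolynomial σ ℂ, P ≠ 0 ∧ ∀ v, eval v P ≠ 0 → Q v

namespace Generically

variable {σ : Type*} {Q Q' : (σ → ℂ) → Prop}

theorem mono (h : Generically Q) (hQ : ∀ v, Q v → Q' v) : Generically Q' := by
  obtain ⟨P, hP, h⟩ := h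
  exact ⟨P, hP, fun v hv => hQ v (h v hv)⟩

theorem and (h : Generically Q) (h' : Generically Q') : Generically fun v => Q v ∧ Q' v := by
  obtain ⟨P, hP, h⟩ := h
  obtain ⟨P', hP', h'⟩ := h'
  refine ⟨P * P', mul_ne_zero hP hP', fun v hv => ?_⟩
  rw [map_mul] at hv
  exact ⟨h v (left_ne_zero_of_mul hv), h' v (right_ne_zero_of_mul hv)⟩

theorem all {ι : Type*} [Finite ι] {Q : ι → (σ → ℂ) → Prop} (h : ∀ i, Generically (Q i)) :
    Generically fun v => ∀ i, Q i v := by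
  classical
  cases nonempty_fintype ι
  choose P hP h using h
  refine ⟨∏ i, P i, Finset.prod_ne_zero_iff.2 fun i _ => hP i, fun v hv i => h i v ?_⟩
  rw [map_prod] at hv
  exact Finset.prod_ne_zero_iff.1 hv i (Finset.mem_univ i)

theorem of_eval_ne_zero {P : MvPolynomial σ ℂ} (hP : P ≠ 0) :
    Generically fun v => eval v P ≠ 0 := ⟨P, hP, fun _ h => h⟩

theorem exists_point (h : Generically Q) : ∃ v, Q v := by
  obtain ⟨P, hP, h⟩ := h
  by_contra! hQ
  refine hP (MvPolynomial.funext fun v => ?_)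
  by_contra hv
  exact hQ v (h v (by simpa using hv))

theorem comp_rename {τ : Type*} {f : τ → σ} (hf : Function.Injective f) {Q : (τ → ℂ) → Prop}
    (h : Generically Q) : Generically fun v : σ → ℂ => Q (v ∘ f) := by
  obtain ⟨P, hP, h⟩ := h
  refine ⟨rename f P, fun h0 => hP (rename_injective f hf (by simpa using h0)), fun v hv => ?_⟩
  rw [eval_rename] at hv
  exact h _ hv

/-- The rank of a polynomial family of vectors is lower semicontinuous. -/
theorem le_finrank_span {α κ : Type*} [Finite α] [Finite κ] (A : α → κ → MvPolynomial σ ℂ)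
    (v₀ : σ → ℂ) (r : ℕ)
    (h : r ≤ Module.finrank ℂ (Submodule.span ℂ (Set.range fun a c => eval v₀ (A a c)))) :
    Generically fun v : σ → ℂ =>
      r ≤ Module.finrank ℂ (Submodule.span ℂ (Set.range fun a c => eval v (A a c))) := by
  classical
  cases nonempty_fintype α
  cases nonempty_fintype κ
  obtain ⟨N, hN, f, hf, hli⟩ : ∃ N, r ≤ N ∧ ∃ f : Fin N → κ → ℂ,
      (∀ i, f i ∈ Set.range fun a c => eval v₀ (A a c)) ∧ LinearIndependent ℂ f := by
    obtain ⟨f, hf, -, hli⟩ := Submodule.exists_fun_fin_finrank_span_eq ℂ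
      (Set.range fun a c => eval v₀ (A a c))
    exact ⟨_, h, f, hf, hli⟩
  choose a ha using hf
  let M : (σ → ℂ) → Matrix (Fin N) κ ℂ := fun v => Matrix.of fun i c => eval v (A (a i) c)
  have hM : LinearIndependent ℂ (M v₀).row := by
    have : (M v₀).row = f := _root_.funext fun i => ha i
    rwa [this]
  obtain ⟨B, hB⟩ : ∃ B : Matrix κ (Fin N) ℂ, M v₀ * B = 1 := by
    have : Function.Surjective (M v₀).mulVec := by
      have h1 : (M v₀).rank = N := by simpa using hM.rank_matrix
      have h2 : LinearMap.range (M v₀).mulVecLin = ⊤ :=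
        Submodule.eq_top_of_finrank_eq (by simpa [Matrix.rank] using h1)
      exact LinearMap.range_eq_top.1 h2
    exact Matrix.mulVec_surjective_iff_exists_right_inverse.1 this
  let P : MvPolynomial σ ℂ :=
    Matrix.det ((Matrix.of fun i c => A (a i) c : Matrix (Fin N) κ (MvPolynomial σ ℂ)) *
      B.map (C : ℂ → MvPolynomial σ ℂ))
  have hP : ∀ v, eval v P = (M v * B).det := by
    intro v
    rw [RingHom.map_det]
    congr 1
    ext i j
    simp [M, Matrix.mul_apply]
  refine ⟨P, fun h0 => ?_, fun v hv => hN.trans ?_⟩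
  · have := hP v₀
    simp [h0, hB] at this
  · rw [hP] at hv
    have hu : IsUnit (M v * B) := (Matrix.isUnit_iff_isUnit_det _).2 (isUnit_iff_ne_zero.2 hv)
    have h1 : N ≤ (M v).rank := by
      have := Matrix.rank_mul_le_left (M v) B
      rwa [Matrix.rank_of_isUnit _ hu, Fintype.card_fin] at this
    refine h1.trans ?_
    rw [Matrix.rank_eq_finrank_span_row]
    refine Submodule.finrank_mono (Submodule.span_mono ?_)
    rintro _ ⟨i, rfl⟩
    exact ⟨a i, rfl⟩

end Generically

theorem MvPolynomial.pderiv_aeval {σ ι : Type*} [Fintype ι] (f : ι → MvPolynomial σ ℂ)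
    (l : σ) (G : MvPolynomial ι ℂ) :
    pderiv l (aeval f G) = ∑ o, aeval f (pderiv o G) * pderiv l (f o) := by
  classical
  induction G using MvPolynomial.induction_on with
  | C a => simp
  | add p q hp hq => simp only [map_add, hp, hq, add_mul, Finset.sum_add_distrib]
  | mul_X p n hp =>
    have h1 : ∀ o, aeval f (pderiv o (p * X n)) * pderiv l (f o) =
        (if o = n then aeval f p * pderiv l (f o) else 0) +
          f n * (aeval f (pderiv o p) * pderiv l (f o)) := by
      intro o
      rw [Derivation.leibniz, pderiv_X, Pi.single_apply]
      split_ifs with h h' h' <;> first | exact absurd h.symm h' | exact absurd h'.symm h | skip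
      all_goals simp only [smul_eq_mul, map_add, map_mul, aeval_X, map_one, map_zero]; ring
    rw [Finset.sum_congr rfl fun o _ => h1 o, Finset.sum_add_distrib, ← Finset.mul_sum, ← hp,
      Finset.sum_ite_eq' Finset.univ n, map_mul, aeval_X, Derivation.leibniz]
    simp

theorem MvPolynomial.optionEquivLeft_pderiv_none {ι : Type*} (G : MvPolynomial (Option ι) ℂ) :
    optionEquivLeft ℂ ι (pderiv none G) = Polynomial.derivative (optionEquivLeft ℂ ι G) := by
  classical
  induction G using MvPolynomial.induction_on with
  | C a => simp [optionEquivLeft_C]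
  | add p q hp hq => simp [hp, hq]
  | mul_X p n hp =>
    rw [Derivation.leibniz, map_add, smul_eq_mul, smul_eq_mul, map_mul, map_mul, hp, map_mul,
      Polynomial.derivative_mul]
    cases n with
    | none => simp [optionEquivLeft_X_none]; ring
    | some n => simp [optionEquivLeft_X_some, pderiv_X]; ring

/-- A minimal relation of an element with an algebraically independent family is separable. -/
theorem exists_separable_relation {ι A : Type*} [CommRing A] [IsDomain A] [Algebra ℂ A]
    {x : ι → A} (hx : AlgebraicIndependent ℂ x) {y : A}
    (hy : IsAlgebraic (Algebra.adjoin ℂ (Set.range x)) y) :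
    ∃ G : MvPolynomial (Option ι) ℂ, aeval (fun o : Option ι => o.elim y x) G = 0 ∧
      aeval (fun o : Option ι => o.elim y x) (pderiv none G) ≠ 0 := by
  classical
  have hne : ∃ G : MvPolynomial (Option ι) ℂ, G ≠ 0 ∧
      aeval (fun o : Option ι => o.elim y x) G = 0 := by
    have : ¬ AlgebraicIndependent ℂ (fun o : Option ι => o.elim y x) := by
      rw [hx.option_iff_transcendental]
      exact fun h => h hy
    rw [algebraicIndependent_iff] at this
    push Not at this
    obtain ⟨G, h1, h2⟩ := this
    exact ⟨G, h2, h1⟩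
  let d : MvPolynomial (Option ι) ℂ → ℕ := fun G => (optionEquivLeft ℂ ι G).natDegree
  have hex : ∃ N, ∃ G : MvPolynomial (Option ι) ℂ, (G ≠ 0 ∧
      aeval (fun o : Option ι => o.elim y x) G = 0) ∧ d G = N := by
    obtain ⟨G, h⟩ := hne
    exact ⟨_, G, h, rfl⟩
  obtain ⟨G, ⟨hG, h0⟩, hd⟩ := Nat.find_spec hex
  refine ⟨G, h0, fun h1 => ?_⟩
  have hG' : optionEquivLeft ℂ ι G ≠ 0 := by simpa using hG
  by_cases hdeg : d G = 0
  · obtain ⟨g, hg⟩ := Polynomial.natDegree_eq_zero.1 hdeg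
    have hGg : G = rename some g := by
      apply (optionEquivLeft ℂ ι).injective
      rw [← hg]
      clear hg
      induction g using MvPolynomial.induction_on with
      | C a => simp [optionEquivLeft_C]
      | add p q hp hq => simp [hp, hq]
      | mul_X p n hp => simp [hp, optionEquivLeft_X_some]
    rw [hGg, aeval_rename] at h0
    have : g = 0 := (algebraicIndependent_iff.1 hx) g h0
    exact hG (by simp [hGg, this])
  · have hder : Polynomial.derivative (optionEquivLeft ℂ ι G) ≠ 0 := fun h =>
      hdeg (Polynomial.derivative_eq_zero.1 h)
    have hlt : d (pderiv none G) < d G := by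
      simp only [d, optionEquivLeft_pderiv_none]
      exact Polynomial.natDegree_derivative_lt hdeg
    refine Nat.find_min hex (hd ▸ hlt) ⟨pderiv none G, ⟨fun h => hder ?_, h1⟩, rfl⟩
    rw [← optionEquivLeft_pderiv_none, h, map_zero]

theorem MvPolynomial.eval_aeval_optionElim {ι σ : Type*} (x : ι → MvPolynomial σ ℂ)
    (y : MvPolynomial σ ℂ) (w : σ → ℂ) (H : MvPolynomial (Option ι) ℂ) :
    eval w (aeval (fun o : Option ι => o.elim y x) H) =
      eval (fun o : Option ι => o.elim (eval w y) fun i => eval w (x i)) H := by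
  induction H using MvPolynomial.induction_on with
  | C a => simp
  | add p q hp hq => simp only [map_add, hp, hq]
  | mul_X p n hp =>
    cases n <;> simp only [map_mul, hp, aeval_X, eval_X, Option.elim_none, Option.elim_some]

theorem dotProduct_eq_zero_of_relation {ι σ : Type*} [Fintype ι] [Fintype σ] {c : ℂ} {g : ι → ℂ}
    {a : σ → ℂ} {b : ι → σ → ℂ} (h : ∀ l, c * a l + ∑ i, g i * b i l = 0) (ξ : σ → ℂ)
    (hξ : ∀ i, ∑ l, b i l * ξ l = 0) {t : ℂ} (ht : ∑ l, a l * ξ l = t) : c * t = 0 := by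
  have h1 : ∑ l, (c * a l + ∑ i, g i * b i l) * ξ l = 0 :=
    Finset.sum_eq_zero fun l _ => by rw [h, zero_mul]
  simp only [add_mul, Finset.sum_add_distrib, Finset.sum_mul] at h1
  rw [Finset.sum_comm] at h1
  have h2 : ∀ i, ∑ l, g i * b i l * ξ l = 0 := fun i => by
    simp only [mul_assoc, ← Finset.mul_sum, hξ, mul_zero]
  rw [Finset.sum_eq_zero fun i _ => h2 i, add_zero] at h1
  simpa only [mul_assoc, ← Finset.mul_sum, ht] using h1

/-- Differentiated form of `exists_separable_relation`, at every point of a fibre. -/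
theorem exists_differential_relation {ι σ : Type*} [Fintype ι]
    {x : ι → MvPolynomial σ ℂ} (hx : AlgebraicIndependent ℂ x) {y : MvPolynomial σ ℂ}
    (hy : IsAlgebraic (Algebra.adjoin ℂ (Set.range x)) y) :
    ∃ (h : MvPolynomial (Option ι) ℂ) (g : ι → MvPolynomial (Option ι) ℂ),
      aeval (fun o : Option ι => o.elim y x) h ≠ 0 ∧
      ∀ (w : σ → ℂ) (l : σ),
        eval (fun o : Option ι => o.elim (eval w y) fun i => eval w (x i)) h
            * eval w (pderiv l y) +
          ∑ i, eval (fun o : Option ι => o.elim (eval w y) fun i => eval w (x i)) (g i)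
            * eval w (pderiv l (x i)) = 0 := by
  obtain ⟨G, h0, h1⟩ := exists_separable_relation hx hy
  refine ⟨pderiv none G, fun i => pderiv (some i) G, h1, fun w l => ?_⟩
  have h2 := congrArg (eval w) (MvPolynomial.pderiv_aeval (fun o : Option ι => o.elim y x) l G)
  rw [h0] at h2
  simp only [map_zero, map_add, map_sum, map_mul, Fintype.sum_option,
    eval_aeval_optionElim] at h2
  simpa only [Option.elim_none, Option.elim_some] using h2.symm

/-- Jacobian criterion: algebraically independent polynomials have generically independent
differentials. -/
theorem AlgebraicIndependent.generically_linearIndependent {ι σ : Type*} [Finite σ]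
    {x : ι → MvPolynomial σ ℂ} (hx : AlgebraicIndependent ℂ x) :
    Generically fun v : σ → ℂ =>
      LinearIndependent ℂ fun (i : ι) (l : σ) => eval v (pderiv l (x i)) := by
  classical
  cases nonempty_fintype σ
  obtain ⟨u, hxu, hu⟩ := exists_isTranscendenceBasis_superset hx.to_subtype_range
  have hcard : Cardinal.mk u = Fintype.card σ := by
    have h1 := hu.lift_cardinalMk_eq_trdeg
    rw [MvPolynomial.trdeg_of_isDomain] at h1
    simpa using h1
  have : Finite u := Cardinal.lt_aleph0_iff_finite.1 (hcard ▸ Cardinal.natCast_lt_aleph0)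
  cases nonempty_fintype u
  have hcard' : Fintype.card u = Fintype.card σ := by
    rw [Cardinal.mk_fintype] at hcard
    exact_mod_cast hcard
  have hrel := fun l : σ => exists_differential_relation hu.1 (hu.isAlgebraic.isAlgebraic (X l))
  choose h g hne hrel using hrel
  have key := fun l => eval_aeval_optionElim (Subtype.val : u → MvPolynomial σ ℂ) (X l)
  refine (Generically.all fun l => Generically.of_eval_ne_zero (hne l)).mono fun v hv => ?_
  have hli : LinearIndependent ℂ fun (b : u) (l : σ) =>
      eval v (pderiv l (b : MvPolynomial σ ℂ)) := by
    let D : Matrix u σ ℂ := Matrix.of fun b l => eval v (pderiv l (b : MvPolynomial σ ℂ))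
    have hinj : LinearMap.ker D.mulVecLin = ⊥ := by
      refine (Submodule.eq_bot_iff _).2 fun ξ hξ => ?_
      have hξ' : ∀ b : u, ∑ l, eval v (pderiv l (b : MvPolynomial σ ℂ)) * ξ l = 0 :=
        fun b => congrFun (LinearMap.mem_ker.1 hξ) b
      funext l
      exact (mul_eq_zero.1 (dotProduct_eq_zero_of_relation (hrel l v) ξ hξ' (t := ξ l) (by
        simp [pderiv_X, Pi.single_apply, apply_ite (eval v)]))).resolve_left
        (by simpa only [key] using hv l)
    have hrank : D.rank = Fintype.card u := by
      have := LinearMap.finrank_range_add_finrank_ker D.mulVecLin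
      rw [hinj, finrank_bot, add_zero, Module.finrank_fintype_fun_eq_card, ← hcard'] at this
      exact this
    rw [Matrix.rank_eq_finrank_span_row] at hrank
    exact linearIndependent_iff_card_eq_finrank_span.2 hrank.symm
  let e : ι → u := fun i => ⟨x i, hxu ⟨i, rfl⟩⟩
  have he : Function.Injective e := fun i j hij => hx.injective (congrArg Subtype.val hij)
  exact hli.comp e he

/-- The image of the differential at `w` of the polynomial map with components `F`. -/
def tangentImage {σ κ : Type*} (F : κ → MvPolynomial σ ℂ) (w : σ → ℂ) : Submodule ℂ (κ → ℂ) :=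
  Submodule.span ℂ (Set.range fun (l : σ) (c : κ) => eval w (pderiv l (F c)))

/-- For a general point `v`, the image of the differential at `v` contains the image of the
differential at any other point of the fibre through `v`. -/
theorem generically_tangentImage_le {σ κ : Type*} [Finite σ] [Finite κ]
    (F : κ → MvPolynomial σ ℂ) :
    Generically fun v : σ → ℂ => ∀ w : σ → ℂ, (∀ c, eval w (F c) = eval v (F c)) →
      tangentImage F w ≤ tangentImage F v := by
  classical
  cases nonempty_fintype σ
  obtain ⟨u, -, hu⟩ := exists_maximal_algebraicIndependent (R := ℂ) ∅ (Set.range F)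
    (Set.empty_subset _) (by
      rw [AlgebraicIndepOn]
      exact (algebraicIndependent_empty_type_iff).2 (algebraMap ℂ (MvPolynomial σ ℂ)).injective)
  have hind : AlgebraicIndependent ℂ (Subtype.val : u → MvPolynomial σ ℂ) := hu.prop.1
  have : Finite u := (Set.finite_range F).subset hu.prop.2
  cases nonempty_fintype u
  choose e he using fun b : u => hu.prop.2 b.2
  have halg : ∀ c, IsAlgebraic (Algebra.adjoin ℂ (Set.range (Subtype.val : u → MvPolynomial σ ℂ)))
      (F c) := by
    intro c
    by_contra hc
    have h1 : AlgebraicIndepOn ℂ id (insert (F c) u) := AlgebraicIndepOn.insert hind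
      (by rw [Subtype.range_coe] at hc; rw [Set.image_id]; exact hc)
    have h2 : F c ∈ u := hu.2 ⟨h1, Set.insert_subset ⟨c, rfl⟩ hu.prop.2⟩
      (Set.subset_insert _ _) (Set.mem_insert _ _)
    exact hc (isAlgebraic_algebraMap (⟨F c, Algebra.subset_adjoin ⟨⟨F c, h2⟩, rfl⟩⟩ :
      Algebra.adjoin ℂ (Set.range (Subtype.val : u → MvPolynomial σ ℂ))))
  choose h g hne hrel using fun c => exists_differential_relation hind (halg c)
  have key := fun c => eval_aeval_optionElim (Subtype.val : u → MvPolynomial σ ℂ) (F c)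
  refine ((Generically.all fun c => Generically.of_eval_ne_zero (hne c)).and
    hind.generically_linearIndependent).mono fun v ⟨hv, hli⟩ w hw => ?_
  simp only [key] at hv
  have hw' : ∀ b : u, eval w (b : MvPolynomial σ ℂ) = eval v (b : MvPolynomial σ ℂ) :=
    fun b => by rw [← he b, hw]
  let H : κ → ℂ := fun c =>
    eval (fun o : Option u => o.elim (eval v (F c)) fun i => eval v (i : MvPolynomial σ ℂ)) (h c)
  let G : κ → u → ℂ := fun c i =>
    eval (fun o : Option u => o.elim (eval v (F c)) fun i => eval v (i : MvPolynomial σ ℂ)) (g c i)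
  have hrelw : ∀ w : σ → ℂ, (∀ c, eval w (F c) = eval v (F c)) →
      ∀ y ∈ tangentImage F w, ∀ c, H c * y c + ∑ i, G c i * y (e i) = 0 := by
    intro w hw y hy c
    have hw' : ∀ b : u, eval w (b : MvPolynomial σ ℂ) = eval v (b : MvPolynomial σ ℂ) :=
      fun b => by rw [← he b, hw]
    let L : (κ → ℂ) →ₗ[ℂ] ℂ := H c • LinearMap.proj c + ∑ i, G c i • LinearMap.proj (e i)
    have hL : ∀ y, L y = H c * y c + ∑ i, G c i * y (e i) := fun y => by simp [L]
    have : tangentImage F w ≤ LinearMap.ker L := by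
      refine Submodule.span_le.2 ?_
      rintro _ ⟨l, rfl⟩
      have h1 := hrel c w l
      simp only [hw, hw'] at h1
      simpa only [SetLike.mem_coe, LinearMap.mem_ker, hL, he] using h1
    simpa only [LinearMap.mem_ker, hL] using this hy
  intro y hy
  let D : Matrix u σ ℂ := Matrix.of fun b l => eval v (pderiv l (b : MvPolynomial σ ℂ))
  obtain ⟨ξ, hξ⟩ : ∃ ξ, D.mulVec ξ = fun b => y (e b) := by
    have hD : LinearIndependent ℂ D.row := hli
    have h2 : LinearMap.range D.mulVecLin = ⊤ :=
      Submodule.eq_top_of_finrank_eq (by simpa [Matrix.rank] using hD.rank_matrix)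
    exact LinearMap.range_eq_top.1 h2 _
  let y' : κ → ℂ := ∑ l, ξ l • fun c => eval v (pderiv l (F c))
  have hy' : y' ∈ tangentImage F v :=
    Submodule.sum_mem _ fun l _ => Submodule.smul_mem _ _ (Submodule.subset_span ⟨l, rfl⟩)
  have hye : ∀ b, y' (e b) = y (e b) := by
    intro b
    rw [← congrFun hξ b]
    simp [y', D, Matrix.mulVec, dotProduct, he, mul_comm]
  have : y = y' := by
    funext c
    have h1 := hrelw w hw y hy c
    have h2 := hrelw v (fun _ => rfl) y' hy' c
    simp only [hye] at h2
    exact mul_left_cancel₀ (hv c) (add_right_cancel (h1.trans h2.symm))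
  exact this ▸ hy'

end GenericLinearAlgebra

section TangentSpaces

open Module

/-- Coordinates of the pure tensor with factors `w j`. -/
noncomputable def segre {M : ℕ} :
    MultilinearMap ℂ (fun _ : Fin M => Fin 2 → ℂ) ((Fin M → Fin 2) → ℂ) :=
  MultilinearMap.pi fun c =>
    (MultilinearMap.mkPiAlgebra ℂ (Fin M) ℂ).compLinearMap fun j => LinearMap.proj (c j)

theorem segre_apply {M : ℕ} (w : Fin M → Fin 2 → ℂ) (c : Fin M → Fin 2) :
    segre w c = ∏ j, w j (c j) := by
  simp [segre]

/-- The tangent space at `segre x` to the cone of pure tensors. -/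
noncomputable def tangent {M : ℕ} (x : Fin M → Fin 2 → ℂ) : Submodule ℂ ((Fin M → Fin 2) → ℂ) :=
  LinearMap.range (segre.linearDeriv x)

/-- The determinant of two vectors of `ℂ²`. -/
def det₂ (a b : Fin 2 → ℂ) : ℂ := a 0 * b 1 - a 1 * b 0

theorem det₂_self (a : Fin 2 → ℂ) : det₂ a a = 0 := by simp [det₂]; ring

theorem det₂_swap (a b : Fin 2 → ℂ) : det₂ a b = - det₂ b a := by simp [det₂]; ring

theorem det₂_zero_right (a : Fin 2 → ℂ) : det₂ a 0 = 0 := by simp [det₂]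

theorem det₂_trans {a b c : Fin 2 → ℂ} (hb : b ≠ 0) (h : det₂ b a = 0) (h' : det₂ b c = 0) :
    det₂ a c = 0 := by
  simp only [det₂] at *
  have : b 0 ≠ 0 ∨ b 1 ≠ 0 := by
    by_contra! h0
    exact hb (by ext i; fin_cases i <;> simp [h0])
  rcases this with h0 | h0 <;> refine mul_left_cancel₀ h0 ?_
  · linear_combination a 0 * h' - c 0 * h
  · linear_combination a 1 * h' - c 1 * h

theorem exists_det₂_eq_one {b : Fin 2 → ℂ} (hb : b ≠ 0) : ∃ a, det₂ a b = 1 := by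
  have : b 0 ≠ 0 ∨ b 1 ≠ 0 := by
    by_contra! h0
    exact hb (by ext i; fin_cases i <;> simp [h0])
  rcases this with h0 | h0
  · exact ⟨![0, - (b 0)⁻¹], by simp [det₂, h0]⟩
  · exact ⟨![(b 1)⁻¹, 0], by simp [det₂, h0]⟩

theorem exists_smul_of_det₂_eq_zero {a b : Fin 2 → ℂ} (ha : a ≠ 0) (h : det₂ a b = 0) :
    ∃ c : ℂ, b = c • a := by
  simp only [det₂] at h
  have : a 0 ≠ 0 ∨ a 1 ≠ 0 := by
    by_contra! h0
    exact ha (by ext i; fin_cases i <;> simp [h0])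
  rcases this with h0 | h0
  · refine ⟨b 0 / a 0, ?_⟩
    ext i; fin_cases i
    · simp [h0]
    · simp; field_simp; linear_combination h
  · refine ⟨b 1 / a 1, ?_⟩
    ext i; fin_cases i
    · simp; field_simp; linear_combination -h
    · simp [h0]

/-- Finitely many nonzero vectors of `ℂ²` avoid a common line. -/
theorem exists_forall_det₂_ne_zero {ι : Type*} [Finite ι] (b : ι → Fin 2 → ℂ) (hb : ∀ i, b i ≠ 0) :
    ∃ a : Fin 2 → ℂ, a ≠ 0 ∧ ∀ i, det₂ a (b i) ≠ 0 := by
  have hf : (Set.range fun i => b i 1 / b i 0).Finite := Set.finite_range _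
  obtain ⟨t, ht⟩ := hf.infinite_compl.nonempty
  have ht' : ((Set.range fun i => b i 1 / b i 0) ∪ {t}).Finite := hf.union (Set.finite_singleton _)
  refine ⟨![1, t], fun h => by simpa using congrFun h 0, fun i h => ?_⟩
  simp only [det₂, Matrix.cons_val_zero, Matrix.cons_val_one, one_mul] at h
  have h0 : b i 0 ≠ 0 := by
    intro h0
    rw [h0, mul_zero, sub_zero] at h
    exact hb i (by ext j; fin_cases j <;> simp [h0, h])
  exact ht ⟨i, by field_simp; linear_combination h⟩

/-- Contraction of the factor `q` with the linear form `det₂ a`. -/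
noncomputable def contract {M : ℕ} (q : Fin (M + 1)) (a : Fin 2 → ℂ) :
    ((Fin (M + 1) → Fin 2) → ℂ) →ₗ[ℂ] ((Fin M → Fin 2) → ℂ) where
  toFun f c := a 0 * f (q.insertNth 1 c) - a 1 * f (q.insertNth 0 c)
  map_add' f g := by ext c; simp; ring
  map_smul' t f := by ext c; simp; ring

theorem contract_segre {M : ℕ} (q : Fin (M + 1)) (a : Fin 2 → ℂ) (w : Fin (M + 1) → Fin 2 → ℂ) :
    contract q a (segre w) = det₂ a (w q) • segre (q.removeNth w) := by
  ext c
  simp only [contract, LinearMap.coe_mk, AddHom.coe_mk, segre_apply, Pi.smul_apply, smul_eq_mul,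
    Fin.prod_univ_succAbove _ q, Fin.insertNth_apply_same, Fin.insertNth_apply_succAbove, det₂,
    Fin.removeNth_apply]
  ring

theorem contract_linearDeriv {M : ℕ} (q : Fin (M + 1)) (a : Fin 2 → ℂ)
    (x τ : Fin (M + 1) → Fin 2 → ℂ) :
    contract q a (segre.linearDeriv x τ) = det₂ a (τ q) • segre (q.removeNth x) +
      det₂ a (x q) • segre.linearDeriv (q.removeNth x) (q.removeNth τ) := by
  rw [MultilinearMap.linearDeriv_apply, MultilinearMap.linearDeriv_apply, map_sum,
    Fin.sum_univ_succAbove _ q, contract_segre, Function.update_self, Fin.removeNth_update,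
    Finset.smul_sum]
  congr 1
  refine Finset.sum_congr rfl fun j _ => ?_
  rw [contract_segre, Function.update_of_ne (Fin.succAbove_ne q j).symm,
    Fin.removeNth_update_succAbove]
  rfl

theorem segre_ne_zero {M : ℕ} {x : Fin M → Fin 2 → ℂ} (hx : ∀ j, x j ≠ 0) : segre x ≠ 0 := by
  choose c hc using fun j => Function.ne_iff.1 (hx j)
  refine fun h => (Finset.prod_ne_zero_iff (s := Finset.univ) (f := fun j => x j (c j))).2
    (fun j _ => hc j) ?_
  rw [← segre_apply, h, Pi.zero_apply]

theorem segre_mem_tangent {M : ℕ} (x : Fin (M + 1) → Fin 2 → ℂ) : segre x ∈ tangent x := by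
  refine ⟨Pi.single 0 (x 0), ?_⟩
  rw [MultilinearMap.linearDeriv_apply, Finset.sum_eq_single 0]
  · simp
  · intro j _ hj
    rw [Pi.single_eq_of_ne hj]
    exact MultilinearMap.map_coord_zero _ j (by simp)
  · simp

theorem segre_update_mem_tangent {M : ℕ} (x : Fin M → Fin 2 → ℂ) (j : Fin M) (a : Fin 2 → ℂ) :
    segre (Function.update x j a) ∈ tangent x := by
  refine ⟨Pi.single j a, ?_⟩
  rw [MultilinearMap.linearDeriv_apply, Finset.sum_eq_single j]
  · simp
  · intro i _ hj
    rw [Pi.single_eq_of_ne hj]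
    exact MultilinearMap.map_coord_zero _ i (by simp)
  · simp

/-- `ℂ²`, placed in the factor `q` of the pure tensor `x`. -/
noncomputable def segreLine {M : ℕ} (x : Fin M → Fin 2 → ℂ) (q : Fin M) :
    Submodule ℂ ((Fin M → Fin 2) → ℂ) :=
  LinearMap.range (segre.toLinearMap x q)

theorem finrank_segreLine_le {M : ℕ} (x : Fin M → Fin 2 → ℂ) (q : Fin M) :
    finrank ℂ (segreLine x q) ≤ 2 :=
  (LinearMap.finrank_range_le (segre.toLinearMap x q)).trans (by simp)

theorem segreLine_le_tangent {M : ℕ} (x : Fin M → Fin 2 → ℂ) (q : Fin M) :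
    segreLine x q ≤ tangent x := by
  rintro _ ⟨a, rfl⟩
  exact segre_update_mem_tangent x q a

theorem segre_mem_segreLine {M : ℕ} (x : Fin M → Fin 2 → ℂ) (q : Fin M) :
    segre x ∈ segreLine x q := ⟨x q, by simp [MultilinearMap.toLinearMap]⟩

theorem exists_smul_add_smul {b : Fin 2 → ℂ} (hb : b ≠ 0) :
    ∃ a, det₂ b a = 1 ∧ ∀ c, ∃ s t : ℂ, c = s • b + t • a := by
  obtain ⟨a, ha⟩ := exists_det₂_eq_one hb
  refine ⟨-a, by rw [← ha]; simp [det₂]; ring, fun c => ⟨det₂ a c, det₂ b c, ?_⟩⟩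
  simp only [det₂] at *
  ext i; fin_cases i
  · simp; linear_combination (- c 0) * ha
  · simp; linear_combination (- c 1) * ha

theorem finrank_tangent_le {M : ℕ} {x : Fin M → Fin 2 → ℂ} (hx : ∀ j, x j ≠ 0) :
    finrank ℂ (tangent x) ≤ M + 1 := by
  choose a ha hs using fun j => exists_smul_add_smul (hx j)
  let f : Option (Fin M) → ((Fin M → Fin 2) → ℂ) := fun o =>
    o.elim (segre x) fun j => segre (Function.update x j (a j))
  have : tangent x ≤ Submodule.span ℂ (Set.range f) := by
    rintro _ ⟨τ, rfl⟩
    rw [MultilinearMap.linearDeriv_apply]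
    refine Submodule.sum_mem _ fun j _ => ?_
    obtain ⟨s, t, h⟩ := hs j (τ j)
    rw [h, MultilinearMap.map_update_add, MultilinearMap.map_update_smul,
      MultilinearMap.map_update_smul, Function.update_eq_self]
    exact add_mem (Submodule.smul_mem _ _ (Submodule.subset_span ⟨none, rfl⟩))
      (Submodule.smul_mem _ _ (Submodule.subset_span ⟨some j, rfl⟩))
  refine (Submodule.finrank_mono this).trans ((finrank_range_le_card f).trans ?_)
  simp

theorem exists_linearForm_segre {M : ℕ} (b : Fin M → Fin 2 → ℂ) :
    ∃ Λ : ((Fin M → Fin 2) → ℂ) →ₗ[ℂ] ℂ, ∀ w, Λ (segre w) = ∏ j, det₂ (b j) (w j) := by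
  let φ : Fin M → Fin 2 → ℂ := fun j => ![- b j 1, b j 0]
  refine ⟨∑ c, (∏ j, φ j (c j)) • LinearMap.proj c, fun w => ?_⟩
  have : ∀ j, det₂ (b j) (w j) = ∑ e, φ j e * w j e := fun j => by
    simp [det₂, φ]; ring
  simp only [this, Finset.prod_univ_sum, Finset.prod_mul_distrib]
  simp [segre_apply]

theorem le_finrank_tangent {M : ℕ} {x : Fin (M + 1) → Fin 2 → ℂ} (hx : ∀ j, x j ≠ 0) :
    M + 2 ≤ finrank ℂ (tangent x) := by
  choose a ha _ using fun j => exists_smul_add_smul (hx j)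
  let f : Option (Fin (M + 1)) → tangent x := fun o =>
    o.elim ⟨segre x, segre_mem_tangent x⟩ fun j =>
      ⟨segre (Function.update x j (a j)), segre_update_mem_tangent x j _⟩
  have hf : LinearIndependent ℂ f := by
    rw [Fintype.linearIndependent_iff]
    intro g hg
    have hg' : g none • segre x + ∑ j, g (some j) • segre (Function.update x j (a j)) = 0 := by
      have := congrArg Subtype.val hg
      rw [Fintype.sum_option] at this
      simpa [f] using this
    have hsome : ∀ k, g (some k) = 0 := by
      intro k
      obtain ⟨Λ, hΛ⟩ := exists_linearForm_segre (Function.update a k (x k))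
      have hprod : ∀ w : Fin (M + 1) → Fin 2 → ℂ, det₂ (x k) (w k) = 0 → Λ (segre w) = 0 := by
        intro w hw
        rw [hΛ]
        exact Finset.prod_eq_zero (Finset.mem_univ k) (by simpa using hw)
      have h1 := congrArg Λ hg'
      rw [map_add, map_smul, hprod x (det₂_self _), map_sum, Finset.sum_eq_single k] at h1
      · simp only [map_smul, hΛ, smul_eq_mul, mul_zero, zero_add, map_zero] at h1
        refine (mul_eq_zero.1 h1).resolve_right (Finset.prod_ne_zero_iff.2 fun j _ => ?_)
        by_cases hj : j = k
        · subst hj; simp [ha]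
        · simp only [ne_eq, hj, not_false_eq_true, Function.update_of_ne]
          rw [det₂_swap, ha]; simp
      · intro j _ hj
        rw [map_smul, hprod, smul_zero]
        rw [Function.update_of_ne hj.symm, det₂_self]
      · simp
    simp only [hsome, zero_smul, Finset.sum_const_zero, add_zero] at hg'
    rintro (_ | k)
    · exact (smul_eq_zero.1 hg').resolve_right (segre_ne_zero hx)
    · exact hsome k
  simpa [Nat.succ_le_iff] using hf.fintype_card_le_finrank

theorem Submodule.mem_iSup_iff_exists_sum {ι V : Type*} [Fintype ι] [AddCommGroup V] [Module ℂ V]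
    (p : ι → Submodule ℂ V) (y : V) :
    y ∈ ⨆ i, p i ↔ ∃ f : ι → V, (∀ i, f i ∈ p i) ∧ ∑ i, f i = y := by
  have := Submodule.mem_iSup_finset_iff_exists_sum (s := Finset.univ) p y
  simp only [Finset.mem_univ, iSup_pos] at this
  rw [this]
  exact ⟨fun ⟨μ, h⟩ => ⟨fun i => μ i, fun i => (μ i).2, h⟩,
    fun ⟨f, hf, h⟩ => ⟨fun i => ⟨f i, hf i⟩, h⟩⟩

/-- Subspaces whose sum has the expected dimension are independent. -/
theorem forall_eq_zero_of_sum_finrank_le {ι V : Type*} [Fintype ι] [AddCommGroup V] [Module ℂ V]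
    [FiniteDimensional ℂ V] (p : ι → Submodule ℂ V)
    (h : ∑ i, finrank ℂ (p i) ≤ finrank ℂ (⨆ i, p i : Submodule ℂ V)) (f : ι → V)
    (hf : ∀ i, f i ∈ p i) (h0 : ∑ i, f i = 0) (i : ι) : f i = 0 := by
  let L : ((i : ι) → p i) →ₗ[ℂ] V := ∑ i, (p i).subtype ∘ₗ LinearMap.proj i
  have hL : ∀ g, L g = ∑ i, (g i : V) := fun g => by simp [L]
  have hr : LinearMap.range L = ⨆ i, p i := by
    ext y
    rw [Submodule.mem_iSup_iff_exists_sum]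
    constructor
    · rintro ⟨g, rfl⟩
      exact ⟨fun i => g i, fun i => (g i).2, (hL g).symm⟩
    · rintro ⟨f, hf, rfl⟩
      exact ⟨fun i => ⟨f i, hf i⟩, hL _⟩
  have hk := LinearMap.finrank_range_add_finrank_ker L
  rw [hr, finrank_pi_fintype] at hk
  have hk0 : LinearMap.ker L = ⊥ := Submodule.finrank_eq_zero.1 (by omega)
  have hg : (fun i => ⟨f i, hf i⟩ : (i : ι) → p i) ∈ LinearMap.ker L :=
    LinearMap.mem_ker.2 ((hL _).trans h0)
  rw [hk0, Submodule.mem_bot] at hg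
  exact congrArg Subtype.val (congrFun hg i)

theorem eq_zero_of_forall_det₂_eq_zero {b : Fin 2 → ℂ} (h : ∀ a, det₂ a b = 0) : b = 0 := by
  by_contra hb
  obtain ⟨a, ha⟩ := exists_det₂_eq_one hb
  exact one_ne_zero (ha.symm.trans (h a))

theorem le_finrank_segreLine {M : ℕ} {x : Fin (M + 1) → Fin 2 → ℂ} (hx : ∀ j, x j ≠ 0)
    (q : Fin (M + 1)) : 2 ≤ finrank ℂ (segreLine x q) := by
  have hinj : Function.Injective (segre.toLinearMap x q) := by
    rw [← LinearMap.ker_eq_bot, Submodule.eq_bot_iff]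
    intro b hb
    refine eq_zero_of_forall_det₂_eq_zero fun a => ?_
    have h1 := congrArg (contract q a) (LinearMap.mem_ker.1 hb)
    rw [MultilinearMap.toLinearMap_apply, contract_segre, map_zero, Function.update_self,
      Fin.removeNth_update] at h1
    exact (smul_eq_zero.1 h1).resolve_right (segre_ne_zero fun j => hx _)
  rw [segreLine, LinearMap.finrank_range_of_inj hinj]
  simp

/-- The space of relations among the subspaces `p i`. -/
def relations {ι V : Type*} [Fintype ι] [AddCommGroup V] [Module ℂ V] (p : ι → Submodule ℂ V) :
    Submodule ℂ (ι → V) where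
  carrier := {f | (∀ i, f i ∈ p i) ∧ ∑ i, f i = 0}
  add_mem' := fun ⟨h, h'⟩ ⟨g, g'⟩ => ⟨fun i => add_mem (h i) (g i), by
    simp [Finset.sum_add_distrib, h', g']⟩
  zero_mem' := ⟨fun i => zero_mem _, by simp⟩
  smul_mem' := fun c f ⟨h, h'⟩ => ⟨fun i => Submodule.smul_mem _ _ (h i), by
    simp [← Finset.smul_sum, h']⟩

theorem finrank_relations_add_le {ι V : Type*} [Fintype ι] [AddCommGroup V] [Module ℂ V]
    [FiniteDimensional ℂ V] (p : ι → Submodule ℂ V) (j : ι) (l : Submodule ℂ V) (hl : l ≤ p j)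
    (h : ∀ f ∈ relations p, f j ∈ l → f = 0) :
    finrank ℂ (relations p) + finrank ℂ l ≤ finrank ℂ (p j) := by
  let g : relations p →ₗ[ℂ] V := LinearMap.proj j ∘ₗ (relations p).subtype
  have hg : Function.Injective g := by
    rw [← LinearMap.ker_eq_bot, Submodule.eq_bot_iff]
    intro f hf
    exact Subtype.ext (h f f.2 (by rw [show (f : ι → V) j = 0 from hf]; exact zero_mem _))
  have h1 : LinearMap.range g ⊓ l = ⊥ := by
    rw [Submodule.eq_bot_iff]
    rintro _ ⟨⟨f, rfl⟩, hf⟩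
    have := h f f.2 hf
    simp [g, this]
  have h2 : LinearMap.range g ⊔ l ≤ p j := by
    refine sup_le ?_ hl
    rintro _ ⟨f, rfl⟩
    exact f.2.1 j
  have h3 := Submodule.finrank_sup_add_finrank_inf_eq (LinearMap.range g) l
  rw [h1, finrank_bot, LinearMap.finrank_range_of_inj hg] at h3
  have := Submodule.finrank_mono h2
  omega

theorem coeff_mul_det₂_eq_zero_of_contract {ι : Type*} [Fintype ι] {M : ℕ}
    {x : ι → Fin (M + 1) → Fin 2 → ℂ}
    {q : Fin (M + 1)} (hli : LinearIndependent ℂ fun i => segre (q.removeNth (x i)))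
    {a : Fin 2 → ℂ} {c : ι → ℂ} (h : contract q a (∑ i, c i • segre (x i)) = 0) (i : ι) :
    c i * det₂ a (x i q) = 0 := by
  simp only [map_sum, map_smul, contract_segre, smul_smul] at h
  exact Fintype.linearIndependent_iff.1 hli _ h i

theorem linearIndependent_segre_of_removeNth {ι : Type*} [Fintype ι] {M : ℕ}
    {x : ι → Fin (M + 1) → Fin 2 → ℂ} {q : Fin (M + 1)} (hx : ∀ i, x i q ≠ 0)
    (hli : LinearIndependent ℂ fun i => segre (q.removeNth (x i))) :
    LinearIndependent ℂ fun i => segre (x i) := by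
  rw [Fintype.linearIndependent_iff]
  intro c hc i
  by_contra hci
  refine hx i (eq_zero_of_forall_det₂_eq_zero fun a => ?_)
  exact (mul_eq_zero.1 (coeff_mul_det₂_eq_zero_of_contract hli (a := a)
    (by rw [hc, map_zero]) i)).resolve_left
    hci

/-- Independent pure tensors do not span a tangent space. -/
theorem not_tangent_le_span {ι : Type*} [Fintype ι] {M : ℕ} {x : ι → Fin (M + 1) → Fin 2 → ℂ}
    {q : Fin (M + 1)} (hx : ∀ i, x i q ≠ 0)
    (hli : LinearIndependent ℂ fun i => segre (q.removeNth (x i)))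
    {z : Fin (M + 1) → Fin 2 → ℂ} (hz : ∀ j, z j ≠ 0) :
    ¬ tangent z ≤ Submodule.span ℂ (Set.range fun i => segre (x i)) := by
  intro hle
  obtain ⟨a, ha0, ha⟩ := exists_forall_det₂_ne_zero (fun i => x i q) hx
  have h1 := hle (segre_update_mem_tangent z q a)
  obtain ⟨c, hc⟩ := (Submodule.mem_span_range_iff_exists_fun ℂ).1 h1
  have h2 : ∀ i, c i = 0 := fun i =>
    (mul_eq_zero.1 (coeff_mul_det₂_eq_zero_of_contract hli (a := a) (by
      rw [hc, contract_segre, Function.update_self, det₂_self, zero_smul]) i)).resolve_right (ha i)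
  simp only [h2, zero_smul, Finset.sum_const_zero] at hc
  refine segre_ne_zero (fun j => ?_) hc.symm
  by_cases hj : j = q
  · subst hj; simpa using ha0
  · simpa [hj] using hz j

theorem exists_common_zero {L : ℕ} (hL : 1 ≤ L) {a b : Fin (L + 2) → ℂ}
    (ha : ∀ q q', q ≠ q' → a q * a q' = 0) (hb : ∀ q q', q ≠ q' → b q * b q' = 0) :
    ∃ q, a q = 0 ∧ b q = 0 := by
  by_contra! h
  let c : Fin 3 → Fin (L + 2) := Fin.castLE (by omega)
  have hc : ∀ i j, i ≠ j → c i ≠ c j := fun i j hij h => hij (Fin.castLE_injective _ h)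
  have a01 := ha _ _ (hc 0 1 (by decide))
  have a02 := ha _ _ (hc 0 2 (by decide))
  have a12 := ha _ _ (hc 1 2 (by decide))
  have b01 := hb _ _ (hc 0 1 (by decide))
  have b02 := hb _ _ (hc 0 2 (by decide))
  have b12 := hb _ _ (hc 1 2 (by decide))
  have h0 := h (c 0)
  have h1 := h (c 1)
  have h2 := h (c 2)
  simp only [mul_eq_zero] at *
  tauto

theorem finrank_tangent_inf_span_le_one {ι : Type*} [Fintype ι] {L : ℕ} (hL : 1 ≤ L)
    {x : ι → Fin (L + 2) → Fin 2 → ℂ}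
    (hpair : ∀ q i k, i ≠ k → det₂ (x i q) (x k q) ≠ 0)
    (hli : ∀ (q : Fin (L + 2)) (k : Fin (L + 1)),
      LinearIndependent ℂ fun i => segre (k.removeNth (q.removeNth (x i))))
    {z : Fin (L + 2) → Fin 2 → ℂ} (hz : ∀ j, z j ≠ 0) :
    finrank ℂ (tangent z ⊓ Submodule.span ℂ (Set.range fun i => segre (x i)) :
      Submodule ℂ ((Fin (L + 2) → Fin 2) → ℂ)) ≤ 1 := by
  let good : ι → Prop := fun i =>
    ∀ q q', q ≠ q' → det₂ (z q) (x i q) * det₂ (z q') (x i q') = 0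
  have huniq : ∀ i k, good i → good k → i = k := by
    intro i k hi hk
    by_contra hik
    obtain ⟨q, h1, h2⟩ := exists_common_zero hL hi hk
    refine hpair q i k hik (det₂_trans (hz q) h1 h2)
  have hsupp : ∀ c : ι → ℂ, ∑ i, c i • segre (x i) ∈ tangent z → ∀ i, c i ≠ 0 → good i := by
    rintro c ⟨τ, hτ⟩ i hi q q' hqq
    obtain ⟨k, rfl⟩ := Fin.exists_succAbove_eq hqq.symm
    have h1 : contract k (z (q.succAbove k)) (contract q (z q) (∑ i, c i • segre (x i))) = 0 := by
      rw [← hτ, contract_linearDeriv, det₂_self, zero_smul, add_zero, map_smul, contract_segre,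
        Fin.removeNth_apply, det₂_self, zero_smul, smul_zero]
    simp only [map_sum, map_smul, contract_segre, smul_smul] at h1
    have h2 := Fintype.linearIndependent_iff.1 (hli q k) _ h1 i
    rw [mul_assoc] at h2
    exact (mul_eq_zero.1 h2).resolve_left hi
  by_cases hex : ∃ i₀, good i₀
  · obtain ⟨i₀, hi₀⟩ := hex
    have hle : (tangent z ⊓ Submodule.span ℂ (Set.range fun i => segre (x i)) :
        Submodule ℂ ((Fin (L + 2) → Fin 2) → ℂ)) ≤ Submodule.span ℂ {segre (x i₀)} := by
      rintro d ⟨hd, hd'⟩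
      obtain ⟨c, rfl⟩ := (Submodule.mem_span_range_iff_exists_fun ℂ).1 hd'
      refine Submodule.sum_mem _ fun i _ => ?_
      by_cases hi : c i = 0
      · rw [hi, zero_smul]; exact zero_mem _
      · rw [huniq i i₀ (hsupp c hd i hi) hi₀]
        exact Submodule.smul_mem _ _ (Submodule.mem_span_singleton_self _)
    refine (Submodule.finrank_mono hle).trans ?_
    simpa using finrank_span_le_card (R := ℂ) {segre (x i₀)}
  · have : (tangent z ⊓ Submodule.span ℂ (Set.range fun i => segre (x i)) :
        Submodule ℂ ((Fin (L + 2) → Fin 2) → ℂ)) = ⊥ := by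
      rw [Submodule.eq_bot_iff]
      rintro d ⟨hd, hd'⟩
      obtain ⟨c, rfl⟩ := (Submodule.mem_span_range_iff_exists_fun ℂ).1 hd'
      refine Finset.sum_eq_zero fun i _ => ?_
      by_cases hi : c i = 0
      · rw [hi, zero_smul]
      · exact absurd ⟨i, hsupp c hd i hi⟩ hex
    rw [this, finrank_bot]
    exact zero_le_one

open Classical in
/-- A tangent space contained in the sum of the tangent spaces at sufficiently general points
is the tangent space at one of them. -/
theorem exists_det₂_eq_zero_of_tangent_le {ι : Type*} [Fintype ι] {L : ℕ} (hL : 1 ≤ L)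
    {v : ι → Fin (L + 3) → Fin 2 → ℂ} (hne : ∀ i q, v i q ≠ 0)
    (hpair : ∀ q i k, i ≠ k → det₂ (v i q) (v k q) ≠ 0)
    (hli : ∀ (q : Fin (L + 2)) (k : Fin (L + 1)), LinearIndependent ℂ fun i =>
      segre (k.removeNth (q.removeNth (Fin.removeNth 0 (v i)))))
    (hrank : ∀ j, (Fintype.card ι - 1) * (L + 3) + 2 ≤ finrank ℂ (⨆ i, if i = j then
      segreLine (Fin.removeNth 0 (v i)) 0 else tangent (Fin.removeNth 0 (v i)) :
        Submodule ℂ ((Fin (L + 2) → Fin 2) → ℂ)))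
    {y : Fin (L + 3) → Fin 2 → ℂ} (hy : ∀ q, y q ≠ 0) (hT : tangent y ≤ ⨆ i, tangent (v i)) :
    ∃ j, ∀ q, det₂ (v j q) (y q) = 0 := by
  set x : ι → Fin (L + 2) → Fin 2 → ℂ := fun i => Fin.removeNth 0 (v i) with hxdef
  set z : Fin (L + 2) → Fin 2 → ℂ := Fin.removeNth 0 y with hzdef
  have hx : ∀ i q, x i q ≠ 0 := fun i q => hne i _
  have hz : ∀ q, z q ≠ 0 := fun q => hy _
  have hxpair : ∀ q i k, i ≠ k → det₂ (x i q) (x k q) ≠ 0 := fun q => hpair _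
  have hli1 : ∀ q : Fin (L + 2), LinearIndependent ℂ fun i => segre (q.removeNth (x i)) :=
    fun q => linearIndependent_segre_of_removeNth (fun i => hx i _) (hli q 0)
  have hindep : ∀ j, ∀ f : ι → (Fin (L + 2) → Fin 2) → ℂ, (∀ i, f i ∈ tangent (x i)) →
      f j ∈ segreLine (x j) 0 → ∑ i, f i = 0 → ∀ i, f i = 0 := by
    intro j f hf hfj h0
    refine forall_eq_zero_of_sum_finrank_le (fun i => if i = j then segreLine (x i) 0
      else tangent (x i)) (le_trans ?_ (hrank j)) f (fun i => ?_) h0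
    · rw [← Finset.add_sum_erase _ _ (Finset.mem_univ j), add_comm]
      refine add_le_add ((Finset.sum_le_card_nsmul _ _ (L + 3) fun i hi => ?_).trans ?_) ?_
      · rw [if_neg (Finset.ne_of_mem_erase hi)]
        exact finrank_tangent_le (hx i)
      · simp
      · rw [if_pos rfl]
        exact finrank_segreLine_le _ _
    · split_ifs with h
      · exact h ▸ hfj
      · exact hf i
  -- the linear relations satisfied by elements of the tangent space at `z`
  have hrel : ∀ τ : Fin (L + 2) → Fin 2 → ℂ, ∃ (s : ι → Fin 2 → ℂ)
      (σ : ι → Fin (L + 2) → Fin 2 → ℂ), ∀ a, det₂ a (y 0) • segre.linearDeriv z τ =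
        ∑ i, (det₂ a (s i) • segre (x i) + det₂ a (v i 0) • segre.linearDeriv (x i) (σ i)) := by
    intro τ
    obtain ⟨f, hf, hsum⟩ := (Submodule.mem_iSup_iff_exists_sum _ _).1
      (hT ⟨Fin.insertNth 0 0 τ, rfl⟩)
    choose σ hσ using hf
    refine ⟨fun i => σ i 0, fun i => Fin.removeNth 0 (σ i), fun a => ?_⟩
    have h1 := congrArg (contract 0 a) hsum
    rw [contract_linearDeriv, Fin.insertNth_apply_same, det₂_zero_right, zero_smul, zero_add,
      Fin.removeNth_insertNth, map_sum] at h1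
    rw [← h1]
    exact Finset.sum_congr rfl fun i _ => by rw [← hσ, contract_linearDeriv]
  have hterm : ∀ (b c : ℂ) i τ,
      b • segre (x i) + c • segre.linearDeriv (x i) τ ∈ tangent (x i) := fun b c i τ =>
    add_mem (Submodule.smul_mem _ _ (segre_mem_tangent _)) (Submodule.smul_mem _ _ ⟨τ, rfl⟩)
  obtain ⟨a, ha⟩ := exists_det₂_eq_one (hy 0)
  set S := Submodule.span ℂ (Set.range fun i => segre (x i)) with hS
  have hxS : ∀ i, segre (x i) ∈ S := fun i => Submodule.subset_span ⟨i, rfl⟩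
  by_cases hcase : ∃ j, det₂ (y 0) (v j 0) = 0
  · obtain ⟨j, hj⟩ := hcase
    have hnej : ∀ i, i ≠ j → det₂ (y 0) (v i 0) ≠ 0 := fun i hi h0 =>
      hpair 0 i j hi (det₂_trans (hy 0) h0 hj)
    have hle : tangent z ≤ S ⊔ tangent (x j) := by
      rintro _ ⟨τ, rfl⟩
      obtain ⟨s, σ, h⟩ := hrel τ
      have h0 := h (y 0)
      rw [det₂_self, zero_smul] at h0
      have h1 := hindep j _ (fun i => hterm _ _ i _) (by
        rw [hj, zero_smul, add_zero]
        exact Submodule.smul_mem _ _ (segre_mem_segreLine _ _)) h0.symm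
      have h2 := h a
      rw [ha, one_smul] at h2
      rw [h2]
      refine Submodule.sum_mem _ fun i _ => add_mem
        (Submodule.mem_sup_left (Submodule.smul_mem _ _ (hxS i))) (Submodule.smul_mem _ _ ?_)
      by_cases hi : i = j
      · rw [hi]
        exact Submodule.mem_sup_right ⟨_, rfl⟩
      · refine Submodule.mem_sup_left ?_
        have h3 := h1 i
        rw [add_eq_zero_iff_eq_neg'] at h3
        rw [← Submodule.smul_mem_iff S (hnej i hi), h3]
        exact Submodule.neg_mem _ (Submodule.smul_mem _ _ (hxS i))
    refine ⟨j, fun q => ?_⟩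
    rw [det₂_swap, neg_eq_zero]
    rcases Fin.eq_zero_or_eq_succ q with rfl | ⟨q, rfl⟩
    · exact hj
    change det₂ (z q) (x j q) = 0
    by_contra hq
    refine not_tangent_le_span (q := 0) (x := fun i => q.removeNth (x i)) (fun i => hx i _)
      (hli q 0) (z := q.removeNth z) (fun k => hz _) ?_
    rintro _ ⟨τ, rfl⟩
    have h1 : segre.linearDeriv z (q.insertNth 0 τ) ∈ S ⊔ tangent (x j) := hle ⟨_, rfl⟩
    have h2 : (S ⊔ tangent (x j)).map (contract q (x j q)) ≤
        Submodule.span ℂ (Set.range fun i => segre (q.removeNth (x i))) := by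
      rw [Submodule.map_sup, sup_le_iff]
      constructor
      · rw [hS, Submodule.map_span_le]
        rintro _ ⟨i, rfl⟩
        rw [contract_segre]
        exact Submodule.smul_mem _ _ (Submodule.subset_span ⟨i, rfl⟩)
      · rintro _ ⟨_, ⟨τ, rfl⟩, rfl⟩
        rw [contract_linearDeriv, det₂_self, zero_smul, add_zero]
        exact Submodule.smul_mem _ _ (Submodule.subset_span ⟨j, rfl⟩)
    have h3 := h2 ⟨_, h1, rfl⟩
    rw [contract_linearDeriv, Fin.insertNth_apply_same, det₂_zero_right, zero_smul, zero_add,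
      Fin.removeNth_insertNth] at h3
    exact (Submodule.smul_mem_iff _ (by rwa [det₂_swap, neg_ne_zero])).1 h3
  · push Not at hcase
    exfalso
    let ρ : (ι → (Fin (L + 2) → Fin 2) → ℂ) →ₗ[ℂ] ((Fin (L + 2) → Fin 2) → ℂ) :=
      ∑ i, (det₂ a (v i 0) / det₂ (y 0) (v i 0)) • LinearMap.proj i
    set Rel := (relations fun i => tangent (x i)).map ρ with hRel
    have hRelrank : finrank ℂ Rel ≤ L + 1 := by
      refine (Submodule.finrank_map_le _ _).trans ?_
      rcases isEmpty_or_nonempty ι with hι | ⟨⟨j⟩⟩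
      · rw [finrank_zero_of_subsingleton]
        exact Nat.zero_le _
      · have h1 := finrank_relations_add_le _ j (segreLine (x j) 0) (segreLine_le_tangent _ _)
          fun f hf hfj => funext (hindep j f hf.1 hfj hf.2)
        have h2 : 2 ≤ finrank ℂ (segreLine (x j) 0) := le_finrank_segreLine (hx j) _
        have h3 : finrank ℂ (tangent (x j)) ≤ L + 2 + 1 := finrank_tangent_le (hx j)
        omega
    have hle : tangent z ≤ S ⊔ Rel := by
      rintro _ ⟨τ, rfl⟩
      obtain ⟨s, σ, h⟩ := hrel τ
      have h0 := h (y 0)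
      rw [det₂_self, zero_smul] at h0
      have h2 := h a
      rw [ha, one_smul] at h2
      let r : ι → (Fin (L + 2) → Fin 2) → ℂ := fun i =>
        det₂ (y 0) (s i) • segre (x i) + det₂ (y 0) (v i 0) • segre.linearDeriv (x i) (σ i)
      have hr : ρ r ∈ Rel := ⟨r, ⟨fun i => hterm _ _ i _, h0.symm⟩, rfl⟩
      have h3 : segre.linearDeriv z τ = ∑ i, (det₂ a (s i) - det₂ a (v i 0) /
          det₂ (y 0) (v i 0) * det₂ (y 0) (s i)) • segre (x i) + ρ r := by
        rw [h2]
        simp only [ρ, r, LinearMap.sum_apply, LinearMap.smul_apply, LinearMap.proj_apply,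
          ← Finset.sum_add_distrib]
        refine Finset.sum_congr rfl fun i _ => ?_
        rw [smul_add, smul_smul, smul_smul, div_mul_cancel₀ _ (hcase i), ← add_assoc, ← add_smul,
          sub_add_cancel]
      rw [h3]
      exact add_mem (Submodule.mem_sup_left (Submodule.sum_mem _ fun i _ =>
        Submodule.smul_mem _ _ (hxS i))) (Submodule.mem_sup_right hr)
    have h1 : finrank ℂ (tangent z ⊓ S : Submodule ℂ ((Fin (L + 2) → Fin 2) → ℂ)) ≤ 1 :=
      finrank_tangent_inf_span_le_one hL hxpair hli hz
    have h2 := Submodule.finrank_sup_add_finrank_inf_eq (tangent z) S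
    have h3 : finrank ℂ (tangent z ⊔ S : Submodule ℂ ((Fin (L + 2) → Fin 2) → ℂ)) ≤
        finrank ℂ S + finrank ℂ Rel :=
      (Submodule.finrank_mono (sup_le hle le_sup_left)).trans
        (Submodule.finrank_add_le_finrank_add_finrank _ _)
    have h4 : L + 1 + 2 ≤ finrank ℂ (tangent z) := le_finrank_tangent hz
    omega

section PolynomialFamily

open MvPolynomial

/-- A family of subspaces of `κ → ℂ` spanned by finitely many vectors depending polynomially on
the parameter. -/
def IsPolynomialFamily {σ κ : Type*} (U : (σ → ℂ) → Submodule ℂ (κ → ℂ)) : Prop :=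
  ∃ s : Set (κ → MvPolynomial σ ℂ), s.Finite ∧
    ∀ v, U v = Submodule.span ℂ ((fun A c => eval v (A c)) '' s)

namespace IsPolynomialFamily

variable {σ κ : Type*}

theorem iSup {ι : Type*} [Finite ι] {U : ι → (σ → ℂ) → Submodule ℂ (κ → ℂ)}
    (h : ∀ i, IsPolynomialFamily (U i)) : IsPolynomialFamily fun v => ⨆ i, U i v := by
  choose s hs h using h
  refine ⟨⋃ i, s i, Set.finite_iUnion hs, fun v => ?_⟩
  simp only [h, Set.image_iUnion, Submodule.span_iUnion]

theorem ite {p : Prop} [Decidable p] {U U' : (σ → ℂ) → Submodule ℂ (κ → ℂ)}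
    (h : IsPolynomialFamily U) (h' : IsPolynomialFamily U') :
    IsPolynomialFamily fun v => if p then U v else U' v := by
  split_ifs
  exacts [h, h']

theorem generically_le_finrank [Finite κ] {U : (σ → ℂ) → Submodule ℂ (κ → ℂ)}
    (h : IsPolynomialFamily U) {v₀ : σ → ℂ} {r : ℕ} (hr : r ≤ finrank ℂ (U v₀)) :
    Generically fun v => r ≤ finrank ℂ (U v) := by
  obtain ⟨s, hs, h⟩ := h
  obtain rfl : U = fun v => Submodule.span ℂ (Set.range fun (a : s) c => eval v (a.1 c)) :=
    funext fun v => by rw [h, Set.image_eq_range]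
  have := hs.to_subtype
  exact Generically.le_finrank_span (fun a : s => a.1) v₀ r hr

theorem span_segre {M : ℕ} (B : Fin M → Fin 2 → MvPolynomial σ ℂ) :
    IsPolynomialFamily fun v => Submodule.span ℂ {segre fun j e => eval v (B j e)} := by
  refine ⟨{fun c => ∏ j, B j (c j)}, Set.finite_singleton _, fun v => ?_⟩
  have h : (segre fun j e => eval v (B j e)) = fun c => eval v (∏ j, B j (c j)) := by
    ext c
    rw [segre_apply, map_prod]
  rw [Set.image_singleton, ← h]

end IsPolynomialFamily

end PolynomialFamily

theorem segreLine_eq_iSup {M : ℕ} (x : Fin M → Fin 2 → ℂ) (q : Fin M) :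
    segreLine x q = ⨆ e, Submodule.span ℂ {segre (Function.update x q (Pi.single e 1))} := by
  rw [← Submodule.span_range_eq_iSup, segreLine, LinearMap.range_eq_map,
    ← (Pi.basisFun ℂ (Fin 2)).span_eq, Submodule.map_span, ← Set.range_comp]
  congr 2
  ext e
  simp [MultilinearMap.toLinearMap]

theorem tangent_eq_iSup {M : ℕ} (x : Fin M → Fin 2 → ℂ) : tangent x = ⨆ q, segreLine x q := by
  refine le_antisymm ?_ (iSup_le fun q => segreLine_le_tangent x q)
  rintro _ ⟨τ, rfl⟩
  rw [MultilinearMap.linearDeriv_apply]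
  exact Submodule.sum_mem _ fun q _ => Submodule.mem_iSup_of_mem q ⟨τ q, rfl⟩

namespace IsPolynomialFamily

open MvPolynomial

variable {ι : Type*} {M : ℕ}

theorem segre (i : ι) : IsPolynomialFamily fun v : ι × Fin M × Fin 2 → ℂ =>
    Submodule.span ℂ {segre fun j e => v (i, j, e)} := by
  simpa using span_segre fun j e => (X (i, j, e) : MvPolynomial (ι × Fin M × Fin 2) ℂ)

theorem segreLine (i : ι) (q : Fin M) : IsPolynomialFamily fun v : ι × Fin M × Fin 2 → ℂ =>
    segreLine (fun j e => v (i, j, e)) q := by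
  simp only [segreLine_eq_iSup]
  refine iSup fun e => ?_
  convert span_segre (Function.update
    (fun j e => (X (i, j, e) : MvPolynomial (ι × Fin M × Fin 2) ℂ)) q (Pi.single e 1)) using 5
    with v
  ext j e'
  rcases eq_or_ne j q with rfl | h
  · rcases eq_or_ne e' e with rfl | h' <;> simp [*]
  · simp [h]

theorem tangent (i : ι) : IsPolynomialFamily fun v : ι × Fin M × Fin 2 → ℂ =>
    tangent fun j e => v (i, j, e) := by
  simp only [tangent_eq_iSup]
  exact iSup fun q => segreLine i q

end IsPolynomialFamily

theorem span_range_segre (M : ℕ) : Submodule.span ℂ (Set.range (segre (M := M))) = ⊤ := by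
  rw [eq_top_iff, ← (Pi.basisFun ℂ (Fin M → Fin 2)).span_eq]
  refine Submodule.span_mono ?_
  rintro _ ⟨c, rfl⟩
  refine ⟨fun j => Pi.single (c j) 1, ?_⟩
  ext d
  rw [segre_apply, Pi.basisFun_apply]
  rcases eq_or_ne d c with rfl | h
  · simp
  · obtain ⟨j, hj⟩ := Function.ne_iff.1 h
    rw [Pi.single_eq_of_ne h]
    exact Finset.prod_eq_zero (Finset.mem_univ j) (Pi.single_eq_of_ne hj _)

theorem exists_le_finrank_sup_segre {M r : ℕ} {U : Submodule ℂ ((Fin M → Fin 2) → ℂ)}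
    (hU : r ≤ finrank ℂ U) {ι : Type*} [DecidableEq ι] (J : Finset ι) (hJ : r + J.card ≤ 2 ^ M) :
    ∃ x : ι → Fin M → Fin 2 → ℂ,
      r + J.card ≤ finrank ℂ (U ⊔ ⨆ i ∈ J, Submodule.span ℂ {segre (x i)} : Submodule ℂ _) := by
  induction J using Finset.induction_on with
  | empty => exact ⟨0, hU.trans (Submodule.finrank_mono le_sup_left)⟩
  | insert a J ha ih =>
    rw [Finset.card_insert_of_notMem ha] at hJ ⊢
    obtain ⟨x, hx⟩ := ih (by omega)
    set W := U ⊔ ⨆ i ∈ J, Submodule.span ℂ {segre (x i)} with hW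
    have hupd : ∀ y, U ⊔ ⨆ i ∈ insert a J, Submodule.span ℂ {segre (Function.update x a y i)} =
        W ⊔ Submodule.span ℂ {segre y} := by
      intro y
      rw [Finset.iSup_insert, Function.update_self, hW, sup_left_comm, sup_comm]
      congr 2
      refine iSup_congr fun i => iSup_congr fun hi => ?_
      rw [Function.update_of_ne (by rintro rfl; exact ha hi)]
    by_cases hlt : r + (J.card + 1) ≤ finrank ℂ W
    · refine ⟨Function.update x a 0, hlt.trans (Submodule.finrank_mono ?_)⟩
      rw [hupd]
      exact le_sup_left
    · obtain ⟨y, hy⟩ : ∃ y, segre y ∉ W := by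
        by_contra! h
        have : W = ⊤ := by
          rw [eq_top_iff, ← span_range_segre, Submodule.span_le]
          rintro _ ⟨y, rfl⟩
          exact h y
        rw [this, finrank_top, finrank_fintype_fun_eq_card] at hlt
        simp only [Fintype.card_pi, Fintype.card_fin, Finset.prod_const, Finset.card_univ] at hlt
        omega
      refine ⟨Function.update x a y, ?_⟩
      rw [hupd]
      have : W < W ⊔ Submodule.span ℂ {segre y} := left_lt_sup.2 fun h =>
        hy (h (Submodule.mem_span_singleton_self _))
      have := Submodule.finrank_lt_finrank_of_lt this
      omega

/-- Some `s` points of `(ℙ¹)^M` have independent tangent spaces, i.e. the `s`-th secant variety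
has the expected dimension. -/
def Nondefective (M s : ℕ) : Prop :=
  ∃ x : Fin s → Fin M → Fin 2 → ℂ, s * (M + 1) ≤ finrank ℂ (⨆ i, tangent (x i) : Submodule ℂ _)

theorem Nondefective.exists_mixed {M : ℕ} {ι : Type*} [Fintype ι] [DecidableEq ι] (S : Finset ι)
    (h : Nondefective M S.card) (hS : S.card * M + Fintype.card ι ≤ 2 ^ M) :
    ∃ x : ι → Fin M → Fin 2 → ℂ, S.card * M + Fintype.card ι ≤ finrank ℂ
      (⨆ i, if i ∈ S then tangent (x i) else Submodule.span ℂ {segre (x i)} :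
        Submodule ℂ ((Fin M → Fin 2) → ℂ)) := by
  obtain ⟨x, hx⟩ := h
  have hcard : S.card * M + Fintype.card ι = S.card * (M + 1) + Sᶜ.card := by
    rw [← Finset.card_add_card_compl S]; ring
  rw [hcard] at hS ⊢
  obtain ⟨y, hy⟩ := exists_le_finrank_sup_segre hx Sᶜ hS
  refine ⟨fun i => if hi : i ∈ S then x (S.equivFin ⟨i, hi⟩) else y i,
    hy.trans (Submodule.finrank_mono (sup_le (iSup_le fun a => ?_)
      (iSup₂_le fun i hi => ?_)))⟩
  · refine le_trans ?_ (le_iSup _ (S.equivFin.symm a).1)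
    simp
  · refine le_trans ?_ (le_iSup _ i)
    rw [Finset.mem_compl] at hi
    simp [hi]

theorem Nondefective.generically_mixed {M : ℕ} {ι : Type*} [Fintype ι] [DecidableEq ι]
    (S : Finset ι) (h : Nondefective M S.card) (hS : S.card * M + Fintype.card ι ≤ 2 ^ M) :
    Generically fun v : ι × Fin M × Fin 2 → ℂ => S.card * M + Fintype.card ι ≤ finrank ℂ
      (⨆ i, if i ∈ S then tangent (fun j e => v (i, j, e)) else
        Submodule.span ℂ {segre fun j e => v (i, j, e)} : Submodule ℂ ((Fin M → Fin 2) → ℂ)) := by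
  obtain ⟨x, hx⟩ := h.exists_mixed S hS
  exact (IsPolynomialFamily.iSup fun i => IsPolynomialFamily.ite (IsPolynomialFamily.tangent i)
    (IsPolynomialFamily.segre i)).generically_le_finrank (v₀ := fun p => x p.1 p.2.1 p.2.2) hx

/-- Tensoring with a basis vector of `ℂ²` in front. -/
def consTensor {M : ℕ} (e : Fin 2) :
    ((Fin M → Fin 2) → ℂ) →ₗ[ℂ] ((Fin (M + 1) → Fin 2) → ℂ) where
  toFun f c := (Pi.single e 1 : Fin 2 → ℂ) (c 0) * f (Fin.tail c)
  map_add' f g := by ext c; simp [mul_add]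
  map_smul' t f := by ext c; simp [mul_left_comm]

theorem consTensor_segre {M : ℕ} (e : Fin 2) (x : Fin M → Fin 2 → ℂ) :
    consTensor e (segre x) = segre (Fin.cons (Pi.single e 1) x) := by
  ext c
  simp [consTensor, segre_apply, Fin.prod_univ_succ, Fin.tail]

theorem consTensor_injective {M : ℕ} (e : Fin 2) : Function.Injective (consTensor (M := M) e) := by
  intro f g h
  ext c
  simpa [consTensor] using congrFun h (Fin.cons e c)

theorem map_consTensor_inf {M : ℕ} (U U' : Submodule ℂ ((Fin M → Fin 2) → ℂ)) :
    U.map (consTensor 0) ⊓ U'.map (consTensor 1) = ⊥ := by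
  rw [Submodule.eq_bot_iff]
  rintro _ ⟨⟨f, -, rfl⟩, g, -, hg⟩
  ext c
  have h := congrFun hg c
  simp only [consTensor, LinearMap.coe_mk, AddHom.coe_mk] at h ⊢
  rcases Fin.exists_fin_two.1 ⟨c 0, rfl⟩ with h0 | h0
  · simpa [h0] using h.symm
  · simp [h0]

theorem consTensor_segre_mem_segreLine {M : ℕ} (e : Fin 2) (a : Fin 2 → ℂ)
    (x : Fin M → Fin 2 → ℂ) : consTensor e (segre x) ∈ segreLine (Fin.cons a x) 0 :=
  ⟨Pi.single e 1, by simp [consTensor_segre, MultilinearMap.toLinearMap]⟩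

theorem map_consTensor_tangent_le {M : ℕ} (e : Fin 2) (x : Fin M → Fin 2 → ℂ) :
    (tangent x).map (consTensor e) ≤ tangent (Fin.cons (Pi.single e 1) x) := by
  rw [Submodule.map_le_iff_le_comap, tangent_eq_iSup]
  refine iSup_le fun q => ?_
  rintro _ ⟨a, rfl⟩
  have := segre_update_mem_tangent
    (Fin.cons (Pi.single e 1) x : Fin (M + 1) → Fin 2 → ℂ) q.succ a
  rwa [← Fin.cons_update, ← consTensor_segre] at this

theorem exists_tangent_segreLine {M s₀ s₁ : ℕ} {ι : Type*} [Fintype ι] [DecidableEq ι]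
    (S : Finset ι) (hS : S.card = s₀ + s₁) (h₀ : Nondefective M s₀) (h₁ : Nondefective M s₁)
    (hs₀ : s₀ * M + Fintype.card ι ≤ 2 ^ M) (hs₁ : s₁ * M + Fintype.card ι ≤ 2 ^ M) :
    ∃ x : ι → Fin (M + 1) → Fin 2 → ℂ, S.card * M + 2 * Fintype.card ι ≤ finrank ℂ
      (⨆ i, if i ∈ S then tangent (x i) else segreLine (x i) 0 :
        Submodule ℂ ((Fin (M + 1) → Fin 2) → ℂ)) := by
  obtain ⟨T, hTS, hT⟩ := Finset.exists_subset_card_eq (show s₀ ≤ S.card by omega)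
  have hT' : (S \ T).card = s₁ := by rw [Finset.card_sdiff_of_subset hTS]; omega
  subst hT hT'
  obtain ⟨v, hv₀, hv₁⟩ := ((h₀.generically_mixed T hs₀).and
    (h₁.generically_mixed (S \ T) hs₁)).exists_point
  set β : ι → Fin M → Fin 2 → ℂ := fun i j e => v (i, j, e)
  let b : ι → Fin 2 := fun i => if i ∈ T then 0 else 1
  have key : ∀ (e : Fin 2) (R : Finset ι), (∀ i ∈ R, i ∈ S ∧ b i = e) →
      (⨆ i, if i ∈ R then tangent (β i) else Submodule.span ℂ {segre (β i)}).map (consTensor e) ≤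
      ⨆ i, if i ∈ S then tangent (Fin.cons (Pi.single (b i) 1) (β i)) else
        segreLine (Fin.cons (Pi.single (b i) 1) (β i)) 0 := by
    intro e R hR
    rw [Submodule.map_iSup]
    refine iSup_mono fun i => ?_
    by_cases hi : i ∈ R
    · obtain ⟨hi', rfl⟩ := hR i hi
      rw [if_pos hi, if_pos hi']
      exact map_consTensor_tangent_le _ _
    · rw [if_neg hi, Submodule.map_span_le]
      rintro _ rfl
      have := consTensor_segre_mem_segreLine e (Pi.single (b i) 1) (β i)
      split_ifs
      exacts [segreLine_le_tangent _ _ this, this]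
  refine ⟨fun i => Fin.cons (Pi.single (b i) 1) (β i), le_trans ?_ (Submodule.finrank_mono
    (sup_le (key 0 T fun i hi => ⟨hTS hi, if_pos hi⟩) (key 1 (S \ T) fun i hi =>
      ⟨(Finset.mem_sdiff.1 hi).1, if_neg (Finset.mem_sdiff.1 hi).2⟩)))⟩
  have h := Submodule.finrank_sup_add_finrank_inf_eq
    ((⨆ i, if i ∈ T then tangent (β i) else Submodule.span ℂ {segre (β i)}).map (consTensor 0))
    ((⨆ i, if i ∈ S \ T then tangent (β i) else Submodule.span ℂ {segre (β i)}).map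
      (consTensor 1))
  rw [map_consTensor_inf, finrank_bot, add_zero,
    (Submodule.equivMapOfInjective _ (consTensor_injective 0) _).symm.finrank_eq,
    (Submodule.equivMapOfInjective _ (consTensor_injective 1) _).symm.finrank_eq] at h
  rw [h, hS, add_mul]
  refine le_trans (le_of_eq ?_) (add_le_add hv₀ hv₁)
  ring

theorem nondefective_of_le_one {M s : ℕ} (hs : s ≤ 1) : Nondefective (M + 1) s := by
  refine ⟨fun _ _ => 1, ?_⟩
  rcases Nat.le_one_iff_eq_zero_or_eq_one.1 hs with rfl | rfl
  · simp
  · rw [iSup_const, one_mul]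
    exact le_finrank_tangent fun _ => one_ne_zero

theorem Nondefective.succ {M s₀ s₁ : ℕ} (h₀ : Nondefective M s₀) (h₁ : Nondefective M s₁)
    (hs₀ : s₀ * M + (s₀ + s₁) ≤ 2 ^ M) (hs₁ : s₁ * M + (s₀ + s₁) ≤ 2 ^ M) :
    Nondefective (M + 1) (s₀ + s₁) := by
  obtain ⟨x, hx⟩ := exists_tangent_segreLine (ι := Fin (s₀ + s₁)) Finset.univ (by simp) h₀ h₁
    (by simpa using hs₀) (by simpa using hs₁)
  refine ⟨x, ?_⟩
  rw [Finset.card_univ, Fintype.card_fin] at hx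
  refine le_trans (le_of_eq (by ring)) (hx.trans (Submodule.finrank_mono
    (iSup_mono fun i => ?_)))
  rw [if_pos (Finset.mem_univ i)]

theorem half_mul_le {M s : ℕ} (hM : 3 ≤ M) (h : (s + 1) * (M + 2) ≤ 2 ^ (M + 1)) :
    ((s + 1) / 2 + 1) * (M + 1) ≤ 2 ^ M := by
  obtain hM' | hM' := lt_or_ge M 6
  · interval_cases M <;> omega
  · have hpow : (2 * M + 3) * (M + 1) ≤ 2 ^ (M + 1) := by
      clear h hM
      induction M, hM' using Nat.le_induction with
      | base => norm_num
      | succ M hM' ih =>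
        rw [pow_succ]
        nlinarith
    rw [pow_succ] at *
    have h2 : 2 * ((s + 1) / 2) ≤ s + 1 := Nat.mul_div_le _ _
    obtain hs | hs := lt_or_ge s (2 * M + 1)
    · nlinarith
    · nlinarith

theorem nondefective {M : ℕ} (hM : 3 ≤ M) :
    ∀ s, (s + 1) * (M + 1) ≤ 2 ^ M → Nondefective M s := by
  induction M, hM using Nat.le_induction with
  | base => exact fun s hs => nondefective_of_le_one (by omega)
  | succ M hM ih =>
    intro s hs
    have h := half_mul_le hM hs
    have hsum : (s + 1) / 2 + s / 2 = s := by omega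
    have hle : s / 2 ≤ (s + 1) / 2 := by omega
    have hb : (s + 1) / 2 * M + s ≤ 2 ^ M := by
      have h2 : 2 * ((s + 1) / 2) ≤ s + 1 := Nat.mul_div_le _ _
      rw [pow_succ] at hs
      nlinarith
    have := (ih _ h).succ (ih (s / 2) (le_trans (by gcongr) h)) (by rwa [hsum])
      (le_trans (by rw [hsum]; gcongr) hb)
    rwa [hsum] at this

theorem exists_tangent_segreLine_of_le {L : ℕ} (hL : 3 ≤ L) {ι : Type*} [Fintype ι]
    [DecidableEq ι] (h : Fintype.card ι * (L + 3) ≤ 2 ^ (L + 2)) (j : ι) :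
    ∃ x : ι → Fin (L + 2) → Fin 2 → ℂ, (Fintype.card ι - 1) * (L + 3) + 2 ≤ finrank ℂ
      (⨆ i, if i = j then segreLine (x i) 0 else tangent (x i) :
        Submodule ℂ ((Fin (L + 2) → Fin 2) → ℂ)) := by
  obtain ⟨n, hn⟩ : ∃ n, Fintype.card ι = n + 1 :=
    Nat.exists_eq_succ_of_ne_zero (Fintype.card_pos_iff.2 ⟨j⟩).ne'
  have hS : (Finset.univ.erase j : Finset ι).card = (n + 1) / 2 + n / 2 := by
    rw [Finset.card_erase_of_mem (Finset.mem_univ j), Finset.card_univ]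
    omega
  rw [hn] at h
  have hle : n / 2 ≤ (n + 1) / 2 := by omega
  have hhalf : ((n + 1) / 2 + 1) * (L + 1 + 1) ≤ 2 ^ (L + 1) := half_mul_le (by omega) h
  have hb : (n + 1) / 2 * (L + 1) + (n + 1) ≤ 2 ^ (L + 1) := by
    have h2 : 2 * ((n + 1) / 2) ≤ n + 1 := Nat.mul_div_le _ _
    rw [pow_succ] at h
    nlinarith
  obtain ⟨x, hx⟩ := exists_tangent_segreLine _ hS (nondefective (by omega) _ hhalf)
    (nondefective (by omega) _ (le_trans (by gcongr) hhalf)) (by rwa [hn])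
    (le_trans (by rw [hn]; gcongr) hb)
  refine ⟨x, ?_⟩
  rw [show (Finset.univ.erase j : Finset ι).card = n by omega, hn] at hx
  rw [hn, Nat.add_sub_cancel]
  refine le_trans (le_of_eq (by ring)) (hx.trans (Submodule.finrank_mono
    (iSup_mono fun i => ?_)))
  by_cases hi : i = j <;> simp [hi]

end TangentSpaces

section GenericPoints

open Module MvPolynomial

theorem generically_linearIndependent_segre {ι : Type*} [Fintype ι] {M : ℕ}
    (h : Fintype.card ι ≤ 2 ^ M) : Generically fun v : ι × Fin M × Fin 2 → ℂ =>
      LinearIndependent ℂ fun i => segre fun j e => v (i, j, e) := by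
  classical
  obtain ⟨x, hx⟩ := exists_le_finrank_sup_segre (Nat.zero_le (finrank ℂ
    (⊥ : Submodule ℂ ((Fin M → Fin 2) → ℂ)))) (Finset.univ : Finset ι) (by simpa using h)
  rw [zero_add, bot_sup_eq, Finset.card_univ] at hx
  refine ((IsPolynomialFamily.iSup IsPolynomialFamily.segre).generically_le_finrank
    (v₀ := fun p => x p.1 p.2.1 p.2.2) (hx.trans (Submodule.finrank_mono ?_))).mono fun v hv => ?_
  · exact iSup₂_le fun i _ => le_iSup (fun i => Submodule.span ℂ {segre (x i)}) i
  · rwa [linearIndependent_iff_card_le_finrank_span, Set.finrank, Submodule.span_range_eq_iSup]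

theorem generically_det₂_ne_zero {ι : Type*} {M : ℕ} {i k : ι} (hik : i ≠ k) (q : Fin M) :
    Generically fun v : ι × Fin M × Fin 2 → ℂ =>
      det₂ (fun e => v (i, q, e)) (fun e => v (k, q, e)) ≠ 0 := by
  classical
  have hP : (X (i, q, 0) * X (k, q, 1) - X (i, q, 1) * X (k, q, 0) :
      MvPolynomial (ι × Fin M × Fin 2) ℂ) ≠ 0 := fun h => by
    simpa [hik.symm] using congrArg (eval fun p => if p.1 = i then if p.2.2 = 0 then 1 else 0 else
      if p.2.2 = 1 then (1 : ℂ) else 0) h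
  exact (Generically.of_eval_ne_zero hP).mono fun v hv => by simpa [det₂] using hv

open Classical in
theorem generically_le_finrank_tangent_segreLine {ι : Type*} [Fintype ι] {L : ℕ} (hL : 3 ≤ L)
    (h : Fintype.card ι * (L + 3) ≤ 2 ^ (L + 2)) (j : ι) :
    Generically fun v : ι × Fin (L + 2) × Fin 2 → ℂ =>
      (Fintype.card ι - 1) * (L + 3) + 2 ≤ finrank ℂ
        (⨆ i, if i = j then segreLine (fun q e => v (i, q, e)) 0 else
          tangent (fun q e => v (i, q, e)) : Submodule ℂ ((Fin (L + 2) → Fin 2) → ℂ)) := by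
  obtain ⟨x, hx⟩ := exists_tangent_segreLine_of_le hL h j
  exact (IsPolynomialFamily.iSup fun i => IsPolynomialFamily.ite
    (IsPolynomialFamily.segreLine i 0) (IsPolynomialFamily.tangent i)).generically_le_finrank
      (v₀ := fun p => x p.1 p.2.1 p.2.2) hx

/-- Restricting a parameter to the factors in the image of an injection preserves genericity. -/
theorem Generically.comp_factors {ι : Type*} {M N : ℕ} {f : Fin M → Fin N}
    (hf : Function.Injective f) {Q : (ι × Fin M × Fin 2 → ℂ) → Prop} (h : Generically Q) :
    Generically fun v : ι × Fin N × Fin 2 → ℂ => Q fun p => v (p.1, f p.2.1, p.2.2) :=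
  h.comp_rename (f := fun p : ι × Fin M × Fin 2 => (p.1, f p.2.1, p.2.2))
    fun p p' hp => by
      simp only [Prod.mk.injEq] at hp
      exact Prod.ext hp.1 (Prod.ext (hf hp.2.1) hp.2.2)

/-- At general points, the only tangent spaces contained in the sum of the tangent spaces are
those at the given points. -/
theorem generically_eq_of_tangent_le {ι : Type*} [Fintype ι] [Nontrivial ι] {L : ℕ} (hL : 3 ≤ L)
    (h : Fintype.card ι * (L + 3) ≤ 2 ^ (L + 2)) :
    Generically fun v : ι × Fin (L + 3) × Fin 2 → ℂ =>
      (LinearIndependent ℂ fun i => segre fun q e => v (i, q, e)) ∧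
      (∀ i q, (fun e => v (i, q, e)) ≠ 0) ∧
      ∀ y : Fin (L + 3) → Fin 2 → ℂ, (∀ q, y q ≠ 0) →
        tangent y ≤ ⨆ i, tangent (fun q e => v (i, q, e)) →
        ∃ j, ∀ q, det₂ (fun e => v (j, q, e)) (y q) = 0 := by
  classical
  have hcard : Fintype.card ι ≤ 2 ^ L := by
    rw [pow_add] at h
    nlinarith
  have hpair : Generically fun v : ι × Fin (L + 3) × Fin 2 → ℂ =>
      ∀ q (p : {p : ι × ι // p.1 ≠ p.2}),
      det₂ (fun e => v (p.1.1, q, e)) (fun e => v (p.1.2, q, e)) ≠ 0 :=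
    Generically.all fun q => Generically.all fun p => generically_det₂_ne_zero p.2 q
  have hli : Generically fun v : ι × Fin (L + 3) × Fin 2 → ℂ =>
      ∀ (q : Fin (L + 2)) (k : Fin (L + 1)), LinearIndependent ℂ fun i =>
        segre fun j e => v (i, Fin.succAbove 0 (q.succAbove (k.succAbove j)), e) :=
    Generically.all fun q => Generically.all fun k =>
      (generically_linearIndependent_segre hcard).comp_factors
        (Fin.succAbove_right_injective.comp
          (Fin.succAbove_right_injective.comp Fin.succAbove_right_injective))
  have hrank := Generically.all fun j =>
    (generically_le_finrank_tangent_segreLine hL h j).comp_factors (Fin.succAbove_right_injective (p := (0 : Fin (L + 3))))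
  have hind := generically_linearIndependent_segre (ι := ι) (M := L + 3)
    (hcard.trans (Nat.pow_le_pow_right two_pos (by omega)))
  refine (((hpair.and hli).and hrank).and hind).mono ?_
  rintro v ⟨⟨⟨hpair, hli⟩, hrank⟩, hind⟩
  have hpair' : ∀ q i k, i ≠ k → det₂ (fun e => v (i, q, e)) (fun e => v (k, q, e)) ≠ 0 :=
    fun q i k hik => hpair q ⟨(i, k), hik⟩
  have hne : ∀ i q, (fun e => v (i, q, e)) ≠ 0 := by
    intro i q h0
    obtain ⟨k, hk⟩ := exists_ne i
    refine hpair' q k i hk ?_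
    rw [h0, det₂_zero_right]
  exact ⟨hind, hne, fun y hy hT =>
    exists_det₂_eq_zero_of_tangent_le (by omega) (v := fun i q e => v (i, q, e)) hne hpair' hli
      hrank hy hT⟩

theorem MvPolynomial.pderiv_prod_eq_zero {σ α : Type*} {s : Finset α} {p : α → MvPolynomial σ ℂ}
    {l : σ} (h : ∀ a ∈ s, pderiv l (p a) = 0) : pderiv l (∏ a ∈ s, p a) = 0 :=
  Finset.prod_induction p (fun P => pderiv l P = 0)
    (fun P Q hP hQ => by rw [pderiv_mul, hP, hQ, zero_mul, mul_zero, add_zero]) pderiv_one h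

section SumOfSegre

variable {ι : Type*} [Fintype ι] {M : ℕ}

/-- The coordinates of the sum of the pure tensors given by a parameter. -/
noncomputable def segreSum (ι : Type*) [Fintype ι] {M : ℕ} (c : Fin M → Fin 2) :
    MvPolynomial (ι × Fin M × Fin 2) ℂ :=
  ∑ i, ∏ j, X (i, j, c j)

theorem eval_segreSum (v : ι × Fin M × Fin 2 → ℂ) (c : Fin M → Fin 2) :
    eval v (segreSum ι c) = (∑ i, segre fun j e => v (i, j, e)) c := by
  simp [segreSum, segre_apply]

theorem eval_pderiv_segreSum (v : ι × Fin M × Fin 2 → ℂ) (i : ι) (j : Fin M) (e : Fin 2)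
    (c : Fin M → Fin 2) : eval v (pderiv (i, j, e) (segreSum ι c)) =
      segre (Function.update (fun j e => v (i, j, e)) j (Pi.single e 1)) c := by
  classical
  rw [segreSum, map_sum, Finset.sum_eq_single i, ← Finset.mul_prod_erase _ _ (Finset.mem_univ j),
    pderiv_mul, pderiv_prod_eq_zero, mul_zero, add_zero, segre_apply,
    ← Finset.mul_prod_erase _ _ (Finset.mem_univ j), Function.update_self, map_mul, map_prod]
  · congr 1
    · rcases eq_or_ne (c j) e with h | h
      · simp [h]
      · rw [pderiv_X_of_ne (by simpa using h), map_zero, Pi.single_eq_of_ne h]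
    · refine Finset.prod_congr rfl fun q hq => ?_
      rw [Function.update_of_ne (Finset.ne_of_mem_erase hq), eval_X]
  · intro q hq
    exact pderiv_X_of_ne (by simp [Finset.ne_of_mem_erase hq])
  · intro k _ hk
    exact pderiv_prod_eq_zero fun q _ => pderiv_X_of_ne (by simp [hk])
  · simp

theorem tangentImage_segreSum (v : ι × Fin M × Fin 2 → ℂ) :
    tangentImage (segreSum ι) v = ⨆ i, tangent fun j e => v (i, j, e) := by
  simp only [tangentImage, tangent_eq_iSup, segreLine_eq_iSup, Submodule.span_range_eq_iSup,
    iSup_prod]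
  refine iSup_congr fun i => iSup_congr fun j => iSup_congr fun e => ?_
  congr 2
  exact funext fun c => eval_pderiv_segreSum v i j e c

end SumOfSegre

theorem exists_perm_of_sum_eq {ι V : Type*} [Fintype ι] [AddCommGroup V] [Module ℂ V] {x : ι → V}
    (hx : LinearIndependent ℂ x) {π : ι → ι} {c : ι → ℂ} (h : ∑ i, c i • x (π i) = ∑ i, x i) :
    Function.Bijective π ∧ ∀ i, c i = 1 := by
  classical
  have hfib : ∀ j, ∑ i with π i = j, c i = 1 := by
    intro j
    rw [← Finset.sum_fiberwise Finset.univ π] at h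
    refine sub_eq_zero.1 (Fintype.linearIndependent_iff.1 hx (fun j => ∑ i with π i = j, c i - 1)
      ?_ j)
    simp only [sub_smul, one_smul, Finset.sum_sub_distrib, ← h, sub_eq_zero, Finset.sum_smul]
    refine Finset.sum_congr rfl fun j _ => Finset.sum_congr rfl fun i hi => ?_
    rw [(Finset.mem_filter.1 hi).2]
  have hsurj : Function.Surjective π := by
    intro j
    by_contra! hj
    simpa [Finset.filter_false_of_mem fun i _ => hj i] using hfib j
  have hbij := Finite.surjective_iff_bijective.1 hsurj
  refine ⟨hbij, fun i => ?_⟩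
  rw [← hfib (π i), Finset.sum_eq_single_of_mem i (by simp)]
  exact fun k hk hki => absurd (hbij.1 (Finset.mem_filter.1 hk).2) hki

end GenericPoints

theorem IsDecomposition.exists_eq_map {m n : ℕ} {T : BinTensor m} {D : Multiset (BinTensor m)}
    (h : IsDecomposition n T D) : ∃ w : Fin n → Fin m → Fin 2 → ℂ, (∀ i j, w i j ≠ 0) ∧
      D = Multiset.map (fun i => ⨂ₜ[ℂ] j, w i j) Finset.univ.val ∧
      ∑ i, (⨂ₜ[ℂ] j, w i j) = T := by
  obtain ⟨rfl, hD, rfl⟩ := h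
  obtain ⟨l, rfl⟩ := Quot.exists_rep D
  have hl : ∀ i : Fin l.length, l.get i ≠ 0 ∧ Decomposable (l.get i) := fun i =>
    hD _ (List.get_mem l i)
  choose hl₀ w hw using hl
  have hlw : (l : Multiset (BinTensor m)) =
      Multiset.map (fun i => ⨂ₜ[ℂ] j, w i j) Finset.univ.val := by
    rw [Fin.univ_val_map, ← funext hw, List.ofFn_get]
  refine ⟨w, fun i j h0 => hl₀ i ((hw i).trans ?_), hlw, (congrArg Multiset.sum hlw).symm⟩
  exact MultilinearMap.map_coord_zero _ j h0

theorem segre_binary_identifiable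
    (m k : ℕ) (hm : 5 < m) (hk : 1 ≤ k) (hkm : (k + 1) * m ≤ 2 ^ (m - 1)) :
    ∃ P : MvPolynomial (Fin (k + 1) × Fin m × Fin 2) ℂ, P ≠ 0 ∧
      ∀ v : Fin (k + 1) → Fin m → Fin 2 → ℂ,
        MvPolynomial.eval (fun p => v p.1 p.2.1 p.2.2) P ≠ 0 →
        ∀ D : Multiset (BinTensor m),
          IsDecomposition (k + 1) (∑ i : Fin (k + 1), ⨂ₜ[ℂ] j, v i j) D →
          D = Multiset.map (fun i : Fin (k + 1) => ⨂ₜ[ℂ] j, v i j) Finset.univ.val := by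
  obtain ⟨L, rfl⟩ : ∃ L, m = L + 3 := ⟨m - 3, by omega⟩
  have : Nontrivial (Fin (k + 1)) := Fin.nontrivial_iff_two_le.2 (by omega)
  obtain ⟨P, hP, h⟩ := (generically_tangentImage_le (segreSum (Fin (k + 1)) (M := L + 3))).and
    (generically_eq_of_tangent_le (ι := Fin (k + 1)) (L := L) (by omega) (by simpa using hkm))
  refine ⟨P, hP, fun v hv D hD => ?_⟩
  obtain ⟨hB, hli, hne, hcontact⟩ := h _ hv
  obtain ⟨w, hw, rfl, hsum⟩ := hD.exists_eq_map
  have hsegre : ∑ i, segre (w i) = ∑ i, segre (v i) := by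
    simpa using congrArg (PiTensorProduct.lift segre) hsum
  have hle := hB (fun p => w p.1 p.2.1 p.2.2) fun c => by
    rw [eval_segreSum, eval_segreSum]
    exact congrFun hsegre c
  rw [tangentImage_segreSum, tangentImage_segreSum] at hle
  choose π hπ using fun i => hcontact (w i) (hw i)
    ((le_iSup (fun i => tangent (w i)) i).trans hle)
  choose c hc using fun i q => exists_smul_of_det₂_eq_zero (hne (π i) q) (hπ i q)
  have hwv : ∀ i, w i = fun q => c i q • v (π i) q := fun i => funext (hc i)
  have hsegre' : ∑ i, (∏ q, c i q) • segre (v (π i)) = ∑ i, segre (v i) := by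
    rw [← hsegre]
    exact Finset.sum_congr rfl fun i _ => by rw [hwv i, MultilinearMap.map_smul_univ]
  obtain ⟨hbij, hone⟩ := exists_perm_of_sum_eq hli hsegre'
  have htprod : (fun i => ⨂ₜ[ℂ] j, w i j) =
      (fun i => ⨂ₜ[ℂ] j, v i j) ∘ Equiv.ofBijective π hbij := by
    ext1 i
    simp only [hwv i, MultilinearMap.map_smul_univ, hone i, one_smul, Function.comp_apply,
      Equiv.ofBijective_apply]
  rw [htprod, ← Multiset.map_map, Multiset.map_univ_val_equiv]
end

section
/- The Segre product of 5 copies of ℙ¹ is not 4-identifiable; concretely: there exists a nonzero polynomial P on the parameter space ((ℂ²)^5)^5 such that for every parameter v = (v_{i,j}) with P(v) ≠ 0, the tensor T(v) = Σ_{i=0}^{4} v_{i,0} ⊗ ⋯ ⊗ v_{i,4} ∈ ⨂^5 ℂ² admits at least two distinct decompositions of length 5 (two distinct multisets of 5 nonzero decomposable tensors summing to T(v)). -/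
open scoped TensorProduct

open Polynomial in
theorem exists_normal_form_prod_lines (R : ℂ[X]) (hR : R.natDegree ≤ 3) (u : Fin 5 → ℂ[X])
    (hu : ∀ j, (u j).natDegree ≤ 1) (a : Fin 5 → ℂ) :
    ∃ p q : ℂ[X], p.natDegree ≤ 7 ∧ q.natDegree ≤ 6 ∧
      q.coeff 6 = R.coeff 3 ^ 2 * ∏ j, a j ∧
      ∀ x y : ℂ, y ^ 2 = R.eval x →
        ∏ j, ((u j).eval x + a j * y) = p.eval x + q.eval x * y := by
  have step : ∀ (p q u : ℂ[X]) (a : ℂ) (m n : ℕ), p.natDegree ≤ m → q.natDegree ≤ n →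
      u.natDegree ≤ 1 →
      (p * u + C a * (q * R)).natDegree ≤ max (m + 1) (n + 3) ∧
      (q * u + C a * p).natDegree ≤ max (n + 1) m ∧
      ∀ x y : ℂ, y ^ 2 = R.eval x → (p.eval x + q.eval x * y) * (u.eval x + a * y) =
        (p * u + C a * (q * R)).eval x + (q * u + C a * p).eval x * y := by
    intro p q u a m n hp hq hu
    refine ⟨?_, ?_, ?_⟩
    · refine (natDegree_add_le _ _).trans (max_le_max (natDegree_mul_le_of_le hp hu) ?_)
      exact (natDegree_C_mul_le _ _).trans (natDegree_mul_le_of_le hq hR)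
    · refine (natDegree_add_le _ _).trans (max_le_max (natDegree_mul_le_of_le hq hu) ?_)
      exact (natDegree_C_mul_le _ _).trans hp
    · intro x y h
      simp only [eval_add, eval_mul, eval_C]
      linear_combination (q.eval x * a) * h
  obtain ⟨hp2, hq2, he2⟩ := step (u 0) (C (a 0)) (u 1) (a 1) 1 0 (hu 0) (by simp) (hu 1)
  have hc2 : (u 0 * u 1 + C (a 1) * (C (a 0) * R)).coeff 3 = a 0 * a 1 * R.coeff 3 := by
    rw [coeff_add, coeff_C_mul, coeff_C_mul, coeff_eq_zero_of_natDegree_lt]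
    · ring
    · exact (natDegree_mul_le_of_le (hu 0) (hu 1)).trans_lt (by norm_num)
  generalize u 0 * u 1 + C (a 1) * (C (a 0) * R) = p2 at *
  generalize C (a 0) * u 1 + C (a 1) * u 0 = q2 at *
  norm_num at hp2 hq2
  obtain ⟨hp3, hq3, he3⟩ := step p2 q2 (u 2) (a 2) 3 1 hp2 hq2 (hu 2)
  have hc3 : (q2 * u 2 + C (a 2) * p2).coeff 3 = a 0 * a 1 * a 2 * R.coeff 3 := by
    rw [coeff_add, coeff_C_mul, coeff_eq_zero_of_natDegree_lt, hc2]
    · ring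
    · exact (natDegree_mul_le_of_le hq2 (hu 2)).trans_lt (by norm_num)
  generalize p2 * u 2 + C (a 2) * (q2 * R) = p3 at *
  generalize q2 * u 2 + C (a 2) * p2 = q3 at *
  norm_num at hp3 hq3
  obtain ⟨hp4, hq4, he4⟩ := step p3 q3 (u 3) (a 3) 4 3 hp3 hq3 (hu 3)
  have hc4 : (p3 * u 3 + C (a 3) * (q3 * R)).coeff 6 =
      a 0 * a 1 * a 2 * a 3 * R.coeff 3 ^ 2 := by
    rw [coeff_add, coeff_C_mul, coeff_eq_zero_of_natDegree_lt,
      coeff_mul_add_eq_of_natDegree_le hq3 hR, hc3]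
    · ring
    · exact (natDegree_mul_le_of_le hp3 (hu 3)).trans_lt (by norm_num)
  generalize p3 * u 3 + C (a 3) * (q3 * R) = p4 at *
  generalize q3 * u 3 + C (a 3) * p3 = q4 at *
  norm_num at hp4 hq4
  obtain ⟨hp5, hq5, he5⟩ := step p4 q4 (u 4) (a 4) 6 4 hp4 hq4 (hu 4)
  norm_num at hp5 hq5
  refine ⟨_, _, hp5, hq5, ?_, ?_⟩
  · rw [coeff_add, coeff_C_mul, coeff_eq_zero_of_natDegree_lt, hc4, Fin.prod_univ_five]
    · ring
    · exact (natDegree_mul_le_of_le hq4 (hu 4)).trans_lt (by norm_num)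
  · intro x y h
    rw [← he5 x y h, ← he4 x y h, ← he3 x y h, ← he2 x y h, Fin.prod_univ_five, eval_C]

open Polynomial in
/-- Euler–Jacobi: the sum of the residues of `U / N` at simple zeros of `N`. -/
theorem sum_eval_div_eval_derivative_roots {n : ℕ} (N U : ℂ[X]) (hN : N.natDegree = n + 1)
    (hsep : N.Separable) (hU : U.natDegree ≤ n) :
    ∑ z ∈ N.roots.toFinset, U.eval z / N.derivative.eval z = U.coeff n / N.leadingCoeff := by
  classical
  have hnd := nodup_roots hsep
  have hcard : N.roots.card = n + 1 := by
    rw [← hN]; exact IsAlgClosed.card_roots_eq_natDegree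
  have hZ : N.roots.toFinset.card = n + 1 := by rw [Multiset.toFinset_card_of_nodup hnd, hcard]
  have hprod : N = C N.leadingCoeff * Lagrange.nodal N.roots.toFinset id := by
    conv_lhs => rw [← C_leadingCoeff_mul_prod_multiset_X_sub_C (hcard.trans hN.symm)]
    rw [Lagrange.nodal_eq, Finset.prod, Multiset.toFinset_val, hnd.dedup]
    rfl
  have hUlt : U.degree < (N.roots.toFinset.card : WithBot ℕ) := by
    rw [hZ]
    exact degree_le_natDegree.trans_lt (by exact_mod_cast Nat.lt_succ_of_le hU)
  have h := Lagrange.coeff_eq_sum (s := N.roots.toFinset) (v := id) Function.injective_id.injOn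
    hUlt
  rw [hZ, Nat.add_sub_cancel] at h
  rw [h, Finset.sum_div]
  refine Finset.sum_congr rfl fun z hz => ?_
  have hd : N.derivative.eval z = N.leadingCoeff * ∏ w ∈ N.roots.toFinset.erase z, (z - w) := by
    conv_lhs => rw [hprod]
    rw [derivative_C_mul, eval_C_mul]
    have := Lagrange.eval_nodal_derivative_eval_node_eq (v := id) hz
    rw [id] at this
    rw [this, Lagrange.eval_nodal]
    rfl
  rw [hd]
  simp only [id]
  rw [div_div, mul_comm]

open Polynomial in
theorem exists_second_coordinates (X Y e : Fin 4 → ℂ) (x y α β γ : Fin 5 → ℂ) (R A B : ℂ[X])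
    (hR : R.natDegree ≤ 3) (hA : A.natDegree ≤ 7) (hB : B.natDegree ≤ 5)
    (hRX : ∀ i, R.eval (X i) = Y i ^ 2) (hRx : ∀ j, R.eval (x j) = y j ^ 2)
    (hline : ∀ j, α j * y j + β j * x j + γ j = 0)
    (hAX : ∀ i, A.eval (X i) + Y i * B.eval (X i) = 0)
    (hAx : ∀ j, A.eval (x j) + y j * B.eval (x j) = 0)
    (hlead : A.coeff 7 = -(R.coeff 3 ^ 2 * ∏ j, α j)) (hlead0 : A.coeff 7 ≠ 0)
    (he : ∀ i, 2 * Y i * A.derivative.eval (X i) + 2 * R.eval (X i) * B.derivative.eval (X i) +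
      R.derivative.eval (X i) * B.eval (X i) = e i * ∏ j, (X i - x j))
    (hinj : Function.Injective (Sum.elim X x))
    (hsep : (A ^ 2 - R * B ^ 2).Separable) :
    ∃ ξ η d : Fin 5 → ℂ, (∀ k, d k ≠ 0) ∧ (∀ k j, ξ k ≠ x j) ∧ (∀ k i, ξ k ≠ X i) ∧
      ∀ r : Fin 5 → Fin 2,
        ∑ i, (e i)⁻¹ * ∏ j, (if r j = 0 then
          (α j * Y i + β j * X i + γ j) / (X i - x j) else 1) + (if r = 0 then 1 else 0) =
        ∑ k, d k * ∏ j, (if r j = 0 then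
          (α j * η k + β j * ξ k + γ j) / (ξ k - x j) else 1) := by
  classical
  set N := A ^ 2 - R * B ^ 2 with hNdef
  have hRB : (R * B ^ 2).natDegree ≤ 13 :=
    natDegree_mul_le_of_le hR (natDegree_pow_le_of_le 2 hB)
  have hcN : N.coeff 14 = A.coeff 7 ^ 2 := by
    rw [hNdef, coeff_sub, coeff_eq_zero_of_natDegree_lt (hRB.trans_lt (by norm_num)), sub_zero,
      pow_two, pow_two, coeff_mul_add_eq_of_natDegree_le hA hA]
  have hN14 : N.natDegree = 13 + 1 := by
    refine natDegree_eq_of_le_of_coeff_ne_zero ?_ (by rw [hcN]; exact pow_ne_zero 2 hlead0)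
    exact (natDegree_sub_le _ _).trans
      (max_le (natDegree_pow_le_of_le 2 hA) (hRB.trans (by norm_num)))
  have hN0 : N ≠ 0 := by rintro h; rw [h] at hN14; simp at hN14
  have hlc : N.leadingCoeff = A.coeff 7 ^ 2 := by rw [leadingCoeff, hN14, hcN]
  have hnd := nodup_roots hsep
  have hcard : N.roots.toFinset.card = 14 := by
    rw [Multiset.toFinset_card_of_nodup hnd, IsAlgClosed.card_roots_eq_natDegree, hN14]
  have hNev : ∀ z, N.eval z = A.eval z ^ 2 - R.eval z * B.eval z ^ 2 := fun z => by
    simp [hNdef]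
  have hroot : ∀ z, z ∈ N.roots.toFinset ↔ N.eval z = 0 := fun z => by
    rw [Multiset.mem_toFinset, mem_roots hN0, IsRoot.def]
  have hder : ∀ z, N.derivative.eval z = 2 * A.eval z * A.derivative.eval z -
      R.derivative.eval z * B.eval z ^ 2 - 2 * R.eval z * B.eval z * B.derivative.eval z :=
    fun z => by
      simp [hNdef, derivative_mul, derivative_pow]; ring
  have hderne : ∀ z, N.eval z = 0 → N.derivative.eval z ≠ 0 := fun z hz => by
      have := hsep.eval₂_derivative_ne_zero (RingHom.id ℂ) (x := z) (by rwa [eval₂_id])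
      rwa [eval₂_id] at this
  have hBne : ∀ z, N.eval z = 0 → B.eval z ≠ 0 := fun z hz hB0 => by
    have hA0 : A.eval z = 0 := by
      have := hNev z
      rw [hz, hB0] at this
      simpa using this.symm
    exact hderne z hz (by rw [hder, hB0, hA0]; ring)
  have hXN : ∀ i, N.eval (X i) = 0 := fun i => by
    rw [hNev, hRX]; linear_combination (A.eval (X i) - Y i * B.eval (X i)) * hAX i
  have hxN : ∀ j, N.eval (x j) = 0 := fun j => by
    rw [hNev, hRx]; linear_combination (A.eval (x j) - y j * B.eval (x j)) * hAx j
  set K : Finset ℂ := Finset.univ.image (Sum.elim X x) with hK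
  have hKsub : K ⊆ N.roots.toFinset := by
    intro z hz
    obtain ⟨s, -, rfl⟩ := Finset.mem_image.1 hz
    rw [hroot]
    rcases s with i | j
    exacts [hXN i, hxN j]
  have hcardK : K.card = 9 := by
    rw [hK, Finset.card_image_of_injective _ hinj]; simp
  have hcardQ : (N.roots.toFinset \ K).card = 5 := by
    rw [Finset.card_sdiff_of_subset hKsub, hcard, hcardK]
  let eqv := (Finset.equivFinOfCardEq hcardQ).symm
  have hξK : ∀ k s, (eqv k : ℂ) ≠ Sum.elim X x s := fun k s h =>
    (Finset.mem_sdiff.1 (eqv k).2).2 (h ▸ Finset.mem_image_of_mem _ (Finset.mem_univ s))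
  have hξN : ∀ k, N.eval (eqv k : ℂ) = 0 := fun k =>
    (hroot _).1 (Finset.mem_sdiff.1 (eqv k).2).1
  have hξx : ∀ k j, (eqv k : ℂ) ≠ x j := fun k j => hξK k (Sum.inr j)
  have hXx : ∀ i j, X i ≠ x j := fun i j h => by
    have := @hinj (Sum.inl i) (Sum.inr j) (by simpa using h)
    simp at this
  refine ⟨fun k => eqv k, fun k => - A.eval (eqv k : ℂ) / B.eval (eqv k : ℂ),
    fun k => B.eval (eqv k : ℂ) * (∏ j, ((eqv k : ℂ) - x j)) / N.derivative.eval (eqv k : ℂ),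
    ?_, hξx, fun k i => hξK k (Sum.inl i), ?_⟩
  · intro k
    refine div_ne_zero (mul_ne_zero (hBne _ (hξN k)) ?_) (hderne _ (hξN k))
    exact Finset.prod_ne_zero_iff.2 fun j _ => sub_ne_zero.2 (hξx k j)
  intro r
  set u : Fin 5 → ℂ[X] := fun j =>
    if r j = 0 then C (β j) * Polynomial.X + C (γ j) else Polynomial.X - C (x j) with hu
  set a : Fin 5 → ℂ := fun j => if r j = 0 then α j else 0 with ha
  have hu1 : ∀ j, (u j).natDegree ≤ 1 := fun j => by
    simp only [hu]
    split_ifs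
    · exact natDegree_linear_le
    · exact natDegree_X_sub_C_le _
  obtain ⟨p, q, hp, hq, hq6, hpq⟩ := exists_normal_form_prod_lines R hR u hu1 a
  have hfac : ∀ z w : ℂ, (∀ j, z ≠ x j) → w ^ 2 = R.eval z →
      p.eval z + q.eval z * w = (∏ j, (z - x j)) * ∏ j, (if r j = 0 then
          (α j * w + β j * z + γ j) / (z - x j) else 1) := by
    intro z w hz hw
    rw [← hpq z w hw, ← Finset.prod_mul_distrib]
    refine Finset.prod_congr rfl fun j _ => ?_
    have := sub_ne_zero.2 (hz j)
    simp only [hu, ha]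
    split_ifs
    · simp; field_simp; ring
    · simp
  have hpqx : ∀ j, p.eval (x j) + q.eval (x j) * y j = 0 := by
    intro j
    rw [← hpq _ _ (hRx j).symm]
    refine Finset.prod_eq_zero (Finset.mem_univ j) ?_
    simp only [hu, ha]
    split_ifs
    · simp; linear_combination hline j
    · simp
  set U := q * A - p * B with hUdef
  have hpB : (p * B).natDegree ≤ 12 := natDegree_mul_le_of_le hp hB
  have hU : U.natDegree ≤ 13 :=
    (natDegree_sub_le _ _).trans (max_le (natDegree_mul_le_of_le hq hA) (hpB.trans (by norm_num)))
  have hU13 : U.coeff 13 = R.coeff 3 ^ 2 * (∏ j, a j) * A.coeff 7 := by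
    rw [hUdef, coeff_sub, coeff_eq_zero_of_natDegree_lt (hpB.trans_lt (by norm_num)), sub_zero,
      coeff_mul_add_eq_of_natDegree_le hq hA, hq6]
  have hUev : ∀ z w, A.eval z + w * B.eval z = 0 →
      U.eval z = - B.eval z * (p.eval z + q.eval z * w) := by
    intro z w h
    simp only [hUdef, eval_sub, eval_mul]
    linear_combination q.eval z * h
  have hres := sum_eval_div_eval_derivative_roots N U hN14 hsep hU
  rw [← Finset.sdiff_union_of_subset hKsub,
    Finset.sum_union Finset.sdiff_disjoint, hK, Finset.sum_image hinj.injOn,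
    Fintype.sum_sum_type, ← Finset.sum_coe_sort, ← eqv.sum_comp, hU13, hlc] at hres
  have h1 : ∀ i, U.eval (X i) / N.derivative.eval (X i) =
      (e i)⁻¹ * ∏ j, (if r j = 0 then
          (α j * Y i + β j * X i + γ j) / (X i - x j) else 1) := by
    intro i
    have hN' : N.derivative.eval (X i) = - B.eval (X i) * (e i * ∏ j, (X i - x j)) := by
      rw [hder, ← he i]; linear_combination 2 * A.derivative.eval (X i) * hAX i
    have hne := hderne _ (hXN i)
    rw [hN'] at hne ⊢
    rw [hUev _ _ (hAX i), hfac _ _ (hXx i) (hRX i).symm]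
    have h2 := left_ne_zero_of_mul hne
    have h3 := left_ne_zero_of_mul (right_ne_zero_of_mul hne)
    have h4 := right_ne_zero_of_mul (right_ne_zero_of_mul hne)
    rw [mul_div_mul_left _ _ h2, mul_comm (e i), mul_div_mul_left _ _ h4, div_eq_inv_mul]
  have h2 : ∀ j, U.eval (x j) / N.derivative.eval (x j) = 0 := by
    intro j
    rw [hUev _ _ (hAx j), hpqx]; simp
  have h3 : ∀ k, U.eval (eqv k : ℂ) / N.derivative.eval (eqv k : ℂ) =
      -(B.eval (eqv k : ℂ) * (∏ j, ((eqv k : ℂ) - x j)) / N.derivative.eval (eqv k : ℂ) *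
        ∏ j, (if r j = 0 then (α j * (- A.eval (eqv k : ℂ) / B.eval (eqv k : ℂ)) +
          β j * (eqv k : ℂ) + γ j) / ((eqv k : ℂ) - x j) else 1)) := by
    intro k
    have hB0 := hBne _ (hξN k)
    have hn := hNev (eqv k : ℂ)
    rw [hξN k] at hn
    rw [hUev (eqv k : ℂ) (- A.eval (eqv k : ℂ) / B.eval (eqv k : ℂ)) (by field_simp; ring),
      hfac (eqv k : ℂ) _ (hξx k) (by field_simp; linear_combination -hn)]
    ring
  have h4 : R.coeff 3 ^ 2 * (∏ j, a j) * A.coeff 7 / A.coeff 7 ^ 2 =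
      - (if r = 0 then 1 else 0) := by
    by_cases hr : r = 0
    · have : ∏ j, a j = ∏ j, α j := by simp [ha, hr]
      rw [if_pos hr, this, show R.coeff 3 ^ 2 * ∏ j, α j = - A.coeff 7 by rw [hlead]; ring]
      field_simp
    · have : ∏ j, a j = 0 := by
        obtain ⟨j, hj⟩ := Function.ne_iff.1 hr
        exact Finset.prod_eq_zero (Finset.mem_univ j) (by simp only [ha]; exact if_neg (by simpa using hj))
      rw [if_neg hr, this]; simp
  simp only [Sum.elim_inl, Sum.elim_inr, h1, h2, h3, h4, Finset.sum_neg_distrib,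
    Finset.sum_const_zero, add_zero] at hres
  linear_combination hres

/-- The abscissae of four points on the cubic curve attached to two linear forms. -/
def nodeX {K : Type*} [Ring K] (P Q : Fin 3 → K) : Fin 4 → K :=
  ![P 1 * Q 2 - P 2 * Q 1, P 2 * Q 0 - P 0 * Q 2, P 0 * Q 1 - P 1 * Q 0, 0]

/-- The ordinates of four points on the cubic curve attached to two linear forms. -/
def nodeY {K : Type*} [Ring K] (P Q : Fin 3 → K) : Fin 4 → K :=
  ![Q 0 * Q 1 * P 2 - P 0 * P 2 * Q 1 + Q 1 * Q 1 * P 2 + P 1 * P 2 * Q 0 - Q 1 * Q 2 * P 0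
      - Q 1 * Q 2 * P 1 + P 1 * P 2 * Q 2 - P 2 * P 2 * Q 1,
    P 0 * P 0 * Q 2 - Q 0 * Q 0 * P 2 + P 0 * P 1 * Q 2 - Q 0 * Q 1 * P 2 - P 0 * P 2 * Q 0
      + Q 0 * Q 2 * P 0 + Q 0 * Q 2 * P 1 + P 0 * P 2 * Q 2 - P 1 * P 2 * Q 0 - P 2 * P 2 * Q 0,
    P 0 * P 0 * Q 1 - Q 0 * Q 0 * P 1 - P 0 * P 1 * Q 0 + Q 0 * Q 1 * P 0 - Q 0 * Q 1 * P 1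
      - P 0 * P 1 * Q 2 + P 0 * P 2 * Q 1 - Q 0 * Q 2 * P 1 + Q 1 * Q 1 * P 0 + Q 1 * Q 2 * P 0,
    P 0 * P 1 * Q 2 - Q 0 * Q 2 * P 1 - P 1 * P 2 * Q 0 + Q 1 * Q 2 * P 0]

theorem det_identity_of_chord_slopes {K : Type*} [CommRing K]
    (X1 X2 X3 Y1 Y2 Y3 Y4 P1 P2 P3 Q1 Q2 Q3 z1 z2 z3 : K)
    (h12 : X2 * (Y1 + Y4) + (Y2 - Y4) * X1 = X1 * (X2 - X1) * (-2 * Q1))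
    (h13 : X3 * (Y1 + Y4) + (Y3 - Y4) * X1 = X1 * (X3 - X1) * (2 * P1))
    (h21 : X1 * (Y2 + Y4) + (Y1 - Y4) * X2 = X2 * (X1 - X2) * (-2 * (P2 + Q2)))
    (h23 : X3 * (Y2 + Y4) + (Y3 - Y4) * X2 = X2 * (X3 - X2) * (-2 * P2))
    (h31 : X1 * (Y3 + Y4) + (Y1 - Y4) * X3 = X3 * (X1 - X3) * (2 * (P3 + Q3)))
    (h32 : X2 * (Y3 + Y4) + (Y2 - Y4) * X3 = X3 * (X2 - X3) * (2 * Q3))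
    (hc : -(Y1 * (X2 - X3) ^ 2 + Y2 * (X1 - X3) ^ 2 + Y3 * (X1 - X2) ^ 2) =
      (X2 - X1) * (X2 - X3) * (X3 - X1) * (Q2 - Q1 + P3 - P1))
    (hz : (z1 - z2) * z3 * (Q1 * z1 + Q2 * z2 + Q3 * z3) =
      -((z1 - z3) * z2) * (P1 * z1 + P2 * z2 + P3 * z3)) :
    (z1 * z2 * X3 * (X2 - X1) + z1 * z3 * X2 * (X1 - X3) + z2 * z3 * X1 * (X3 - X2)) *
      (X2 * X3 * (X2 - X3) * (Y1 + Y4) * z1 - X1 * X3 * (X1 - X3) * (Y2 + Y4) * z2 +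
        X1 * X2 * (X1 - X2) * (Y3 + Y4) * z3) +
    (z1 * z2 * (Y3 - Y4) * (X2 - X1) + z1 * z3 * (Y2 - Y4) * (X1 - X3) +
        z2 * z3 * (Y1 - Y4) * (X3 - X2)) *
      (X2 * X3 * (X2 - X3) * X1 * z1 - X1 * X3 * (X1 - X3) * X2 * z2 +
        X1 * X2 * (X1 - X2) * X3 * z3) = 0 := by
  linear_combination
    (z1 ^ 2 * z3 * (X1 - X3) * (X2 * X3 * (X2 - X3))) * h12 +
    (z1 ^ 2 * z2 * (X2 - X1) * (X2 * X3 * (X2 - X3))) * h13 -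
    (z2 ^ 2 * z3 * (X3 - X2) * (X1 * X3 * (X1 - X3))) * h21 -
    (z2 ^ 2 * z1 * (X2 - X1) * (X1 * X3 * (X1 - X3))) * h23 +
    (z3 ^ 2 * z2 * (X3 - X2) * (X1 * X2 * (X1 - X2))) * h31 +
    (z3 ^ 2 * z1 * (X1 - X3) * (X1 * X2 * (X1 - X2))) * h32 +
    (z1 * z2 * z3 * (2 * X1 * X2 * X3)) * hc +
    (2 * X1 * X2 * X3 * (X2 - X1) * (X2 - X3) * (X3 - X1)) * hz

open Polynomial in
theorem eval_eq_sq_of_chord {K : Type*} [Field K] (X1 X2 X3 Y1 Y2 Y3 Y4 z1 z2 z3 x y α β : K)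
    (R : K[X]) (hR : R.natDegree ≤ 3) (r1 : R.eval X1 = Y1 ^ 2) (r2 : R.eval X2 = Y2 ^ 2)
    (r3 : R.eval X3 = Y3 ^ 2) (r4 : R.eval 0 = Y4 ^ 2)
    (l1 : z1 * X1 = x * z1 + α * (Y1 - Y4) + β * X1)
    (l2 : z2 * X2 = x * z2 + α * (Y2 - Y4) + β * X2)
    (l3 : z3 * X3 = x * z3 + α * (Y3 - Y4) + β * X3)
    (hy : α * y = α * Y4 - β * x) (hα : α ≠ 0)
    (h1 : X1 ≠ 0) (h2 : X2 ≠ 0) (h3 : X3 ≠ 0) (h12 : X1 ≠ X2) (h13 : X1 ≠ X3) (h23 : X2 ≠ X3)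
    (hΔ : z1 * ((Y2 - Y4) * X3 - (Y3 - Y4) * X2) - z2 * ((Y1 - Y4) * X3 - (Y3 - Y4) * X1) +
      z3 * ((Y1 - Y4) * X2 - (Y2 - Y4) * X1) ≠ 0)
    (h : (z1 * z2 * X3 * (X2 - X1) + z1 * z3 * X2 * (X1 - X3) + z2 * z3 * X1 * (X3 - X2)) *
      (X2 * X3 * (X2 - X3) * (Y1 + Y4) * z1 - X1 * X3 * (X1 - X3) * (Y2 + Y4) * z2 +
        X1 * X2 * (X1 - X2) * (Y3 + Y4) * z3) +
    (z1 * z2 * (Y3 - Y4) * (X2 - X1) + z1 * z3 * (Y2 - Y4) * (X1 - X3) +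
        z2 * z3 * (Y1 - Y4) * (X3 - X2)) *
      (X2 * X3 * (X2 - X3) * X1 * z1 - X1 * X3 * (X1 - X3) * X2 * z2 +
        X1 * X2 * (X1 - X2) * X3 * z3) = 0) :
    R.eval x = y ^ 2 := by
  set Δ := z1 * ((Y2 - Y4) * X3 - (Y3 - Y4) * X2) - z2 * ((Y1 - Y4) * X3 - (Y3 - Y4) * X1) +
      z3 * ((Y1 - Y4) * X2 - (Y2 - Y4) * X1) with hΔd
  have ha : α * Δ = z1 * z2 * X3 * (X2 - X1) + z1 * z3 * X2 * (X1 - X3) +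
      z2 * z3 * X1 * (X3 - X2) := by
    rw [hΔd]
    linear_combination (z2 * X3 - z3 * X2) * l1 + (z3 * X1 - z1 * X3) * l2 +
      (z1 * X2 - z2 * X1) * l3
  have hb : β * Δ = -(z1 * z2 * (Y3 - Y4) * (X2 - X1) + z1 * z3 * (Y2 - Y4) * (X1 - X3) +
        z2 * z3 * (Y1 - Y4) * (X3 - X2)) := by
    rw [hΔd]
    linear_combination -(z2 * (Y3 - Y4) - z3 * (Y2 - Y4)) * l1 -
      (z3 * (Y1 - Y4) - z1 * (Y3 - Y4)) * l2 - (z1 * (Y2 - Y4) - z2 * (Y1 - Y4)) * l3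
  have hab : α * (X2 * X3 * (X2 - X3) * (Y1 + Y4) * z1 - X1 * X3 * (X1 - X3) * (Y2 + Y4) * z2 +
        X1 * X2 * (X1 - X2) * (Y3 + Y4) * z3) =
      β * (X2 * X3 * (X2 - X3) * X1 * z1 - X1 * X3 * (X1 - X3) * X2 * z2 +
        X1 * X2 * (X1 - X2) * X3 * z3) := by
    refine mul_left_cancel₀ hΔ ?_
    rw [← ha] at h
    linear_combination h - (X2 * X3 * (X2 - X3) * X1 * z1 - X1 * X3 * (X1 - X3) * X2 * z2 +
        X1 * X2 * (X1 - X2) * X3 * z3) * hb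
  have hG : X2 * X3 * (X2 - X3) * (Y1 + y) * (z1 - β) - X1 * X3 * (X1 - X3) * (Y2 + y) * (z2 - β) +
      X1 * X2 * (X1 - X2) * (Y3 + y) * (z3 - β) -
      (X1 - X2) * (X1 - X3) * (X2 - X3) * (Y4 + y) * (0 - β) = 0 := by
    refine (mul_eq_zero.1 ?_).resolve_left hα
    linear_combination (X2 * X3 * (X2 - X3) * (z1 - β) - X1 * X3 * (X1 - X3) * (z2 - β) +
        X1 * X2 * (X1 - X2) * (z3 - β) + (X1 - X2) * (X1 - X3) * (X2 - X3) * β) * hy + hab +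
      β * (X2 * X3 * (X2 - X3) * l1 - X1 * X3 * (X1 - X3) * l2 + X1 * X2 * (X1 - X2) * l3)
  obtain ⟨c0, c1, c2, c3, hev⟩ : ∃ c0 c1 c2 c3 : K, ∀ t, R.eval t =
      c0 + c1 * t + c2 * t ^ 2 + c3 * t ^ 3 := by
    refine ⟨R.coeff 0, R.coeff 1, R.coeff 2, R.coeff 3, fun t => ?_⟩
    rw [eval_eq_sum_range' (show R.natDegree < 4 by omega)]
    simp [Finset.sum_range_succ]
  rw [hev] at r1 r2 r3 r4 ⊢
  set k := c0 + c1 * x + c2 * x ^ 2 + c3 * x ^ 3 - y ^ 2 with hk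
  have key : ∀ t Yt zt : K, c0 + c1 * t + c2 * t ^ 2 + c3 * t ^ 3 = Yt ^ 2 →
      (zt - β) * (t - x) = α * (Yt - y) →
      α * k = (t - x) * ((Yt + y) * (zt - β) -
        α * (c1 + c2 * (t + x) + c3 * (t ^ 2 + t * x + x ^ 2))) := by
    intro t Yt zt hr hl
    rw [hk]
    linear_combination α * hr - (Yt + y) * hl
  have k1 := key X1 Y1 z1 r1 (by linear_combination l1 + hy)
  have k2 := key X2 Y2 z2 r2 (by linear_combination l2 + hy)
  have k3 := key X3 Y3 z3 r3 (by linear_combination l3 + hy)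
  have k4 := key 0 Y4 0 r4 (by linear_combination hy)
  have hz : α * k * (X1 * X2 * X3 * (X1 - X2) * (X1 - X3) * (X2 - X3)) = 0 := by
    linear_combination
      -(X2 * X3 * (X2 - X3)) * ((X2 - x) * (X3 - x) * (0 - x)) * k1 +
      (X1 * X3 * (X1 - X3)) * ((X1 - x) * (X3 - x) * (0 - x)) * k2 -
      (X1 * X2 * (X1 - X2)) * ((X1 - x) * (X2 - x) * (0 - x)) * k3 +
      ((X1 - X2) * (X1 - X3) * (X2 - X3)) * ((X1 - x) * (X2 - x) * (X3 - x)) * k4 -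
      (X1 - x) * (X2 - x) * (X3 - x) * (0 - x) * hG
  have hne : X1 * X2 * X3 * (X1 - X2) * (X1 - X3) * (X2 - X3) ≠ 0 := by
    simp [h1, h2, h3, sub_ne_zero, h12, h13, h23]
  have hk0 : k = 0 := by simpa [hne, hα] using hz
  rw [hk] at hk0
  linear_combination hk0

open Polynomial in
theorem eval_eq_sq_of_nodes {K : Type*} [Field K] (P Q : Fin 3 → K) (z : Fin 3 → K) (x y α β : K)
    (R : K[X]) (hR : R.natDegree ≤ 3) (hRX : ∀ i, R.eval (nodeX P Q i) = nodeY P Q i ^ 2)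
    (hl : ∀ i : Fin 3, z i * nodeX P Q i.castSucc = x * z i +
      α * (nodeY P Q i.castSucc - nodeY P Q 3) + β * nodeX P Q i.castSucc)
    (hy : α * y = α * nodeY P Q 3 - β * x) (hα : α ≠ 0)
    (hX : Function.Injective (nodeX P Q))
    (hΔ : (Matrix.of fun i : Fin 3 => ![z i, nodeY P Q i.castSucc - nodeY P Q 3,
      nodeX P Q i.castSucc]).det ≠ 0)
    (hz : (z 0 - z 1) * z 2 * ∑ i, Q i * z i = -((z 0 - z 2) * z 1) * ∑ i, P i * z i) :
    R.eval x = y ^ 2 := by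
  have l1 := hl 0
  have l2 := hl 1
  have l3 := hl 2
  have r1 := hRX 0
  have r2 := hRX 1
  have r3 := hRX 2
  have r4 := hRX 3
  have n1 := hX.ne (show (0 : Fin 4) ≠ 3 by decide)
  have n2 := hX.ne (show (1 : Fin 4) ≠ 3 by decide)
  have n3 := hX.ne (show (2 : Fin 4) ≠ 3 by decide)
  have n12 := hX.ne (show (0 : Fin 4) ≠ 1 by decide)
  have n13 := hX.ne (show (0 : Fin 4) ≠ 2 by decide)
  have n23 := hX.ne (show (1 : Fin 4) ≠ 2 by decide)
  rw [Fin.sum_univ_three, Fin.sum_univ_three] at hz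
  have e4 : nodeX P Q 3 = 0 := rfl
  rw [e4] at n1 n2 n3 r4
  simp only [Fin.castSucc_zero, show (1 : Fin 3).castSucc = 1 from rfl,
    show (2 : Fin 3).castSucc = 2 from rfl] at l1 l2 l3
  refine eval_eq_sq_of_chord _ _ _ _ _ _ _ _ _ _ x y α β R hR r1 r2 r3 r4 l1 l2 l3 hy hα n1 n2 n3
    n12 n13 n23 ?_ ?_
  · rw [Matrix.det_fin_three] at hΔ
    simp only [Matrix.of_apply, Fin.castSucc_zero, show (1 : Fin 3).castSucc = 1 from rfl,
      show (2 : Fin 3).castSucc = 2 from rfl, Matrix.cons_val] at hΔ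
    intro h
    apply hΔ
    linear_combination h
  · refine det_identity_of_chord_slopes _ _ _ _ _ _ _ (P 0) (P 1) (P 2) (Q 0) (Q 1) (Q 2) _ _ _
      ?_ ?_ ?_ ?_ ?_ ?_ ?_ hz <;>
    · simp only [nodeX, nodeY, Matrix.cons_val]
      ring

theorem tprod_smul_add_eq_sum {m : ℕ} (z : Fin m → ℂ) (a b : Fin m → Fin 2 → ℂ) :
    (⨂ₜ[ℂ] j, (z j • a j + b j) : BinTensor m) =
      ∑ r : Fin m → Fin 2, (∏ j, if r j = 0 then z j else 1) •
        ⨂ₜ[ℂ] j, (if r j = 0 then a j else b j) := by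
  have h : (fun j => z j • a j + b j) =
      fun j => ∑ k : Fin 2, (if k = 0 then z j else 1) • (if k = 0 then a j else b j) := by
    ext j; simp
  rw [h, MultilinearMap.map_sum]
  exact Finset.sum_congr rfl fun r _ => MultilinearMap.map_smul_univ _ _ _

/-- The linear form on tensors that is the product of given linear forms in the factors. -/
noncomputable def prodForm {m : ℕ} (l : Fin m → (Fin 2 → ℂ) →ₗ[ℂ] ℂ) : BinTensor m →ₗ[ℂ] ℂ :=
  PiTensorProduct.lift ((MultilinearMap.mkPiAlgebra ℂ (Fin m) ℂ).compLinearMap l)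

theorem prodForm_tprod {m : ℕ} (l : Fin m → (Fin 2 → ℂ) →ₗ[ℂ] ℂ) (u : Fin m → Fin 2 → ℂ) :
    prodForm l (⨂ₜ[ℂ] j, u j) = ∏ j, l j (u j) := by
  simp [prodForm]

theorem exists_dual_forms (a b : Fin 2 → ℂ) (h : a 0 * b 1 - a 1 * b 0 ≠ 0) :
    ∃ l l' : (Fin 2 → ℂ) →ₗ[ℂ] ℂ, l a = 1 ∧ l b = 0 ∧ l' a = 0 ∧ l' b = 1 := by
  refine ⟨(a 0 * b 1 - a 1 * b 0)⁻¹ • (b 1 • LinearMap.proj 0 - b 0 • LinearMap.proj 1),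
    (a 0 * b 1 - a 1 * b 0)⁻¹ • (a 0 • LinearMap.proj 1 - a 1 • LinearMap.proj 0),
    ?_, ?_, ?_, ?_⟩ <;>
  · simp only [LinearMap.smul_apply, LinearMap.sub_apply, LinearMap.proj_apply, smul_eq_mul]
    field_simp
    try ring

theorem exists_two_decompositions {v : Fin 5 → Fin 5 → Fin 2 → ℂ} (a b : Fin 5 → Fin 2 → ℂ)
    (hab : ∀ j, a j 0 * b j 1 - a j 1 * b j 0 ≠ 0) (z : Fin 4 → Fin 5 → ℂ) (c : Fin 4 → ℂ)
    (hc : ∀ i, c i ≠ 0)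
    (hv : ∀ i : Fin 4, (⨂ₜ[ℂ] j, v i.castSucc j : BinTensor 5) = c i • ⨂ₜ[ℂ] j, (z i j • a j + b j))
    (hv4 : v 4 = a) (φ : Fin 5 → Fin 5 → ℂ) (d : Fin 5 → ℂ) (hd : ∀ k, d k ≠ 0)
    (hne : ∀ i, ¬ (φ 0 0 = z i 0 ∧ φ 0 1 = z i 1))
    (h : ∀ r : Fin 5 → Fin 2, ∑ i, c i * ∏ j, (if r j = 0 then z i j else 1) +
      (if r = 0 then 1 else 0) = ∑ k, d k * ∏ j, (if r j = 0 then φ k j else 1)) :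
    ∃ D₁ D₂ : Multiset (BinTensor 5), D₁ ≠ D₂ ∧
      IsDecomposition 5 (∑ i : Fin 5, ⨂ₜ[ℂ] j, v i j) D₁ ∧
      IsDecomposition 5 (∑ i : Fin 5, ⨂ₜ[ℂ] j, v i j) D₂ := by
  choose l l' hla hlb hla' hlb' using fun j => exists_dual_forms (a j) (b j) (hab j)
  set w : Fin 5 → BinTensor 5 := fun k => d k • ⨂ₜ[ℂ] j, (φ k j • a j + b j) with hw
  have hl' : ∀ (c : ℂ) (z : Fin 5 → ℂ),
      prodForm l' (c • ⨂ₜ[ℂ] j, (z j • a j + b j)) = c := fun c z => by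
    simp [prodForm_tprod, hla', hlb']
  have hl : ∀ (k : Fin 5) (c : ℂ) (z : Fin 5 → ℂ),
      prodForm (Function.update l' k (l k)) (c • ⨂ₜ[ℂ] j, (z j • a j + b j)) = c * z k := by
    intro k c z
    rw [map_smul, prodForm_tprod, smul_eq_mul, Finset.prod_eq_single k]
    · simp [hla, hlb]
    · intro j _ hj
      simp [hj, hla', hlb']
    · simp
  have hsum : (∑ i : Fin 5, ⨂ₜ[ℂ] j, v i j : BinTensor 5) = ∑ k, w k := by
    have ha : (⨂ₜ[ℂ] j, v 4 j : BinTensor 5) = ∑ r : Fin 5 → Fin 2,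
        (if r = 0 then (1 : ℂ) else 0) • ⨂ₜ[ℂ] j, (if r j = 0 then a j else b j) := by
      simp [hv4, ite_smul]
    rw [Fin.sum_univ_castSucc, show Fin.last 4 = 4 from rfl, ha]
    simp only [hv, hw, tprod_smul_add_eq_sum, Finset.smul_sum, smul_smul]
    rw [Finset.sum_comm, ← Finset.sum_add_distrib, Finset.sum_comm (s := Finset.univ (α := Fin 5))]
    refine Finset.sum_congr rfl fun r _ => ?_
    rw [← Finset.sum_smul, ← Finset.sum_smul, ← add_smul, h]
  have hw0 : ∀ i : Fin 5, w 0 ≠ ⨂ₜ[ℂ] j, v i j := by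
    intro i
    induction i using Fin.lastCases with
    | last =>
      rw [show Fin.last 4 = 4 from rfl, hv4]
      intro hi
      have := congrArg (prodForm l') hi
      simp only [hw] at this
      rw [hl', prodForm_tprod] at this
      exact hd 0 (by simpa [hla'] using this)
    | cast i =>
      rw [hv]
      intro hi
      have h0 := congrArg (prodForm l') hi
      have h1 := fun k => congrArg (prodForm (Function.update l' k (l k))) hi
      simp only [hw, hl', hl] at h0 h1
      refine hne i ⟨mul_left_cancel₀ (hc i) ?_, mul_left_cancel₀ (hc i) ?_⟩
      · rw [← h1, h0]
      · rw [← h1, h0]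
  refine ⟨Finset.univ.val.map fun i => ⨂ₜ[ℂ] j, v i j, Finset.univ.val.map w, ?_,
    ⟨by simp, ?_, rfl⟩, ⟨by simp, ?_, hsum.symm⟩⟩
  · intro hD
    have : w 0 ∈ Finset.univ.val.map w := Multiset.mem_map_of_mem _ (Finset.mem_univ_val 0)
    rw [← hD, Multiset.mem_map] at this
    obtain ⟨i, -, hi⟩ := this
    exact hw0 i hi.symm
  · intro t ht
    obtain ⟨i, -, rfl⟩ := Multiset.mem_map.1 ht
    refine ⟨?_, v i, rfl⟩
    induction i using Fin.lastCases with
    | last =>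
      rw [show Fin.last 4 = 4 from rfl, hv4]
      intro hi
      have := congrArg (prodForm l) hi
      rw [prodForm_tprod] at this
      simp [hla] at this
    | cast i =>
      intro hi
      have := congrArg (prodForm l') hi
      rw [hv, hl', map_zero] at this
      exact hc i this
  · intro t ht
    obtain ⟨k, -, rfl⟩ := Multiset.mem_map.1 ht
    refine ⟨fun hk => ?_, Function.update (fun j => φ k j • a j + b j) 0 (d k • (φ k 0 • a 0 + b 0)),
      ?_⟩
    · have := congrArg (prodForm l') hk
      simp only [hw] at this
      rw [hl', map_zero] at this
      exact hd k this
    · rw [MultilinearMap.map_update_smul, Function.update_eq_self]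

section InterpolationSystems

variable {K L : Type*} [CommRing K] [CommRing L]

/-- The linear system for two linear forms `P`, `Q` such that the conics `(z₀ - z₂) z₁` and
`(z₀ - z₁) z₂`, multiplied by `P` and `Q`, add up to a cubic through the five given points. -/
def pencilMatrix (z : Fin 3 → Fin 5 → K) : Matrix (Fin 6) (Fin 6) K :=
  Fin.append (m := 5) (n := 1)
    (fun j => Fin.append (m := 3) (n := 3) (fun k => (z 0 j - z 2 j) * z 1 j * z k j)
      fun k => (z 0 j - z 1 j) * z 2 j * z k j)
    fun _ => ![1, 0, 0, 0, 0, 0]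

/-- The linear system for the coefficients of `A` and `B` expressing that `A + yB` vanishes at the
points `(X, Y)` and `(x, y)` of the curve `y ^ 2 = R(x)` and has given derivatives at the points
`(X, Y)`, where `ρ` is the derivative of `R`. -/
def interpMatrix (X Y ρ : Fin 4 → K) (x y : Fin 5 → K) : Matrix (Fin 13) (Fin 13) K :=
  Fin.append (m := 9) (n := 4)
    (Fin.append (m := 4) (n := 5)
      (fun i => Fin.append (m := 7) (n := 6) (fun k => X i ^ (k : ℕ)) fun k => Y i * X i ^ (k : ℕ))
      fun j => Fin.append (m := 7) (n := 6) (fun k => x j ^ (k : ℕ)) fun k => y j * x j ^ (k : ℕ))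
    fun i => Fin.append (m := 7) (n := 6)
      (fun k => 2 * Y i * ((k : ℕ) * X i ^ ((k : ℕ) - 1)))
      fun k => 2 * Y i ^ 2 * ((k : ℕ) * X i ^ ((k : ℕ) - 1)) + ρ i * X i ^ (k : ℕ)

/-- The right hand side of the system `interpMatrix`, where `a` is the leading coefficient of `A`. -/
def interpRhs (X Y e : Fin 4 → K) (x : Fin 5 → K) (a : K) : Fin 13 → K :=
  Fin.append (m := 9) (n := 4)
    (Fin.append (m := 4) (n := 5) (fun i => -(a * X i ^ 7)) fun j => -(a * x j ^ 7))
    fun i => e i * ∏ j, (X i - x j) - 2 * Y i * (7 * a * X i ^ 6)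

/-- The value at `t` of the polynomial with coefficients `u`. -/
def coeffEval {n : ℕ} (u : Fin n → K) (t : K) : K := ∑ k, u k * t ^ (k : ℕ)

theorem pencilMatrix_map (f : K →+* L) (z : Fin 3 → Fin 5 → K) :
    (pencilMatrix z).map f = pencilMatrix fun i j => f (z i j) := by
  ext r k
  induction r using Fin.addCases (m := 5) (n := 1) with
  | left r =>
    induction k using Fin.addCases (m := 3) (n := 3) with
    | left k =>
      rw [Matrix.map_apply]
      simp only [pencilMatrix, Fin.append_left, map_mul, map_sub]
    | right k =>
      rw [Matrix.map_apply]
      simp only [pencilMatrix, Fin.append_left, Fin.append_right, map_mul, map_sub]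
  | right r =>
    rw [Matrix.map_apply]
    simp only [pencilMatrix, Fin.append_right]
    fin_cases k <;> simp

theorem interpMatrix_map (f : K →+* L) (X Y ρ : Fin 4 → K) (x y : Fin 5 → K) :
    (interpMatrix X Y ρ x y).map f = interpMatrix (f ∘ X) (f ∘ Y) (f ∘ ρ) (f ∘ x) (f ∘ y) := by
  ext r k
  induction r using Fin.addCases (m := 9) (n := 4) with
  | left r =>
    induction r using Fin.addCases (m := 4) (n := 5) with
    | left r =>
      induction k using Fin.addCases (m := 7) (n := 6) with
      | left k => rw [Matrix.map_apply]; simp [interpMatrix]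
      | right k => rw [Matrix.map_apply]; simp [interpMatrix]
    | right r =>
      induction k using Fin.addCases (m := 7) (n := 6) with
      | left k => rw [Matrix.map_apply]; simp [interpMatrix]
      | right k => rw [Matrix.map_apply]; simp [interpMatrix]
  | right r =>
    induction k using Fin.addCases (m := 7) (n := 6) with
    | left k => rw [Matrix.map_apply]; simp [interpMatrix, map_ofNat f 2]
    | right k => rw [Matrix.map_apply]; simp [interpMatrix, map_ofNat f 2]

theorem interpRhs_map (f : K →+* L) (X Y e : Fin 4 → K) (x : Fin 5 → K) (a : K) :
    f ∘ interpRhs X Y e x a = interpRhs (f ∘ X) (f ∘ Y) (f ∘ e) (f ∘ x) (f a) := by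
  ext r
  induction r using Fin.addCases (m := 9) (n := 4) with
  | left r =>
    induction r using Fin.addCases (m := 4) (n := 5) with
    | left r => simp [interpRhs]
    | right r => simp [interpRhs]
  | right r => simp [interpRhs, map_ofNat f 2, map_ofNat f 7]

theorem nodeX_map (f : K →+* L) (P Q : Fin 3 → K) : f ∘ nodeX P Q = nodeX (f ∘ P) (f ∘ Q) := by
  ext i
  fin_cases i <;> simp [nodeX]

theorem nodeY_map (f : K →+* L) (P Q : Fin 3 → K) : f ∘ nodeY P Q = nodeY (f ∘ P) (f ∘ Q) := by
  ext i
  fin_cases i <;> simp [nodeY]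

theorem coeffEval_map (f : K →+* L) {n : ℕ} (u : Fin n → K) (t : K) :
    f (coeffEval u t) = coeffEval (f ∘ u) (f t) := by
  simp [coeffEval]

theorem det_map_ne_zero_of_mul_eq_one {n : Type*} [Fintype n] [DecidableEq n] (p : ℕ)
    [Fact p.Prime] (M : Matrix n n ℤ) (N : Matrix n n (ZMod p))
    (h : M.map (Int.castRingHom (ZMod p)) * N = 1) [CharZero L] :
    (M.map (Int.castRingHom L)).det ≠ 0 := by
  have h1 : (Int.castRingHom (ZMod p)) M.det ≠ 0 := by
    rw [RingHom.map_det]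
    exact left_ne_zero_of_mul_eq_one (b := N.det) (by
      rw [← Matrix.det_mul]
      exact (congrArg Matrix.det h).trans Matrix.det_one)
  have h2 : M.det ≠ 0 := fun h => h1 (by rw [h, map_zero])
  have h3 : (Int.castRingHom L) M.det ≠ 0 := by simpa using h2
  rwa [RingHom.map_det] at h3

open Polynomial in
/-- The polynomial with given coefficients. -/
noncomputable def coeffPoly {n : ℕ} (u : Fin n → K) : K[X] := ∑ k, C (u k) * X ^ (k : ℕ)

open Polynomial in
theorem eval_coeffPoly {n : ℕ} (u : Fin n → K) (t : K) :
    (coeffPoly u).eval t = coeffEval u t := by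
  simp [coeffPoly, coeffEval, eval_finsetSum]

open Polynomial in
theorem coeff_coeffPoly {n : ℕ} (u : Fin n → K) (k : Fin n) : (coeffPoly u).coeff k = u k := by
  simp [coeffPoly, coeff_X_pow, Fin.val_inj]

open Polynomial in
theorem natDegree_coeffPoly_le {n : ℕ} (u : Fin (n + 1) → K) : (coeffPoly u).natDegree ≤ n := by
  refine natDegree_sum_le_of_forall_le _ _ fun k _ => ?_
  exact (natDegree_C_mul_X_pow_le _ _).trans (Nat.lt_succ_iff.1 k.2)

open Polynomial in
theorem eval_derivative_coeffPoly {n : ℕ} (u : Fin n → K) (t : K) :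
    (coeffPoly u).derivative.eval t = ∑ k, u k * ((k : ℕ) * t ^ ((k : ℕ) - 1)) := by
  simp [coeffPoly, derivative_X_pow, eval_finsetSum]

open Polynomial in
theorem interp_of_mulVec_eq {X Y ρ e : Fin 4 → K} {x y : Fin 5 → K} {a : K} {u : Fin 13 → K}
    (h : (interpMatrix X Y ρ x y).mulVec u = interpRhs X Y e x a) {A B : K[X]}
    (hA : A = coeffPoly (Fin.snoc (n := 7) (α := fun _ => K) (fun k => u (Fin.castAdd 6 k)) a))
    (hB : B = coeffPoly fun k : Fin 6 => u (Fin.natAdd 7 k)) :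
    (∀ i, A.eval (X i) + Y i * B.eval (X i) = 0) ∧ (∀ j, A.eval (x j) + y j * B.eval (x j) = 0) ∧
    ∀ i, 2 * Y i * A.derivative.eval (X i) + 2 * Y i ^ 2 * B.derivative.eval (X i) +
      ρ i * B.eval (X i) = e i * ∏ j, (X i - x j) := by
  have hsplit : ∀ r, ∑ k : Fin 7, interpMatrix X Y ρ x y r (Fin.castAdd 6 k) * u (Fin.castAdd 6 k) +
      ∑ k : Fin 6, interpMatrix X Y ρ x y r (Fin.natAdd 7 k) * u (Fin.natAdd 7 k) =
      interpRhs X Y e x a r := by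
    intro r
    rw [← h, Matrix.mulVec, dotProduct, ← Fin.sum_univ_add (a := 7) (b := 6)
      fun k => interpMatrix X Y ρ x y r k * u k]
  have hA1 : ∀ t, A.eval t = ∑ k : Fin 7, u (Fin.castAdd 6 k) * t ^ (k : ℕ) + a * t ^ 7 := by
    intro t
    rw [hA, eval_coeffPoly, coeffEval, Fin.sum_univ_castSucc]
    simp only [Fin.snoc_castSucc, Fin.snoc_last, Fin.val_castSucc, Fin.val_last]
  have hA2 : ∀ t, A.derivative.eval t =
      ∑ k : Fin 7, u (Fin.castAdd 6 k) * ((k : ℕ) * t ^ ((k : ℕ) - 1)) + a * (7 * t ^ 6) := by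
    intro t
    rw [hA, eval_derivative_coeffPoly, Fin.sum_univ_castSucc]
    simp only [Fin.snoc_castSucc, Fin.snoc_last, Fin.val_castSucc, Fin.val_last]
    norm_num
  have hB1 : ∀ t, B.eval t = ∑ k : Fin 6, u (Fin.natAdd 7 k) * t ^ (k : ℕ) := by
    intro t
    rw [hB, eval_coeffPoly, coeffEval]
  have hB2 : ∀ t, B.derivative.eval t =
      ∑ k : Fin 6, u (Fin.natAdd 7 k) * ((k : ℕ) * t ^ ((k : ℕ) - 1)) := by
    intro t
    rw [hB, eval_derivative_coeffPoly]
  refine ⟨fun i => ?_, fun j => ?_, fun i => ?_⟩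
  · have := hsplit (Fin.castAdd 4 (Fin.castAdd 5 i))
    simp only [interpMatrix, interpRhs, Fin.append_left, Fin.append_right] at this
    rw [hA1, hB1, Finset.mul_sum]
    have h1 : ∑ k : Fin 6, Y i * (u (Fin.natAdd 7 k) * X i ^ (k : ℕ)) =
        ∑ k : Fin 6, Y i * X i ^ (k : ℕ) * u (Fin.natAdd 7 k) :=
      Finset.sum_congr rfl fun k _ => by ring
    simp only [mul_comm (u (Fin.castAdd 6 _))]
    linear_combination this + h1
  · have := hsplit (Fin.castAdd 4 (Fin.natAdd 4 j))
    simp only [interpMatrix, interpRhs, Fin.append_left, Fin.append_right] at this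
    rw [hA1, hB1, Finset.mul_sum]
    have h1 : ∑ k : Fin 6, y j * (u (Fin.natAdd 7 k) * x j ^ (k : ℕ)) =
        ∑ k : Fin 6, y j * x j ^ (k : ℕ) * u (Fin.natAdd 7 k) :=
      Finset.sum_congr rfl fun k _ => by ring
    simp only [mul_comm (u (Fin.castAdd 6 _))]
    linear_combination this + h1
  · have := hsplit (Fin.natAdd 9 i)
    simp only [interpMatrix, interpRhs, Fin.append_left, Fin.append_right] at this
    have h1 : 2 * Y i * ∑ k : Fin 7, u (Fin.castAdd 6 k) * ((k : ℕ) * X i ^ ((k : ℕ) - 1)) =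
        ∑ k : Fin 7, 2 * Y i * ((k : ℕ) * X i ^ ((k : ℕ) - 1)) * u (Fin.castAdd 6 k) := by
      rw [Finset.mul_sum]
      exact Finset.sum_congr rfl fun k _ => by ring
    have h2 : 2 * Y i ^ 2 * ∑ k : Fin 6, u (Fin.natAdd 7 k) * ((k : ℕ) * X i ^ ((k : ℕ) - 1)) +
          ρ i * ∑ k : Fin 6, u (Fin.natAdd 7 k) * X i ^ (k : ℕ) =
        ∑ k : Fin 6, (2 * Y i ^ 2 * ((k : ℕ) * X i ^ ((k : ℕ) - 1)) + ρ i * X i ^ (k : ℕ)) *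
          u (Fin.natAdd 7 k) := by
      rw [Finset.mul_sum, Finset.mul_sum, ← Finset.sum_add_distrib]
      exact Finset.sum_congr rfl fun k _ => by ring
    rw [hA2, hB1, hB2]
    linear_combination this + h1 + h2

end InterpolationSystems

/-- The linear system for the chord slopes `z` of the lines through a point with abscissa `x`,
with unknowns `x` and the coefficients of the line. -/
def chordMatrix {K : Type*} [Ring K] (X Y : Fin 4 → K) (z : Fin 3 → K) : Matrix (Fin 3) (Fin 3) K :=
  Matrix.of fun i => ![z i, Y i.castSucc - Y 3, X i.castSucc]

theorem exists_second_coordinates_of_systems {z : Fin 3 → Fin 5 → ℂ} {e : Fin 4 → ℂ}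
    {w : Fin 6 → ℂ} {P Q : Fin 3 → ℂ} (hP : P = fun k : Fin 3 => w (Fin.castAdd 3 k))
    (hQ : Q = fun k : Fin 3 => w (Fin.natAdd 3 k)) {X Y : Fin 4 → ℂ} (hX : X = nodeX P Q)
    (hY : Y = nodeY P Q) {l : Fin 5 → Fin 3 → ℂ} {r : Fin 4 → ℂ} {u : Fin 13 → ℂ}
    {x y : Fin 5 → ℂ} {ρ : Fin 4 → ℂ} {a : ℂ}
    (hw : ∀ j : Fin 5, (pencilMatrix z).mulVec w (Fin.castAdd 1 j) = 0)
    (hl : ∀ j, (chordMatrix X Y fun i => z i j).mulVec (l j) = fun i => z i j * X i.castSucc)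
    (hr : (Matrix.vandermonde X).mulVec r = fun i => Y i ^ 2)
    (hx : x = fun j => l j 0) (hy : y = fun j => Y 3 - l j 2 * l j 0 / l j 1)
    (hρ : ρ = fun i => r 1 + 2 * r 2 * X i + 3 * r 3 * X i ^ 2)
    (ha : a = -(r 3 ^ 2 * ∏ j, l j 1)) (ha0 : a ≠ 0)
    (hu : (interpMatrix X Y ρ x y).mulVec u = interpRhs X Y e x a)
    (hinj : Function.Injective (Sum.elim X x))
    (hΔ : ∀ j, (chordMatrix X Y fun i => z i j).det ≠ 0)
    (hsep : (coeffPoly (Fin.snoc (n := 7) (α := fun _ => ℂ) (fun k => u (Fin.castAdd 6 k)) a) ^ 2 -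
      coeffPoly r * coeffPoly (fun k : Fin 6 => u (Fin.natAdd 7 k)) ^ 2).Separable)
    {zs : Fin 4 → Fin 5 → ℂ} (hzs : zs = Fin.snoc (n := 3) (α := fun _ => Fin 5 → ℂ) z 0)
    (hslope : ∀ i, (zs i 0 - l 0 2) * l 1 1 ≠ (zs i 1 - l 1 2) * l 0 1) :
    ∃ φ : Fin 5 → Fin 5 → ℂ, ∃ d : Fin 5 → ℂ, (∀ k, d k ≠ 0) ∧
      (∀ i, ¬ (φ 0 0 = zs i 0 ∧ φ 0 1 = zs i 1)) ∧
      ∀ r : Fin 5 → Fin 2, ∑ i, (e i)⁻¹ * ∏ j, (if r j = 0 then zs i j else 1) +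
        (if r = 0 then 1 else 0) = ∑ k, d k * ∏ j, (if r j = 0 then φ k j else 1) := by
  have hα : ∀ j, l j 1 ≠ 0 := fun j h0 => ha0 (by
    rw [ha, Finset.prod_eq_zero (Finset.mem_univ j) h0]; simp)
  obtain ⟨hAX, hAx, he⟩ := interp_of_mulVec_eq hu rfl rfl
  set A := coeffPoly (Fin.snoc (n := 7) (α := fun _ => ℂ) (fun k => u (Fin.castAdd 6 k)) a) with hA
  set B := coeffPoly (fun k : Fin 6 => u (Fin.natAdd 7 k)) with hB
  have hR : (coeffPoly r).natDegree ≤ 3 := natDegree_coeffPoly_le r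
  have hRX : ∀ i, (coeffPoly r).eval (X i) = Y i ^ 2 := by
    intro i
    rw [eval_coeffPoly, ← congrFun hr i]
    simp [coeffEval, Matrix.mulVec, dotProduct, Matrix.vandermonde_apply, mul_comm]
  have hRX' : ∀ i, (coeffPoly r).derivative.eval (X i) = ρ i := by
    intro i
    rw [eval_derivative_coeffPoly, hρ]
    simp [Fin.sum_univ_succ]
    ring
  have hl' : ∀ j (i : Fin 3), z i j * X i.castSucc =
      x j * z i j + l j 1 * (Y i.castSucc - Y 3) + l j 2 * X i.castSucc := by
    intro j i
    rw [← congrFun (hl j) i, hx]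
    simp [chordMatrix, Matrix.mulVec, dotProduct, Fin.sum_univ_three, mul_comm]
  have hy' : ∀ j, l j 1 * y j = l j 1 * Y 3 - l j 2 * x j := by
    intro j
    rw [hy, hx]
    have := hα j
    field_simp
  have hXinj : Function.Injective X := hinj.comp Sum.inl_injective
  have hRx : ∀ j, (coeffPoly r).eval (x j) = y j ^ 2 := by
    intro j
    subst hX hY
    refine eval_eq_sq_of_nodes P Q (fun i => z i j) (x j) (y j) (l j 1) (l j 2) _ hR hRX (hl' j)
      (hy' j) (hα j) hXinj (hΔ j) ?_
    have := hw j
    rw [Matrix.mulVec, dotProduct, Fin.sum_univ_add (a := 3) (b := 3)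
      fun k => pencilMatrix z (Fin.castAdd 1 j) k * w k] at this
    simp only [pencilMatrix, Fin.append_left, Fin.append_right] at this
    simp only [hP, hQ, Fin.sum_univ_three] at this ⊢
    linear_combination this
  have hA7 : A.coeff 7 = a := (coeff_coeffPoly _ (Fin.last 7)).trans (Fin.snoc_last _ _)
  have hr3 : (coeffPoly r).coeff 3 = r 3 := coeff_coeffPoly r 3
  have hXx : ∀ i j, X i - x j ≠ 0 := fun i j h =>
    Sum.inl_ne_inr (hinj (a₁ := Sum.inl i) (a₂ := Sum.inr j) (sub_eq_zero.1 h))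
  have hX3 : X 3 = 0 := by rw [hX]; rfl
  have hzs' : ∀ i j, (l j 1 * Y i + l j 2 * X i + -(l j 1 * Y 3)) / (X i - x j) = zs i j := by
    intro i j
    rw [div_eq_iff (hXx i j), hzs]
    induction i using Fin.lastCases with
    | last =>
      rw [Fin.snoc_last]
      change l j 1 * Y 3 + l j 2 * X 3 + -(l j 1 * Y 3) = 0 * _
      rw [hX3]
      ring
    | cast i =>
      rw [Fin.snoc_castSucc]
      linear_combination -hl' j i
  obtain ⟨ξ, η, d, hd, hξx, hξX, h⟩ := exists_second_coordinates X Y e x y (fun j => l j 1)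
    (fun j => l j 2) (fun j => -(l j 1 * Y 3)) (coeffPoly r) A B hR (natDegree_coeffPoly_le _)
    (natDegree_coeffPoly_le _) hRX hRx
    (fun j => by linear_combination hy' j) hAX hAx
    (by rw [hA7, hr3, ha]) (by rw [hA7]; exact ha0)
    (fun i => by rw [hRX, hRX', he]) hinj hsep
  refine ⟨fun k j => (l j 1 * η k + l j 2 * ξ k + -(l j 1 * Y 3)) / (ξ k - x j), d, hd, ?_, ?_⟩
  · rintro i ⟨h0, h1⟩
    have key : ∀ j, (l j 1 * η 0 + l j 2 * ξ 0 + -(l j 1 * Y 3)) / (ξ 0 - x j) = zs i j →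
        l j 1 * (η 0 - Y i) = (zs i j - l j 2) * (ξ 0 - X i) := by
      intro j hj
      have h2 := hzs' i j
      rw [div_eq_iff (sub_ne_zero.2 (hξx 0 j))] at hj
      rw [div_eq_iff (hXx i j)] at h2
      linear_combination hj - h2
    have k0 := key 0 h0
    have k1 := key 1 h1
    refine hslope i (mul_right_cancel₀ (sub_ne_zero.2 (hξX 0 i)) ?_)
    linear_combination l 0 1 * k1 - l 1 1 * k0
  · intro s
    rw [← h s]
    simp only [hzs']

/-- The affine coordinates of the first three summands at the reference point. -/
def refZ : Fin 3 → Fin 5 → ℤ :=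
  ![![-702, 0, 216, -728, -67068], ![-247, -88, -8, -248, -23828], ![378, 162, 27, 377, 37422]]

/-- The inverse weights of the first four summands at the reference point. -/
def refE : Fin 4 → ℤ :=
  ![68197284416701440000, -361645284000000000, -89137848515625000, 109453474432253952]

/-- The two linear forms at the reference point. -/
def refW : Fin 6 → ℤ := ![1, 27, 16, -1, 54, 28]

/-- The abscissae of the first four points at the reference point. -/
def refX : Fin 4 → ℤ := ![-108, -44, 81, 0]

/-- The ordinates of the first four points at the reference point. -/
def refY : Fin 4 → ℤ := ![432, 2000, 6750, 3456]

/-- The data of the five lines at the reference point. -/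
def refL : Fin 5 → Fin 3 → ℤ :=
  ![![-140, 65, -1612], ![-128, 33, -924], ![-119, 7, -218], ![-135, 65, -1638],
    ![-80, 7245, -220248]]

/-- The ordinates of the five centres of projection at the reference point. -/
def refy : Fin 5 → ℤ := ![-16, -128, -250, 54, 1024]

/-- The coefficients of the cubic at the reference point. -/
def refR : Fin 4 → ℤ := ![11943936, 248832, 1728, 4]

/-- The coefficients of the interpolating function at the reference point. -/
def refU : Fin 13 → ℤ :=
  ![269963054362074811465728000000, 7455328309396470933061632000, 73560606904287270383616000,
    278188997565168353664000, 33956131904158464000, -1812550668744816000, -2034054560538000,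
    -78114309711248498688000000, -1343416800004258307328000, -5875467083282933136000,
    3356390273876640000, 37043517415905000, 12953960019000]

/-- The derivative of the cubic at the first four points of the reference point. -/
def refρ : Fin 4 → ℤ := fun i => refR 1 + 2 * refR 2 * refX i + 3 * refR 3 * refX i ^ 2

/-- The roots of the eliminant at the reference point. -/
def refRoot : Fin 14 → ℤ := fun i =>
  (![6, 10, 15, 12, -2, -4, -5, 3, 8, -24, 20, 30, 40, 120] i) ^ 2 - 144

theorem refX_eq : refX = nodeX (fun k : Fin 3 => refW (Fin.castAdd 3 k))
    (fun k : Fin 3 => refW (Fin.natAdd 3 k)) := by decide +kernel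

theorem refY_eq : refY = nodeY (fun k : Fin 3 => refW (Fin.castAdd 3 k))
    (fun k : Fin 3 => refW (Fin.natAdd 3 k)) := by decide +kernel

theorem refW_eq : (pencilMatrix refZ).mulVec refW = ![0, 0, 0, 0, 0, 1] := by decide +kernel

theorem refL_eq : ∀ j, (chordMatrix refX refY fun i => refZ i j).mulVec (refL j) =
    fun i => refZ i j * refX i.castSucc := by decide +kernel

theorem refR_eq : (Matrix.vandermonde refX).mulVec refR = fun i => refY i ^ 2 := by
  decide +kernel

theorem refU_eq : (interpMatrix refX refY refρ (fun j => refL j 0) refy).mulVec refU =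
    interpRhs refX refY refE (fun j => refL j 0) (-113135022000) := by decide +kernel

theorem refy_eq : ∀ j, refL j 1 * refy j = refL j 1 * refY 3 - refL j 2 * refL j 0 := by
  decide +kernel

theorem refA_eq : -113135022000 = -(refR 3 ^ 2 * ∏ j, refL j 1) := by decide +kernel

theorem refRoot_injective : Function.Injective refRoot := by decide +kernel

theorem eval_refRoot : ∀ i,
    coeffEval (Fin.snoc (n := 7) (α := fun _ => ℤ) (fun k => refU (Fin.castAdd 6 k))
      (-113135022000)) (refRoot i) ^ 2 -
    coeffEval refR (refRoot i) *
      coeffEval (fun k : Fin 6 => refU (Fin.natAdd 7 k)) (refRoot i) ^ 2 = 0 := by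
  decide +kernel

theorem refXL_injective : Function.Injective (Sum.elim refX fun j => refL j 0) := by
  decide +kernel

theorem refSlope_ne : ∀ i : Fin 4,
    (Fin.snoc (n := 3) (α := fun _ => Fin 5 → ℤ) refZ 0 i 0 - refL 0 2) * refL 1 1 ≠
      (Fin.snoc (n := 3) (α := fun _ => Fin 5 → ℤ) refZ 0 i 1 - refL 1 2) * refL 0 1 := by
  decide +kernel

instance : Fact (Nat.Prime 17) := ⟨by norm_num⟩

instance : Fact (Nat.Prime 23) := ⟨by norm_num⟩

theorem det_refPencil_ne_zero {K : Type*} [CommRing K] [CharZero K] :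
    ((pencilMatrix refZ).map (Int.castRingHom K)).det ≠ 0 :=
  det_map_ne_zero_of_mul_eq_one 17 _ !![0, 0, 0, 0, 0, 1;
    8, 3, 10, 0, 2, 10;
    6, 10, 1, 13, 7, 16;
    7, 0, 3, 8, 10, 16;
    5, 5, 15, 7, 5, 3;
    4, 11, 13, 12, 1, 11] (by decide +kernel)

theorem det_refInterp_ne_zero {K : Type*} [CommRing K] [CharZero K] :
    ((interpMatrix refX refY refρ (fun j => refL j 0) refy).map (Int.castRingHom K)).det ≠ 0 :=
  det_map_ne_zero_of_mul_eq_one 23 _ !![6, 9, 21, 15, 16, 19, 9, 17, 4, 15, 14, 0, 3;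
    15, 14, 1, 22, 17, 19, 0, 10, 17, 18, 12, 19, 22;
    2, 13, 8, 20, 20, 19, 2, 9, 22, 12, 15, 1, 15;
    5, 1, 20, 5, 16, 19, 14, 11, 1, 4, 12, 5, 3;
    11, 4, 15, 22, 3, 11, 11, 19, 19, 7, 16, 6, 8;
    16, 6, 22, 11, 10, 12, 6, 2, 7, 12, 9, 9, 14;
    0, 20, 12, 5, 22, 21, 6, 5, 1, 5, 4, 7, 22;
    22, 10, 8, 13, 5, 16, 10, 1, 7, 9, 13, 0, 11;
    15, 22, 17, 18, 17, 12, 9, 0, 5, 12, 12, 16, 15;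
    5, 16, 11, 12, 12, 3, 7, 0, 3, 1, 10, 12, 3;
    0, 9, 10, 8, 10, 7, 17, 1, 7, 9, 5, 20, 10;
    6, 2, 14, 13, 18, 8, 11, 16, 4, 6, 21, 19, 13;
    16, 11, 20, 16, 17, 10, 11, 1, 13, 16, 9, 13, 8] (by decide +kernel)

theorem det_refChord_ne_zero : ∀ j, (chordMatrix refX refY fun i => refZ i j).det ≠ 0 := by
  intro j
  rw [Matrix.det_fin_three]
  revert j
  decide +kernel

/-- The filter of Zariski neighbourhoods of a point of affine space. -/
def zariskiNhds {σ : Type*} (v₀ : σ → ℂ) : Filter (σ → ℂ) where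
  sets := {s | ∃ q : MvPolynomial σ ℂ, MvPolynomial.eval v₀ q ≠ 0 ∧
    ∀ v, MvPolynomial.eval v q ≠ 0 → v ∈ s}
  univ_sets := ⟨1, by simp, fun _ _ => trivial⟩
  sets_of_superset := fun ⟨q, h, h'⟩ hst => ⟨q, h, fun v hv => hst (h' v hv)⟩
  inter_sets := fun ⟨q, h, h'⟩ ⟨p, k, k'⟩ => ⟨q * p, by simp [h, k], fun v hv => by
    rw [map_mul] at hv
    exact ⟨h' v (left_ne_zero_of_mul hv), k' v (right_ne_zero_of_mul hv)⟩⟩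

theorem eventually_zariskiNhds {σ : Type*} {v₀ : σ → ℂ} {p : (σ → ℂ) → Prop} :
    (∀ᶠ v in zariskiNhds v₀, p v) ↔ ∃ q : MvPolynomial σ ℂ, MvPolynomial.eval v₀ q ≠ 0 ∧
      ∀ v, MvPolynomial.eval v q ≠ 0 → p v := Iff.rfl

/-- A function on affine space that is given by a regular fraction near `v₀`. -/
def RegularAt {σ : Type*} (v₀ : σ → ℂ) (f : (σ → ℂ) → ℂ) : Prop :=
  ∃ p q : MvPolynomial σ ℂ, MvPolynomial.eval v₀ q ≠ 0 ∧
    ∀ v, MvPolynomial.eval v q ≠ 0 → f v = MvPolynomial.eval v p / MvPolynomial.eval v q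

namespace RegularAt

variable {σ : Type*} {v₀ : σ → ℂ} {f g : (σ → ℂ) → ℂ}

theorem const (c : ℂ) : RegularAt v₀ fun _ => c := ⟨MvPolynomial.C c, 1, by simp, by simp⟩

theorem coord (s : σ) : RegularAt v₀ fun v => v s := ⟨MvPolynomial.X s, 1, by simp, by simp⟩

theorem add (hf : RegularAt v₀ f) (hg : RegularAt v₀ g) : RegularAt v₀ fun v => f v + g v := by
  obtain ⟨p, q, h, h'⟩ := hf
  obtain ⟨r, s, k, k'⟩ := hg
  refine ⟨p * s + r * q, q * s, by simp [h, k], fun v hv => ?_⟩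
  rw [map_mul] at hv
  have h1 := left_ne_zero_of_mul hv
  have h2 := right_ne_zero_of_mul hv
  beta_reduce
  rw [h' v h1, k' v h2, map_add, map_mul, map_mul, map_mul]
  field_simp

theorem mul (hf : RegularAt v₀ f) (hg : RegularAt v₀ g) : RegularAt v₀ fun v => f v * g v := by
  obtain ⟨p, q, h, h'⟩ := hf
  obtain ⟨r, s, k, k'⟩ := hg
  refine ⟨p * r, q * s, by simp [h, k], fun v hv => ?_⟩
  rw [map_mul] at hv
  have h1 := left_ne_zero_of_mul hv
  have h2 := right_ne_zero_of_mul hv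
  beta_reduce
  rw [h' v h1, k' v h2, map_mul, map_mul]
  field_simp

theorem inv (hf : RegularAt v₀ f) (h0 : f v₀ ≠ 0) : RegularAt v₀ fun v => (f v)⁻¹ := by
  obtain ⟨p, q, h, h'⟩ := hf
  have hp : MvPolynomial.eval v₀ p ≠ 0 := fun hp => h0 (by rw [h' _ h, hp, zero_div])
  refine ⟨q * q, p * q, by simp [h, hp], fun v hv => ?_⟩
  rw [map_mul] at hv
  have h1 := left_ne_zero_of_mul hv
  have h2 := right_ne_zero_of_mul hv
  beta_reduce
  rw [h' v h2, map_mul, map_mul]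
  field_simp

theorem neg (hf : RegularAt v₀ f) : RegularAt v₀ fun v => -f v := by
  simpa using (const (-1)).mul hf

theorem sub (hf : RegularAt v₀ f) (hg : RegularAt v₀ g) : RegularAt v₀ fun v => f v - g v := by
  simpa [sub_eq_add_neg] using hf.add hg.neg

theorem div (hf : RegularAt v₀ f) (hg : RegularAt v₀ g) (h0 : g v₀ ≠ 0) :
    RegularAt v₀ fun v => f v / g v := by
  simpa [div_eq_mul_inv] using hf.mul (hg.inv h0)

theorem pow (hf : RegularAt v₀ f) (n : ℕ) : RegularAt v₀ fun v => f v ^ n := by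
  induction n with
  | zero => simpa using const 1
  | succ n ih => simpa [pow_succ] using ih.mul hf

theorem sum {ι : Type*} (s : Finset ι) {F : ι → (σ → ℂ) → ℂ} (hF : ∀ i, RegularAt v₀ (F i)) :
    RegularAt v₀ fun v => ∑ i ∈ s, F i v := by
  classical
  induction s using Finset.induction_on with
  | empty => simpa using const 0
  | insert a s ha ih => simpa [Finset.sum_insert ha] using (hF a).add ih

theorem prod {ι : Type*} (s : Finset ι) {F : ι → (σ → ℂ) → ℂ} (hF : ∀ i, RegularAt v₀ (F i)) :
    RegularAt v₀ fun v => ∏ i ∈ s, F i v := by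
  classical
  induction s using Finset.induction_on with
  | empty => simpa using const 1
  | insert a s ha ih => simpa [Finset.prod_insert ha] using (hF a).mul ih

theorem det {n : Type*} [Fintype n] [DecidableEq n] {M : (σ → ℂ) → Matrix n n ℂ}
    (hM : ∀ i j, RegularAt v₀ fun v => M v i j) : RegularAt v₀ fun v => (M v).det := by
  simp only [Matrix.det_apply']
  exact sum _ fun τ => (const _).mul (prod _ fun i => hM _ _)

theorem eventually_ne_zero (hf : RegularAt v₀ f) (h0 : f v₀ ≠ 0) :
    ∀ᶠ v in zariskiNhds v₀, f v ≠ 0 := by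
  obtain ⟨p, q, h, h'⟩ := hf
  have hp : MvPolynomial.eval v₀ p ≠ 0 := fun hp => h0 (by rw [h' _ h, hp, zero_div])
  refine ⟨p * q, by simp [h, hp], fun v hv => ?_⟩
  rw [map_mul] at hv
  have h1 := left_ne_zero_of_mul hv
  have h2 := right_ne_zero_of_mul hv
  change f v ≠ 0
  rw [h' v h2]
  exact div_ne_zero h1 h2

theorem eventually_ne (hf : RegularAt v₀ f) (hg : RegularAt v₀ g) (h0 : f v₀ ≠ g v₀) :
    ∀ᶠ v in zariskiNhds v₀, f v ≠ g v :=
  ((hf.sub hg).eventually_ne_zero (sub_ne_zero.2 h0)).mono fun _ => sub_ne_zero.1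

theorem exists_mulVec_eq {n : Type*} [Fintype n] [DecidableEq n] {M : (σ → ℂ) → Matrix n n ℂ}
    {b : (σ → ℂ) → n → ℂ} (hM : ∀ i j, RegularAt v₀ fun v => M v i j)
    (hb : ∀ i, RegularAt v₀ fun v => b v i) (h0 : (M v₀).det ≠ 0) (u₀ : n → ℂ)
    (hu₀ : (M v₀).mulVec u₀ = b v₀) :
    ∃ u : (σ → ℂ) → n → ℂ, (∀ i, RegularAt v₀ fun v => u v i) ∧ u v₀ = u₀ ∧
      ∀ᶠ v in zariskiNhds v₀, (M v).mulVec (u v) = b v := by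
  refine ⟨fun v => (M v)⁻¹.mulVec (b v), fun i => ?_, ?_, ?_⟩
  · simp only [Matrix.mulVec, dotProduct, Matrix.inv_def, Matrix.smul_apply, smul_eq_mul,
      Ring.inverse_eq_inv', Matrix.adjugate_apply]
    refine sum _ fun j => (((det hM).inv h0).mul (det fun k l => ?_)).mul (hb j)
    simp only [Matrix.updateRow_apply]
    split_ifs
    · exact const _
    · exact hM k l
  · simp only
    rw [← hu₀, Matrix.mulVec_mulVec, Matrix.nonsing_inv_mul _ (isUnit_iff_ne_zero.2 h0),
      Matrix.one_mulVec]
  · filter_upwards [(det hM).eventually_ne_zero h0] with v hv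
    rw [Matrix.mulVec_mulVec, Matrix.mul_nonsing_inv _ (isUnit_iff_ne_zero.2 hv),
      Matrix.one_mulVec]

open Polynomial in
theorem eventually_separable {n : ℕ} {N : (σ → ℂ) → ℂ[X]}
    (hN : ∀ k, RegularAt v₀ fun v => (N v).coeff k) (hn : ∀ v, (N v).natDegree ≤ n + 1)
    (hn₀ : (N v₀).natDegree = n + 1) (h0 : (N v₀).Separable) :
    ∀ᶠ v in zariskiNhds v₀, (N v).Separable := by
  have hd : ∀ v, (N v).derivative.natDegree ≤ n := fun v =>
    (natDegree_derivative_le _).trans (by have := hn v; omega)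
  have hres : RegularAt v₀ fun v => resultant (N v) (N v).derivative (n + 1) n := by
    refine det fun i j => ?_
    simp only [sylvester, Matrix.of_apply]
    induction j using Fin.addCases with
    | left j =>
      simp only [Fin.addCases_left, coeff_derivative]
      split_ifs
      · exact (hN _).mul (const _)
      · exact const _
    | right j =>
      simp only [Fin.addCases_right]
      split_ifs
      · exact hN _
      · exact const _
  have hd₀ : (N v₀).derivative.natDegree = n := by
    rw [natDegree_derivative, hn₀, Nat.add_sub_cancel]
  have hres₀ : resultant (N v₀) (N v₀).derivative (n + 1) n ≠ 0 := by
    have := resultant_ne_zero (N v₀) (N v₀).derivative h0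
    rwa [hn₀, hd₀] at this
  filter_upwards [hres.eventually_ne_zero hres₀] with v hv
  obtain ⟨a, b, -, -, hab⟩ := exists_mul_add_mul_eq_C_resultant (N v) (N v).derivative (hn v)
    (hd v) (by simp)
  refine ⟨C (resultant (N v) (N v).derivative (n + 1) n)⁻¹ * a,
    C (resultant (N v) (N v).derivative (n + 1) n)⁻¹ * b, ?_⟩
  rw [mul_assoc, mul_assoc, ← mul_add, mul_comm a, mul_comm b, hab, ← C_mul, inv_mul_cancel₀ hv,
    C_1]

end RegularAt

theorem chordMatrix_map {K L : Type*} [CommRing K] [CommRing L] (f : K →+* L) (X Y : Fin 4 → K)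
    (z : Fin 3 → K) : (chordMatrix X Y z).map f = chordMatrix (f ∘ X) (f ∘ Y) (f ∘ z) := by
  ext i k
  fin_cases k <;> simp [chordMatrix]

open Polynomial in
theorem coeffPoly_map {K L : Type*} [CommRing K] [CommRing L] (f : K →+* L) {n : ℕ}
    (u : Fin n → K) : (coeffPoly u).map f = coeffPoly (f ∘ u) := by
  simp [coeffPoly, Polynomial.map_sum]

open Polynomial in
theorem separable_of_injective_roots {K : Type*} [Field K] {n : ℕ} {N : K[X]} (hN : N ≠ 0)
    (hn : N.natDegree = n) {t : Fin n → K} (ht : Function.Injective t)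
    (h : ∀ i, N.eval (t i) = 0) : N.Separable := by
  have hle : Finset.univ.val.map t ≤ N.roots := by
    rw [Multiset.le_iff_subset (Finset.univ.nodup.map ht)]
    intro s hs
    obtain ⟨i, -, rfl⟩ := Multiset.mem_map.1 hs
    exact (mem_roots hN).2 (h i)
  have heq : Finset.univ.val.map t = N.roots :=
    Multiset.eq_of_le_of_card_le hle (by simpa [hn] using card_roots' N)
  have hsplits : N.Splits := splits_iff_card_roots.2 (by rw [← heq, hn]; simp)
  exact (nodup_roots_iff_of_splits hN hsplits).1 (heq ▸ Finset.univ.nodup.map ht)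

namespace RegularAt

variable {σ : Type*} {v₀ : σ → ℂ}

theorem eventually_injective {ι : Type*} [Finite ι] {F : (σ → ℂ) → ι → ℂ}
    (hF : ∀ i, RegularAt v₀ fun v => F v i) (h0 : Function.Injective (F v₀)) :
    ∀ᶠ v in zariskiNhds v₀, Function.Injective (F v) := by
  have h : ∀ᶠ v in zariskiNhds v₀, ∀ i j, i ≠ j → F v i ≠ F v j := by
    refine Filter.eventually_all.2 fun i => Filter.eventually_all.2 fun j => ?_
    by_cases hij : i = j
    · exact Filter.Eventually.of_forall fun v h => absurd hij h
    · exact ((hF i).eventually_ne (hF j) (h0.ne hij)).mono fun v h _ => h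
  exact h.mono fun v h i j hij => by_contra fun hne => h i j hne hij

/-- The ring of functions that are regular at a point. -/
def subring (v₀ : σ → ℂ) : Subring ((σ → ℂ) → ℂ) where
  carrier := {f | RegularAt v₀ f}
  mul_mem' := mul
  one_mem' := const 1
  add_mem' := add
  zero_mem' := const 0
  neg_mem' := neg

/-- Evaluation of regular functions. -/
def evalHom (v₀ v : σ → ℂ) : subring v₀ →+* ℂ :=
  (Pi.evalRingHom (fun _ => ℂ) v).comp (subring v₀).subtype

theorem evalHom_apply (s : subring v₀) : RegularAt v₀ fun v => evalHom v₀ v s := s.2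

theorem exists_lift {ι : Type*} {F : (σ → ℂ) → ι → ℂ} (hF : ∀ i, RegularAt v₀ fun v => F v i) :
    ∃ F' : ι → subring v₀, ∀ v, F v = evalHom v₀ v ∘ F' :=
  ⟨fun i => ⟨_, hF i⟩, fun _ => rfl⟩

variable {P Q : (σ → ℂ) → Fin 3 → ℂ} {X Y ρ e : (σ → ℂ) → Fin 4 → ℂ} {x y : (σ → ℂ) → Fin 5 → ℂ}
  {a : (σ → ℂ) → ℂ}

theorem nodeX (hP : ∀ k, RegularAt v₀ fun v => P v k) (hQ : ∀ k, RegularAt v₀ fun v => Q v k)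
    (i : Fin 4) : RegularAt v₀ fun v => _root_.nodeX (P v) (Q v) i := by
  obtain ⟨P', hP'⟩ := exists_lift hP
  obtain ⟨Q', hQ'⟩ := exists_lift hQ
  simp only [hP', hQ', ← nodeX_map]
  exact evalHom_apply _

theorem nodeY (hP : ∀ k, RegularAt v₀ fun v => P v k) (hQ : ∀ k, RegularAt v₀ fun v => Q v k)
    (i : Fin 4) : RegularAt v₀ fun v => _root_.nodeY (P v) (Q v) i := by
  obtain ⟨P', hP'⟩ := exists_lift hP
  obtain ⟨Q', hQ'⟩ := exists_lift hQ
  simp only [hP', hQ', ← nodeY_map]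
  exact evalHom_apply _

theorem pencilMatrix {z : (σ → ℂ) → Fin 3 → Fin 5 → ℂ} (hz : ∀ i j, RegularAt v₀ fun v => z v i j)
    (i j : Fin 6) : RegularAt v₀ fun v => _root_.pencilMatrix (z v) i j := by
  obtain ⟨z', hz'⟩ : ∃ z' : Fin 3 → Fin 5 → subring v₀, ∀ v, z v = fun i j => evalHom v₀ v (z' i j) :=
    ⟨fun i j => ⟨_, hz i j⟩, fun _ => rfl⟩
  simp only [hz', ← pencilMatrix_map, Matrix.map_apply]
  exact evalHom_apply _

theorem chordMatrix {z : (σ → ℂ) → Fin 3 → ℂ} (hX : ∀ i, RegularAt v₀ fun v => X v i)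
    (hY : ∀ i, RegularAt v₀ fun v => Y v i) (hz : ∀ i, RegularAt v₀ fun v => z v i) (i j : Fin 3) :
    RegularAt v₀ fun v => _root_.chordMatrix (X v) (Y v) (z v) i j := by
  obtain ⟨X', hX'⟩ := exists_lift hX
  obtain ⟨Y', hY'⟩ := exists_lift hY
  obtain ⟨z', hz'⟩ := exists_lift hz
  simp only [hX', hY', hz', ← chordMatrix_map, Matrix.map_apply]
  exact evalHom_apply _

theorem interpMatrix (hX : ∀ i, RegularAt v₀ fun v => X v i) (hY : ∀ i, RegularAt v₀ fun v => Y v i)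
    (hρ : ∀ i, RegularAt v₀ fun v => ρ v i) (hx : ∀ i, RegularAt v₀ fun v => x v i)
    (hy : ∀ i, RegularAt v₀ fun v => y v i) (i j : Fin 13) :
    RegularAt v₀ fun v => _root_.interpMatrix (X v) (Y v) (ρ v) (x v) (y v) i j := by
  obtain ⟨X', hX'⟩ := exists_lift hX
  obtain ⟨Y', hY'⟩ := exists_lift hY
  obtain ⟨ρ', hρ'⟩ := exists_lift hρ
  obtain ⟨x', hx'⟩ := exists_lift hx
  obtain ⟨y', hy'⟩ := exists_lift hy
  simp only [hX', hY', hρ', hx', hy', ← interpMatrix_map, Matrix.map_apply]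
  exact evalHom_apply _

theorem interpRhs (hX : ∀ i, RegularAt v₀ fun v => X v i) (hY : ∀ i, RegularAt v₀ fun v => Y v i)
    (he : ∀ i, RegularAt v₀ fun v => e v i) (hx : ∀ i, RegularAt v₀ fun v => x v i)
    (ha : RegularAt v₀ a) (i : Fin 13) :
    RegularAt v₀ fun v => _root_.interpRhs (X v) (Y v) (e v) (x v) (a v) i := by
  obtain ⟨X', hX'⟩ := exists_lift hX
  obtain ⟨Y', hY'⟩ := exists_lift hY
  obtain ⟨e', he'⟩ := exists_lift he
  obtain ⟨x', hx'⟩ := exists_lift hx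
  have ha' : ∀ v, a v = evalHom v₀ v ⟨a, ha⟩ := fun _ => rfl
  simp only [hX', hY', he', hx', ha', ← interpRhs_map]
  exact evalHom_apply _

theorem coeff_sq_sub_mul_sq {k m n : ℕ} {p : (σ → ℂ) → Fin k → ℂ} {q : (σ → ℂ) → Fin m → ℂ}
    {r : (σ → ℂ) → Fin n → ℂ} (hp : ∀ i, RegularAt v₀ fun v => p v i)
    (hq : ∀ i, RegularAt v₀ fun v => q v i) (hr : ∀ i, RegularAt v₀ fun v => r v i) (i : ℕ) :
    RegularAt v₀ fun v =>
      (coeffPoly (p v) ^ 2 - coeffPoly (q v) * coeffPoly (r v) ^ 2).coeff i := by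
  obtain ⟨p', hp'⟩ := exists_lift hp
  obtain ⟨q', hq'⟩ := exists_lift hq
  obtain ⟨r', hr'⟩ := exists_lift hr
  simp only [hp', hq', hr', ← coeffPoly_map, ← Polynomial.map_pow, ← Polynomial.map_mul,
    ← Polynomial.map_sub, Polynomial.coeff_map]
  exact evalHom_apply _

end RegularAt

theorem eventually_exists_second_coordinates {σ : Type*} {v₀ : σ → ℂ}
    {z : (σ → ℂ) → Fin 3 → Fin 5 → ℂ} {e : (σ → ℂ) → Fin 4 → ℂ}
    (hz : ∀ i j, RegularAt v₀ fun v => z v i j) (he : ∀ i, RegularAt v₀ fun v => e v i)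
    (hz0 : z v₀ = fun i j => Int.castRingHom ℂ (refZ i j)) (he0 : e v₀ = Int.castRingHom ℂ ∘ refE) :
    ∀ᶠ v in zariskiNhds v₀, ∃ φ : Fin 5 → Fin 5 → ℂ, ∃ d : Fin 5 → ℂ, (∀ k, d k ≠ 0) ∧
      (∀ i, ¬ (φ 0 0 = Fin.snoc (n := 3) (α := fun _ => Fin 5 → ℂ) (z v) 0 i 0 ∧
        φ 0 1 = Fin.snoc (n := 3) (α := fun _ => Fin 5 → ℂ) (z v) 0 i 1)) ∧
      ∀ r : Fin 5 → Fin 2, ∑ i, (e v i)⁻¹ * ∏ j, (if r j = 0 then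
          Fin.snoc (n := 3) (α := fun _ => Fin 5 → ℂ) (z v) 0 i j else 1) +
        (if r = 0 then 1 else 0) = ∑ k, d k * ∏ j, (if r j = 0 then φ k j else 1) := by
  set f := Int.castRingHom ℂ with hf
  have hfinj : Function.Injective f := Int.cast_injective
  obtain ⟨w, hwr, hw0, hw⟩ := RegularAt.exists_mulVec_eq (v₀ := v₀) (M := fun v => pencilMatrix (z v))
    (b := fun _ => f ∘ ![0, 0, 0, 0, 0, 1]) (RegularAt.pencilMatrix hz)
    (fun _ => RegularAt.const _) (by rw [hz0, ← pencilMatrix_map]; exact det_refPencil_ne_zero)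
    (f ∘ refW) (by
      rw [hz0, ← pencilMatrix_map, ← refW_eq]
      exact funext fun i => (f.map_mulVec _ _ i).symm)
  obtain ⟨P, hP⟩ : ∃ P : (σ → ℂ) → Fin 3 → ℂ, P = fun v (k : Fin 3) => w v (Fin.castAdd 3 k) :=
    ⟨_, rfl⟩
  obtain ⟨Q, hQ⟩ : ∃ Q : (σ → ℂ) → Fin 3 → ℂ, Q = fun v (k : Fin 3) => w v (Fin.natAdd 3 k) :=
    ⟨_, rfl⟩
  have hPr : ∀ k, RegularAt v₀ fun v => P v k := fun k => by rw [hP]; exact hwr _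
  have hQr : ∀ k, RegularAt v₀ fun v => Q v k := fun k => by rw [hQ]; exact hwr _
  obtain ⟨X, hX⟩ : ∃ X : (σ → ℂ) → Fin 4 → ℂ, X = fun v => nodeX (P v) (Q v) := ⟨_, rfl⟩
  obtain ⟨Y, hY⟩ : ∃ Y : (σ → ℂ) → Fin 4 → ℂ, Y = fun v => nodeY (P v) (Q v) := ⟨_, rfl⟩
  have hXr : ∀ i, RegularAt v₀ fun v => X v i := fun i => by
    rw [hX]; exact RegularAt.nodeX hPr hQr i
  have hYr : ∀ i, RegularAt v₀ fun v => Y v i := fun i => by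
    rw [hY]; exact RegularAt.nodeY hPr hQr i
  have hX0 : X v₀ = f ∘ refX := by
    rw [refX_eq, nodeX_map, hX, hP, hQ]
    simp only [hw0]
    rfl
  have hY0 : Y v₀ = f ∘ refY := by
    rw [refY_eq, nodeY_map, hY, hP, hQ]
    simp only [hw0]
    rfl
  have hΔ0 : ∀ j, (chordMatrix (X v₀) (Y v₀) fun i => z v₀ i j).det ≠ 0 := by
    intro j
    rw [hX0, hY0, hz0]
    change (chordMatrix (f ∘ refX) (f ∘ refY) (f ∘ fun i => refZ i j)).det ≠ 0
    rw [← chordMatrix_map, ← RingHom.mapMatrix_apply, ← RingHom.map_det]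
    exact (map_ne_zero_iff f hfinj).2 (det_refChord_ne_zero j)
  choose l hlr hl0 hl using fun j => RegularAt.exists_mulVec_eq (v₀ := v₀)
    (M := fun v => chordMatrix (X v) (Y v) fun i => z v i j)
    (b := fun v i => z v i j * X v i.castSucc) (RegularAt.chordMatrix hXr hYr fun i => hz i j)
    (fun i => (hz i j).mul (hXr _)) (hΔ0 j) (f ∘ refL j) (by
      have h1 : (fun i => z v₀ i j * X v₀ i.castSucc) =
          f ∘ fun i => refZ i j * refX i.castSucc := by
        ext i
        simp [hz0, hX0, hf]
      have h2 : (fun i => z v₀ i j) = f ∘ fun i => refZ i j := by rw [hz0]; rfl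
      rw [h1, h2, hX0, hY0, ← chordMatrix_map, ← refL_eq]
      exact funext fun i => (f.map_mulVec _ _ i).symm)
  obtain ⟨x, hx⟩ : ∃ x : (σ → ℂ) → Fin 5 → ℂ, x = fun v j => l j v 0 := ⟨_, rfl⟩
  have hxr : ∀ j, RegularAt v₀ fun v => x v j := fun j => by rw [hx]; exact hlr j 0
  have hx0 : x v₀ = f ∘ fun j => refL j 0 := by
    rw [hx]
    exact funext fun j => congrFun (hl0 j) 0
  have hinj0 : Function.Injective (Sum.elim (X v₀) (x v₀)) := by
    rw [hX0, hx0, ← Sum.comp_elim]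
    exact hfinj.comp refXL_injective
  have hα0 : ∀ j, l j v₀ 1 ≠ 0 := by
    intro j
    rw [hl0 j]
    refine (map_ne_zero_iff f hfinj).2 ?_
    revert j
    decide
  obtain ⟨y, hy⟩ : ∃ y : (σ → ℂ) → Fin 5 → ℂ,
    y = fun v j => Y v 3 - l j v 2 * l j v 0 / l j v 1 := ⟨_, rfl⟩
  have hyr : ∀ j, RegularAt v₀ fun v => y v j := fun j => by
    rw [hy]; exact (hYr 3).sub (((hlr j 2).mul (hlr j 0)).div (hlr j 1) (hα0 j))
  have hy0 : y v₀ = f ∘ refy := by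
    ext j
    have h1 := congrArg f (refy_eq j)
    have h2 := hα0 j
    simp only [hy, hl0, hY0, Function.comp_apply, map_mul, map_sub] at h1 h2 ⊢
    field_simp
    linear_combination -h1
  obtain ⟨r, hrr, hr0, hr⟩ := RegularAt.exists_mulVec_eq (v₀ := v₀)
    (M := fun v => Matrix.vandermonde (X v)) (b := fun v i => Y v i ^ 2)
    (fun i j => (hXr i).pow _) (fun i => (hYr i).pow 2)
    (Matrix.det_vandermonde_ne_zero_iff.2 (hinj0.comp Sum.inl_injective)) (f ∘ refR) (by
      have h1 : (fun i => Y v₀ i ^ 2) = f ∘ fun i => refY i ^ 2 := by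
        ext i
        simp [hY0]
      have h2 : Matrix.vandermonde (X v₀) = (Matrix.vandermonde refX).map f := by
        ext i j
        simp [Matrix.vandermonde_apply, hX0]
      rw [h1, h2, ← refR_eq]
      exact funext fun i => (f.map_mulVec _ _ i).symm)
  obtain ⟨ρ, hρ⟩ : ∃ ρ : (σ → ℂ) → Fin 4 → ℂ,
    ρ = fun v i => r v 1 + 2 * r v 2 * X v i + 3 * r v 3 * X v i ^ 2 := ⟨_, rfl⟩
  have hρr : ∀ i, RegularAt v₀ fun v => ρ v i := fun i => by
    rw [hρ]
    exact ((hrr 1).add (((RegularAt.const 2).mul (hrr 2)).mul (hXr i))).add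
      (((RegularAt.const 3).mul (hrr 3)).mul ((hXr i).pow 2))
  have hρ0 : ρ v₀ = f ∘ refρ := by
    ext i
    simp [hρ, hr0, hX0, refρ, hf]
  obtain ⟨a, ha⟩ : ∃ a : (σ → ℂ) → ℂ, a = fun v => -(r v 3 ^ 2 * ∏ j, l j v 1) := ⟨_, rfl⟩
  have har : RegularAt v₀ a := by
    rw [ha]
    exact (((hrr 3).pow 2).mul (RegularAt.prod _ fun j => hlr j 1)).neg
  have ha0 : a v₀ = f (-113135022000) := by
    rw [refA_eq, ha]
    simp only [hr0, hl0, map_neg, map_mul, map_pow, map_prod, Function.comp_apply]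
  have ha0' : a v₀ ≠ 0 := by
    rw [ha0]
    exact (map_ne_zero_iff f hfinj).2 (by norm_num)
  obtain ⟨u, hur, hu0, hu⟩ := RegularAt.exists_mulVec_eq (v₀ := v₀)
    (M := fun v => interpMatrix (X v) (Y v) (ρ v) (x v) (y v))
    (b := fun v => interpRhs (X v) (Y v) (e v) (x v) (a v))
    (RegularAt.interpMatrix hXr hYr hρr hxr hyr) (RegularAt.interpRhs hXr hYr he hxr har)
    (by rw [hX0, hY0, hρ0, hx0, hy0, ← interpMatrix_map]; exact det_refInterp_ne_zero)
    (f ∘ refU) (by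
      rw [hX0, hY0, hρ0, hx0, hy0, he0, ha0, ← interpMatrix_map, ← interpRhs_map, ← refU_eq]
      exact funext fun i => (f.map_mulVec _ _ i).symm)
  obtain ⟨p, hp⟩ : ∃ p : (σ → ℂ) → Fin 8 → ℂ, p = fun v =>
    Fin.snoc (n := 7) (α := fun _ => ℂ) (fun k => u v (Fin.castAdd 6 k)) (a v) := ⟨_, rfl⟩
  obtain ⟨q, hq⟩ : ∃ q : (σ → ℂ) → Fin 6 → ℂ, q = fun v k => u v (Fin.natAdd 7 k) := ⟨_, rfl⟩
  have hpr : ∀ k, RegularAt v₀ fun v => p v k := by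
    intro k
    simp only [hp]
    induction k using Fin.lastCases with
    | last => simpa only [Fin.snoc_last] using har
    | cast k => simpa only [Fin.snoc_castSucc] using hur _
  have hqr : ∀ k, RegularAt v₀ fun v => q v k := fun k => by rw [hq]; exact hur _
  have hp0 : p v₀ = f ∘ Fin.snoc (n := 7) (α := fun _ => ℤ) (fun k => refU (Fin.castAdd 6 k))
      (-113135022000) := by
    ext k
    simp only [hp, Function.comp_apply]
    induction k using Fin.lastCases with
    | last => simp only [Fin.snoc_last, ha0]
    | cast k => simp only [Fin.snoc_castSucc, hu0, Function.comp_apply]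
  have hq0 : q v₀ = f ∘ fun k : Fin 6 => refU (Fin.natAdd 7 k) := by
    ext k
    simp only [hq, hu0, Function.comp_apply]
  have hpl : ∀ v, p v (Fin.last 7) = a v := fun v => by simp only [hp, Fin.snoc_last]
  have hsub : ∀ v, (coeffPoly (r v) * coeffPoly (q v) ^ 2).natDegree ≤ 13 := fun v =>
    Polynomial.natDegree_mul_le_of_le (natDegree_coeffPoly_le _)
      (Polynomial.natDegree_pow_le_of_le 2 (natDegree_coeffPoly_le (q v)))
  have hdeg : ∀ v, (coeffPoly (p v) ^ 2 - coeffPoly (r v) * coeffPoly (q v) ^ 2).natDegree ≤ 13 + 1 :=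
    fun v => (Polynomial.natDegree_sub_le _ _).trans (max_le
      (Polynomial.natDegree_pow_le_of_le 2 (natDegree_coeffPoly_le (p v)))
      ((hsub v).trans (Nat.le_succ 13)))
  have hcoeff : (coeffPoly (p v₀) ^ 2 - coeffPoly (r v₀) * coeffPoly (q v₀) ^ 2).coeff 14 ≠ 0 := by
    rw [Polynomial.coeff_sub, Polynomial.coeff_eq_zero_of_natDegree_lt ((hsub v₀).trans_lt
      (by norm_num : 13 < 14)), sub_zero, Polynomial.coeff_pow_of_natDegree_le (m := 2) (n := 7)
      (natDegree_coeffPoly_le (p v₀))]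
    rw [show (coeffPoly (p v₀)).coeff 7 = a v₀ from (coeff_coeffPoly _ (Fin.last 7)).trans (hpl _)]
    exact pow_ne_zero 2 ha0'
  have hdeg0 := Polynomial.natDegree_eq_of_le_of_coeff_ne_zero (hdeg v₀) hcoeff
  have hsep0 : (coeffPoly (p v₀) ^ 2 - coeffPoly (r v₀) * coeffPoly (q v₀) ^ 2).Separable := by
    refine separable_of_injective_roots (n := 14) (fun h => hcoeff (by rw [h, Polynomial.coeff_zero]))
      hdeg0 (hfinj.comp refRoot_injective) fun i => ?_
    have h := congrArg f (eval_refRoot i)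
    simp only [map_sub, map_mul, map_pow, map_zero, coeffEval_map] at h
    simpa only [Polynomial.eval_sub, Polynomial.eval_mul, Polynomial.eval_pow, eval_coeffPoly,
      hp0, hq0, hr0, Function.comp_apply] using h
  have hsep := RegularAt.eventually_separable (RegularAt.coeff_sq_sub_mul_sq hpr hrr hqr) hdeg hdeg0
    hsep0
  have hinj := RegularAt.eventually_injective (F := fun v => Sum.elim (X v) (x v))
    (by rintro (i | j); exacts [hXr i, hxr j]) hinj0
  have hΔ : ∀ᶠ v in zariskiNhds v₀, ∀ j, (chordMatrix (X v) (Y v) fun i => z v i j).det ≠ 0 :=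
    Filter.eventually_all.2 fun j =>
      (RegularAt.det (RegularAt.chordMatrix hXr hYr fun i => hz i j)).eventually_ne_zero (hΔ0 j)
  obtain ⟨zs, hzs⟩ : ∃ zs : (σ → ℂ) → Fin 4 → Fin 5 → ℂ,
    zs = fun v => Fin.snoc (n := 3) (α := fun _ => Fin 5 → ℂ) (z v) 0 := ⟨_, rfl⟩
  have hzsr : ∀ i j, RegularAt v₀ fun v => zs v i j := by
    intro i j
    simp only [hzs]
    induction i using Fin.lastCases with
    | last => simpa only [Fin.snoc_last, Pi.zero_apply] using RegularAt.const 0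
    | cast i => simpa only [Fin.snoc_castSucc] using hz i j
  have hzs0 : ∀ i j, zs v₀ i j =
      f (Fin.snoc (n := 3) (α := fun _ => Fin 5 → ℤ) refZ 0 i j) := by
    intro i j
    simp only [hzs]
    induction i using Fin.lastCases with
    | last => simp only [Fin.snoc_last, Pi.zero_apply, map_zero]
    | cast i => simp only [Fin.snoc_castSucc, hz0]
  have hslope : ∀ᶠ v in zariskiNhds v₀, ∀ i,
      (zs v i 0 - l 0 v 2) * l 1 v 1 ≠ (zs v i 1 - l 1 v 2) * l 0 v 1 := by
    refine Filter.eventually_all.2 fun i => RegularAt.eventually_ne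
      (((hzsr i 0).sub (hlr 0 2)).mul (hlr 1 1)) (((hzsr i 1).sub (hlr 1 2)).mul (hlr 0 1)) ?_
    simp only [hzs0, hl0, Function.comp_apply, ← map_sub, ← map_mul]
    exact hfinj.ne (refSlope_ne i)
  filter_upwards [hw, Filter.eventually_all.2 hl, hr, hu, hsep, hinj, hΔ, hslope,
    har.eventually_ne_zero ha0'] with v hw hl hr hu hsep hinj hΔ hslope hav
  subst hP hQ hX hY hx hy hρ ha hp hq hzs
  refine exists_second_coordinates_of_systems (w := w v) rfl rfl rfl rfl (fun j => ?_)
    (l := fun j => l j v) hl hr rfl rfl rfl rfl hav hu hinj hΔ hsep rfl hslope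
  rw [hw]
  fin_cases j <;> simp

/-- The vectors of the reference point, normalised so that the last two summands are built from
the standard basis. -/
noncomputable def refPoint : Fin 5 × Fin 5 × Fin 2 → ℂ := fun p =>
  (Fin.snoc (n := 4) (α := fun _ => Fin 5 → Fin 2 → ℂ)
    (Fin.snoc (n := 3) (α := fun _ => Fin 5 → Fin 2 → ℂ)
      (fun i j => if j = 0 then ![(refZ i 0 : ℂ) / refE i.castSucc, (refE 3 : ℂ) / refE i.castSucc]
        else ![(refZ i j : ℂ), 1]) fun _ => ![0, 1]) fun _ => ![1, 0]) p.1 p.2.1 p.2.2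

theorem segre_P1_pow5_not_4identifiable :
    ∃ P : MvPolynomial (Fin 5 × Fin 5 × Fin 2) ℂ, P ≠ 0 ∧
      ∀ v : Fin 5 → Fin 5 → Fin 2 → ℂ,
        MvPolynomial.eval (fun p => v p.1 p.2.1 p.2.2) P ≠ 0 →
        ∃ D₁ D₂ : Multiset (BinTensor 5), D₁ ≠ D₂ ∧
          IsDecomposition 5 (∑ i : Fin 5, ⨂ₜ[ℂ] j, v i j) D₁ ∧
          IsDecomposition 5 (∑ i : Fin 5, ⨂ₜ[ℂ] j, v i j) D₂ := by
  suffices h : ∀ᶠ v in zariskiNhds refPoint,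
      ∃ D₁ D₂ : Multiset (BinTensor 5), D₁ ≠ D₂ ∧
        IsDecomposition 5 (∑ i : Fin 5, ⨂ₜ[ℂ] j, fun k => v (i, j, k)) D₁ ∧
        IsDecomposition 5 (∑ i : Fin 5, ⨂ₜ[ℂ] j, fun k => v (i, j, k)) D₂ by
    rw [eventually_zariskiNhds] at h
    obtain ⟨q, hq, h⟩ := h
    exact ⟨q, fun h0 => hq (by rw [h0, map_zero]), fun v hv => h (fun p => v p.1 p.2.1 p.2.2) hv⟩
  have hE : ∀ i, (refE i : ℂ) ≠ 0 := fun i => Int.cast_ne_zero.2 (by revert i; decide)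
  have h3 : ∀ j, refPoint (3, j, 0) = 0 ∧ refPoint (3, j, 1) = 1 := fun j => by
    simp [refPoint, Fin.snoc]
  have h4 : ∀ j, refPoint (4, j, 0) = 1 ∧ refPoint (4, j, 1) = 0 := fun j => by
    simp [refPoint, Fin.snoc]
  have h00 : ∀ i : Fin 3, refPoint (i.castSucc.castSucc, 0, 0) = refZ i 0 / refE i.castSucc ∧
      refPoint (i.castSucc.castSucc, 0, 1) = refE 3 / refE i.castSucc := fun i => by
    simp only [refPoint, Fin.snoc_castSucc]
    simp
  have h0 : ∀ (i : Fin 3) (j : Fin 5), j ≠ 0 → refPoint (i.castSucc.castSucc, j, 0) = refZ i j ∧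
      refPoint (i.castSucc.castSucc, j, 1) = 1 := fun i j hj => by
    simp only [refPoint, Fin.snoc_castSucc]
    simp [hj]
  obtain ⟨s, hs⟩ : ∃ s : Fin 5 → ℂ, s = fun j => if j = 0 then (refE 3 : ℂ) else 1 := ⟨_, rfl⟩
  have hs0 : ∀ j, s j ≠ 0 := fun j => by
    rw [hs]; dsimp only; split_ifs; exacts [hE 3, one_ne_zero]
  have hsprod : ∏ j, s j = refE 3 := by simp [hs]
  obtain ⟨D, hD⟩ : ∃ D : (Fin 5 × Fin 5 × Fin 2 → ℂ) → Fin 5 → ℂ, D = fun v j =>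
    v (4, j, 0) * (s j * v (3, j, 1)) - v (4, j, 1) * (s j * v (3, j, 0)) := ⟨_, rfl⟩
  obtain ⟨μ, hμ⟩ : ∃ μ : (Fin 5 × Fin 5 × Fin 2 → ℂ) → Fin 3 → Fin 5 → ℂ, μ = fun v i j =>
    (v (i.castSucc.castSucc, j, 0) * (s j * v (3, j, 1)) -
      v (i.castSucc.castSucc, j, 1) * (s j * v (3, j, 0))) / D v j := ⟨_, rfl⟩
  obtain ⟨ν, hν⟩ : ∃ ν : (Fin 5 × Fin 5 × Fin 2 → ℂ) → Fin 3 → Fin 5 → ℂ, ν = fun v i j =>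
    (v (4, j, 0) * v (i.castSucc.castSucc, j, 1) -
      v (4, j, 1) * v (i.castSucc.castSucc, j, 0)) / D v j := ⟨_, rfl⟩
  have hcr : ∀ t, RegularAt refPoint fun v => v t := fun t => RegularAt.coord t
  have hDr : ∀ j, RegularAt refPoint fun v => D v j := fun j => by
    rw [hD]
    exact ((hcr _).mul ((RegularAt.const _).mul (hcr _))).sub
      ((hcr _).mul ((RegularAt.const _).mul (hcr _)))
  have hD0 : ∀ j, D refPoint j = s j := fun j => by
    simp [hD, h3, h4]
  have hD0' : ∀ j, D refPoint j ≠ 0 := fun j => by rw [hD0]; exact hs0 j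
  have hμr : ∀ i j, RegularAt refPoint fun v => μ v i j := fun i j => by
    rw [hμ]
    exact (((hcr _).mul ((RegularAt.const _).mul (hcr _))).sub
      ((hcr _).mul ((RegularAt.const _).mul (hcr _)))).div (hDr j) (hD0' j)
  have hνr : ∀ i j, RegularAt refPoint fun v => ν v i j := fun i j => by
    rw [hν]
    exact (((hcr _).mul (hcr _)).sub ((hcr _).mul (hcr _))).div (hDr j) (hD0' j)
  have hμ0 : ∀ i j, μ refPoint i j = refPoint (i.castSucc.castSucc, j, 0) := fun i j => by
    have := hs0 j
    simp only [hμ, hD0, h3]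
    field_simp
    ring
  have hν0 : ∀ i j, ν refPoint i j = if j = 0 then (refE i.castSucc : ℂ)⁻¹ else 1 := fun i j => by
    have := hE 3
    simp only [hν, hD0, h4, hs]
    split_ifs with hj
    · subst hj
      rw [(h00 i).2]
      field_simp
      ring
    · rw [(h0 i j hj).2]
      ring
  have hν0' : ∀ i j, ν refPoint i j ≠ 0 := fun i j => by
    rw [hν0]; split_ifs; exacts [inv_ne_zero (hE _), one_ne_zero]
  obtain ⟨e, he⟩ : ∃ e : (Fin 5 × Fin 5 × Fin 2 → ℂ) → Fin 4 → ℂ, e = fun v =>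
    Fin.snoc (n := 3) (α := fun _ => ℂ) (fun i => (∏ j, ν v i j)⁻¹) (refE 3 : ℂ) := ⟨_, rfl⟩
  have her : ∀ i, RegularAt refPoint fun v => e v i := fun i => by
    simp only [he]
    induction i using Fin.lastCases with
    | last => simpa only [Fin.snoc_last] using RegularAt.const _
    | cast i =>
      simpa only [Fin.snoc_castSucc] using (RegularAt.prod _ (hνr i)).inv
        (Finset.prod_ne_zero_iff.2 fun j _ => hν0' i j)
  have hzr : ∀ i j, RegularAt refPoint fun v => μ v i j / ν v i j := fun i j =>
    (hμr i j).div (hνr i j) (hν0' i j)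
  have key := eventually_exists_second_coordinates (z := fun v i j => μ v i j / ν v i j) hzr her
    (by
      ext i j
      rw [hμ0, hν0]
      split_ifs with hj
      · subst hj
        rw [(h00 i).1]
        have := hE i.castSucc
        field_simp
        rfl
      · rw [(h0 i j hj).1, div_one]
        rfl)
    (by
      ext i
      simp only [he]
      induction i using Fin.lastCases with
      | last => rw [Fin.snoc_last]; rfl
      | cast i =>
        rw [Fin.snoc_castSucc, Fin.prod_univ_succ]
        simp [hν0])
  have hDne : ∀ᶠ v in zariskiNhds refPoint, ∀ j, D v j ≠ 0 :=
    Filter.eventually_all.2 fun j => (hDr j).eventually_ne_zero (hD0' j)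
  have hνne : ∀ᶠ v in zariskiNhds refPoint, ∀ i j, ν v i j ≠ 0 :=
    Filter.eventually_all.2 fun i => Filter.eventually_all.2 fun j =>
      (hνr i j).eventually_ne_zero (hν0' i j)
  filter_upwards [key, hDne, hνne] with v ⟨φ, d, hd, hne, h⟩ hDne hνne
  have hene : ∀ i, e v i ≠ 0 := fun i => by
    simp only [he]
    induction i using Fin.lastCases with
    | last => simpa only [Fin.snoc_last] using hE 3
    | cast i =>
      simpa only [Fin.snoc_castSucc] using inv_ne_zero
        (Finset.prod_ne_zero_iff.2 fun j _ => hνne i j)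
  refine exists_two_decompositions (v := fun i j k => v (i, j, k)) (fun j k => v (4, j, k))
    (fun j k => s j * v (3, j, k)) (fun j => by simpa only [hD] using hDne j) _
    (fun i => (e v i)⁻¹) (fun i => inv_ne_zero (hene i)) (fun i => ?_) rfl φ d hd hne h
  induction i using Fin.lastCases with
  | last =>
    simp only [he, Fin.snoc_last, Pi.zero_apply, zero_smul, zero_add]
    rw [← hsprod, eq_inv_smul_iff₀ (Finset.prod_ne_zero_iff.2 fun j _ => hs0 j),
      ← MultilinearMap.map_smul_univ]
    rfl
  | cast i =>
    simp only [he, Fin.snoc_castSucc, inv_inv]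
    rw [← MultilinearMap.map_smul_univ]
    congr 1
    ext j k
    have h1 := hDne j
    have h2 := hνne i j
    simp only [Pi.smul_apply, Pi.add_apply, smul_eq_mul]
    have h5 : ν v i j * (μ v i j / ν v i j * v (4, j, k) + s j * v (3, j, k)) =
        μ v i j * v (4, j, k) + ν v i j * (s j * v (3, j, k)) := by
      field_simp
    rw [h5]
    simp only [hμ, hν]
    rw [div_mul_eq_mul_div, div_mul_eq_mul_div, ← add_div, eq_div_iff h1]
    simp only [hD]
    fin_cases k <;> simp <;> ring
end
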